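/- Let n ≥ 1, s ∈ (0,1), A₀ > 0, and let Ω ⊂ ℝⁿ be a bounded C² domain. There exist α ∈ (0,1) and a constant C > 0 such that for every a ∈ [0, A₀], every g : Ω → ℝ with ‖g‖_{C^{0,1}(Ω)} ≤ 1, and every u ∈ C²(Ω) ∩ C(ℝⁿ) solving −Δu + a(−Δ)ˢu = g in Ω with u = 0 in Ωᶜ, one has for all x ∈ Ω: |D²u(x)| ≤ C·dist(x,∂Ω)^{α−1}, and |(−Δ)ˢu(x)| ≤ C(1 + 𝟙_{s<1/2} + 𝟙_{s=1/2}|log dist(x,∂Ω)| + 𝟙_{s>1/2} dist(x,∂Ω)^{1−2s}). -/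

import Mathlib

open MeasureTheory Real Set Metric Bornology Filter
open scoped RealInnerProductSpace ENNReal NNReal Pointwise

noncomputable section

abbrev En (n : ℕ) : Type := EuclideanSpace ℝ (Fin n)

/-- The normalizing constant `c_{n,s}`. -/
def cK (n : ℕ) (s : ℝ) : ℝ :=
  s * (2 : ℝ) ^ (2 * s) * Real.Gamma (((n : ℝ) + 2 * s) / 2) /
    (Real.pi ^ ((n : ℝ) / 2) * Real.Gamma (1 - s))

/-- The fractional Laplacian `(-Δ)ˢ u (x)`. -/
def fracLap (n : ℕ) (s : ℝ) (u : En n → ℝ) (x : En n) : ℝ :=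
  (cK n s / 2) * ∫ y : En n, (2 * u x - u (x + y) - u (x - y)) / ‖y‖ ^ ((n : ℝ) + 2 * s)

/-- `(-Δ)^{s/2} u (x)`, defined via the non-symmetrized integral. -/
def fracHalf (n : ℕ) (s : ℝ) (u : En n → ℝ) (x : En n) : ℝ :=
  cK n (s / 2) * ∫ z : En n, (u x - u (x + z)) / ‖z‖ ^ ((n : ℝ) + s)

/-- The squared Gagliardo-type seminorm `[u]_s²`. -/
def seminormSsq (n : ℕ) (s : ℝ) (u : En n → ℝ) : ℝ :=
  (cK n s / 2) * ∫ p : En n × En n, (u p.1 - u p.2) ^ 2 / ‖p.1 - p.2‖ ^ ((n : ℝ) + 2 * s)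

/-- The squared seminorm `[u]₁² = ∫_Ω |∇u|²`. -/
def seminorm1sq (n : ℕ) (Ω : Set (En n)) (u : En n → ℝ) : ℝ :=
  ∫ x in Ω, ‖gradient u x‖ ^ 2

/-- The Laplacian as the trace of the Hessian. -/
def lap (n : ℕ) (u : En n → ℝ) (x : En n) : ℝ :=
  ∑ i : Fin n, fderiv ℝ (fun y => fderiv ℝ u y (EuclideanSpace.single i 1)) x
    (EuclideanSpace.single i 1)

/-- The Hessian `D²u(x)` as a continuous bilinear-type map; `‖hess n u x‖` is its operator
norm. -/
def hess (n : ℕ) (u : En n → ℝ) (x : En n) : En n →L[ℝ] En n →L[ℝ] ℝ :=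
  fderiv ℝ (fderiv ℝ u) x

/-- A bounded C² domain `Ω ⊆ ℝⁿ`: a bounded open connected set whose boundary is a C²
hypersurface, described by a global C² defining function with nonvanishing gradient
on the boundary. -/
structure C2Domain (n : ℕ) where
  carrier : Set (En n)
  phi : En n → ℝ
  phi_smooth : ContDiff ℝ 2 phi
  carrier_eq : carrier = {x | phi x < 0}
  grad_ne : ∀ x ∈ frontier carrier, gradient phi x ≠ 0
  bounded : IsBounded carrier
  connected : IsConnected carrier

/-- The outward unit normal `ν` on `∂Ω`. -/
def C2Domain.nu {n : ℕ} (D : C2Domain n) (x : En n) : En n :=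
  ‖gradient D.phi x‖⁻¹ • gradient D.phi x

/-- The normal derivative `∂u/∂ν` at a boundary point (the derivative from inside). -/
def normalDeriv {n : ℕ} (D : C2Domain n) (u : En n → ℝ) (x : En n) : ℝ :=
  fderivWithin ℝ u (closure D.carrier) x (D.nu x)

/-- `Ω` is strictly star-shaped with respect to `z₀`. -/
def C2Domain.StrictlyStarShapedAt {n : ℕ} (D : C2Domain n) (z₀ : En n) : Prop :=
  z₀ ∈ D.carrier ∧ ∀ x ∈ frontier D.carrier, 0 < ⟪x - z₀, D.nu x⟫

/-- `Ω` is strictly star-shaped. -/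
def C2Domain.StrictlyStarShaped {n : ℕ} (D : C2Domain n) : Prop :=
  ∃ z₀, D.StrictlyStarShapedAt z₀

/-- The Pohozaev boundary term `∫_{∂Ω} (∂u/∂ν)² (x·ν(x)) dS`, with `dS` the
`(n-1)`-dimensional Hausdorff measure on `∂Ω`. -/
def pohozaevBoundary {n : ℕ} (D : C2Domain n) (u : En n → ℝ) : ℝ :=
  ∫ x in frontier D.carrier, (normalDeriv D u x) ^ 2 * ⟪x, D.nu x⟫ ∂ μH[(n : ℝ) - 1]

/-- Condition (★). -/
def StarCond (n : ℕ) (s : ℝ) (Ω : Set (En n)) (u : En n → ℝ) : Prop :=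
  ∃ C > 0, ∃ γ ∈ Set.Ioo (0:ℝ) 1, ∀ x ∈ Ω,
    ‖hess n u x‖ ≤ C * infDist x (frontier Ω) ^ (γ - 1) ∧
    |u x| ≤ C * infDist x (frontier Ω) ∧
    |fracLap n s u x| ≤ C * (1 + (if s < 1/2 then 1 else 0)
      + (if s = 1/2 then |Real.log (infDist x (frontier Ω))| else 0)
      + (if 1/2 < s then infDist x (frontier Ω) ^ (1 - 2*s) else 0))

section

open MeasureTheory Real Set Metric Bornology Filter
open scoped RealInnerProductSpace ENNReal NNReal Pointwise

/-- Radial profiles: `rp (i+1) = 2 (rp i)'`. -/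
def rp : ℕ → ℝ → ℝ
  | 0 => fun t => -expNegInvGlue (1 - t)
  | (i+1) => fun t => 2 * deriv (rp i) t

lemma rp_contDiff (i : ℕ) : ContDiff ℝ (⊤ : ℕ∞) (rp i) := by
  induction i with
  | zero =>
    unfold rp
    exact (expNegInvGlue.contDiff.comp (contDiff_const.sub contDiff_id)).neg
  | succ i ih =>
    unfold rp
    refine contDiff_const.mul ?_
    exact ((contDiff_infty_iff_deriv (𝕜 := ℝ)).1 ih).2

lemma rp_zero (i : ℕ) : ∀ t : ℝ, 1 ≤ t → rp i t = 0 := by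
  induction i with
  | zero =>
    intro t ht
    simp [rp, expNegInvGlue.zero_of_nonpos (show 1 - t ≤ 0 by linarith)]
  | succ i ih =>
    have h1 : ∀ t ∈ Ioi (1:ℝ), rp (i+1) t = 0 := by
      intro t ht
      have : rp i =ᶠ[nhds t] fun _ => 0 := by
        filter_upwards [Ioi_mem_nhds ht] with y hy using ih y (le_of_lt hy)
      simp [rp, this.deriv_eq]
    have h2 : ∀ t ∈ closure (Ioi (1:ℝ)), rp (i+1) t = 0 := by
      have hc : IsClosed {t | rp (i+1) t = 0} :=
        isClosed_eq (rp_contDiff (i+1)).continuous continuous_const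
      intro t ht
      exact (closure_minimal h1 hc) ht
    intro t ht
    exact h2 t (by simpa using ht)

lemma rp_one (t : ℝ) : rp 1 t = 2 * (((1 - t)⁻¹)^2 * expNegInvGlue (1 - t)) := by
  have h := expNegInvGlue.hasDerivAt_polynomial_eval_inv_mul 1 (1 - t)
  have h3 : HasDerivAt (fun t : ℝ => 1 - t) (-1) t := by
    simpa using (hasDerivAt_id t).const_sub 1
  have h2 := (h.comp t h3).neg
  have h4 : rp 0 = -((fun x => Polynomial.eval x⁻¹ 1 * expNegInvGlue x) ∘ fun t => 1 - t) := by
    ext t; simp [rp]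
  show 2 * deriv (rp 0) t = _
  rw [h4, h2.deriv]
  simp

/-- Radial weights. -/
def rW {n : ℕ} (i : ℕ) (z : En n) : ℝ := rp i (‖z‖^2)

variable {n : ℕ}

lemma rW_contDiff (i : ℕ) : ContDiff ℝ (⊤ : ℕ∞) (rW (n := n) i) :=
  (rp_contDiff i).comp (contDiff_norm_sq ℝ)

lemma rW_cont (i : ℕ) : Continuous (rW (n := n) i) := (rW_contDiff i).continuous

lemma rW_hasFDerivAt (i : ℕ) (z : En n) :
    HasFDerivAt (rW (n := n) i) (rW (i+1) z • innerSL ℝ z) z := by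
  have h1 : HasDerivAt (rp i) (deriv (rp i) (‖z‖^2)) (‖z‖^2) :=
    (((rp_contDiff i).differentiable (by simp)) _).hasDerivAt
  have h2 := (hasStrictFDerivAt_norm_sq z).hasFDerivAt
  have h3 := h1.comp_hasFDerivAt z h2
  have e1 : rW (i+1) z • innerSL ℝ z = deriv (rp i) (‖z‖^2) • (2 • innerSL ℝ z) := by
    ext e
    simp [rW, rp]
    ring
  rw [e1]
  exact h3

lemma rW_fderiv (i : ℕ) (z e : En n) :
    fderiv ℝ (rW (n := n) i) z e = rW (i+1) z * ⟪z, e⟫ := by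
  rw [(rW_hasFDerivAt i z).fderiv]; simp

lemma rW_zero (i : ℕ) {z : En n} (hz : 1 ≤ ‖z‖) : rW i z = 0 :=
  rp_zero i _ (by nlinarith)

lemma hcs_of {θ : En n → ℝ} (h : ∀ z, 1 ≤ ‖z‖ → θ z = 0) : HasCompactSupport θ := by
  refine HasCompactSupport.intro (isCompact_closedBall (0 : En n) 1) ?_
  intro x hx
  apply h
  simp at hx
  linarith

lemma rW1_nonneg (z : En n) : 0 ≤ rW 1 z := by
  unfold rW; rw [rp_one]
  have := expNegInvGlue.nonneg (1 - ‖z‖^2)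
  positivity

lemma rW1_lower : ∃ c > 0, ∀ n : ℕ, ∀ z : En n, ‖z‖ ≤ 3/4 → c ≤ rW 1 z := by
  refine ⟨2 * expNegInvGlue (7/16), ?_, ?_⟩
  · have := expNegInvGlue.pos_of_pos (show (0:ℝ) < 7/16 by norm_num)
    positivity
  · intro n z hz
    unfold rW; rw [rp_one]
    have h0 : ‖z‖^2 ≤ 9/16 := by nlinarith [norm_nonneg z]
    have h1 : expNegInvGlue (7/16) ≤ expNegInvGlue (1 - ‖z‖^2) :=
      expNegInvGlue.monotone (by linarith)
    have h2 : 1 ≤ ((1 - ‖z‖^2)⁻¹)^2 := by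
      apply one_le_pow₀
      rw [one_le_inv₀ (by linarith)]
      nlinarith [norm_nonneg z]
    have h3 := expNegInvGlue.nonneg (7/16)
    nlinarith [expNegInvGlue.nonneg (1 - ‖z‖^2)]

lemma ibp {θ U : En n → ℝ} (hθ : ContDiff ℝ 1 θ) (hc : HasCompactSupport θ)
    (hU : ContDiff ℝ 1 U) (e : En n) :
    ∫ z, θ z * fderiv ℝ U z e = -∫ z, fderiv ℝ θ z e * U z := by
  have c1 : Continuous fun z => fderiv ℝ θ z e :=
    (hθ.continuous_fderiv (by simp)).clm_apply continuous_const
  have c2 : Continuous fun z => fderiv ℝ U z e :=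
    (hU.continuous_fderiv (by simp)).clm_apply continuous_const
  apply integral_mul_fderiv_eq_neg_fderiv_mul_of_integrable
  · apply Continuous.integrable_of_hasCompactSupport (c1.mul hU.continuous)
    exact (hc.fderiv_apply (𝕜 := ℝ) e).mul_right
  · exact Continuous.integrable_of_hasCompactSupport (hθ.continuous.mul c2) hc.mul_right
  · exact Continuous.integrable_of_hasCompactSupport (hθ.continuous.mul hU.continuous) hc.mul_right
  · exact fun x _ => hθ.differentiable (by simp) x
  · exact fun x _ => hU.differentiable (by simp) x

lemma integ_hasDerivAt {θ u : En n → ℝ} (hθ : Continuous θ) (hc : ∀ z, 1 ≤ ‖z‖ → θ z = 0)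
    (hu : ContDiff ℝ 1 u) (x : En n) (t : ℝ) :
    HasDerivAt (fun t : ℝ => ∫ z, θ z * u (x + t • z))
      (∫ z, θ z * fderiv ℝ u (x + t • z) z) t := by
  have hcs := hcs_of hc
  have hfu : Continuous (fderiv ℝ u) := hu.continuous_fderiv (by simp)
  have hcF : Continuous fun p : ℝ × En n => θ p.2 * fderiv ℝ u (x + p.1 • p.2) p.2 := by
    refine (hθ.comp continuous_snd).mul ?_
    exact (hfu.comp (by fun_prop)).clm_apply continuous_snd
  obtain ⟨B, hB⟩ : ∃ B, ∀ p ∈ (Icc (t-1) (t+1)) ×ˢ closedBall (0 : En n) 1,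
      ‖θ p.2 * fderiv ℝ u (x + p.1 • p.2) p.2‖ ≤ B :=
    (isCompact_Icc.prod (isCompact_closedBall _ _)).exists_bound_of_continuousOn hcF.continuousOn
  have hB0 : 0 ≤ B := (norm_nonneg _).trans (hB (t, 0) (by simp))
  have := hasDerivAt_integral_of_dominated_loc_of_deriv_le (μ := volume)
    (F := fun t z => θ z * u (x + t • z))
    (F' := fun t z => θ z * fderiv ℝ u (x + t • z) z) (x₀ := t) (s := Icc (t-1) (t+1))
    (bound := (closedBall (0:En n) 1).indicator fun _ => B) (Icc_mem_nhds (by linarith) (by linarith))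
    ?_ ?_ ?_ ?_ ?_ ?_
  · exact this.2
  · refine Eventually.of_forall fun t => ?_
    exact (hθ.mul (hu.continuous.comp (by fun_prop))).aestronglyMeasurable
  · exact Continuous.integrable_of_hasCompactSupport
      (hθ.mul (hu.continuous.comp (by fun_prop))) hcs.mul_right
  · exact (hcF.comp (Continuous.prodMk continuous_const continuous_id)).aestronglyMeasurable
  · refine Eventually.of_forall fun z τ hτ => ?_
    by_cases hz : z ∈ closedBall (0 : En n) 1
    · rw [indicator_of_mem hz]; exact hB (τ, z) ⟨hτ, hz⟩
    · rw [indicator_of_notMem hz, hc z (by simp at hz; linarith)]; simp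
  · rw [integrable_indicator_iff measurableSet_closedBall]
    exact integrableOn_const (measure_closedBall_lt_top.ne)
  · refine Eventually.of_forall fun z τ hτ => ?_
    have h1 : HasDerivAt (fun τ : ℝ => x + τ • z) z τ := by
      simpa using ((hasDerivAt_id τ).smul_const z).const_add x
    exact (((hu.differentiable (by simp) _).hasFDerivAt.comp_hasDerivAt τ h1)).const_mul _

end

section

open MeasureTheory Real Set Metric Bornology Filter
open scoped RealInnerProductSpace ENNReal NNReal Pointwise

variable {n : ℕ}

/-- coordinate vector -/
abbrev bv (n : ℕ) (i : Fin n) : En n := EuclideanSpace.single i (1:ℝ)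

lemma sum_bv (z : En n) : ∑ i, z i • bv n i = z := by
  ext j
  simp [bv, Pi.single_apply]

lemma fderiv_eq_sum (T : En n →L[ℝ] ℝ) (z : En n) : T z = ∑ i, ⟪z, bv n i⟫ * T (bv n i) := by
  conv_lhs => rw [← sum_bv z]
  simp [bv, EuclideanSpace.inner_single_right]

lemma dir_contDiff {u : En n → ℝ} (hu : ContDiff ℝ 2 u) (e : En n) :
    ContDiff ℝ 1 (fun y => fderiv ℝ u y e) :=
  (hu.fderiv_right (m := 1) (by norm_num)).clm_apply contDiff_const

lemma affine_contDiff {m : WithTop ℕ∞} (x : En n) (t : ℝ) : ContDiff ℝ m (fun z : En n => x + t • z) :=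
  contDiff_const.add (contDiff_id.const_smul t)

lemma fderiv_affine {V : En n → ℝ} (hV : ContDiff ℝ 1 V) (x : En n) (t : ℝ) (z e : En n) :
    fderiv ℝ (fun z => V (x + t • z)) z e = t * fderiv ℝ V (x + t • z) e := by
  have h1 : HasFDerivAt (fun z : En n => x + t • z) (t • ContinuousLinearMap.id ℝ (En n)) z :=
    ((hasFDerivAt_id z).const_smul t).const_add x
  have h2 := ((hV.differentiable (by simp) (x + t • z)).hasFDerivAt).comp z h1
  have h3 : fderiv ℝ (fun z => V (x + t • z)) z = _ := h2.fderiv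
  rw [h3]; simp

lemma ibp_aff {G V : En n → ℝ} (hG : ContDiff ℝ 1 G) (hc : HasCompactSupport G)
    (hV : ContDiff ℝ 1 V) (x : En n) (t : ℝ) (e : En n) :
    ∫ z, fderiv ℝ G z e * V (x + t • z) = - (t * ∫ z, G z * fderiv ℝ V (x + t • z) e) := by
  have := ibp hG hc (hV.comp (affine_contDiff x t)) e
  have h2 : ∀ z, fderiv ℝ (V ∘ fun z => x + t • z) z e = t * fderiv ℝ V (x + t • z) e :=
    fun z => fderiv_affine hV x t z e
  simp only [h2, Function.comp] at this
  rw [← integral_const_mul, ← neg_eq_iff_eq_neg, ← this]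
  congr 1; ext z; ring

lemma lap_cont {u : En n → ℝ} (hu : ContDiff ℝ 2 u) : Continuous (lap n u) := by
  unfold lap
  refine continuous_finsetSum _ fun i _ => ?_
  exact ((dir_contDiff hu _).continuous_fderiv (by simp)).clm_apply continuous_const

lemma div_id {G u : En n → ℝ} (hG : ContDiff ℝ 1 G) (hc : HasCompactSupport G)
    (hu : ContDiff ℝ 2 u) (x : En n) (t : ℝ) :
    ∫ z, (∑ i, fderiv ℝ G z (bv n i) * fderiv ℝ u (x + t • z) (bv n i)) =
      - (t * ∫ z, G z * lap n u (x + t • z)) := by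
  have hcV : ∀ i, Continuous fun z => fderiv ℝ u (x + t • z) (bv n i) := fun i =>
    (dir_contDiff hu _).continuous.comp (affine_contDiff (m := 0) x t).continuous
  have hcV2 : ∀ i, Continuous fun z =>
      fderiv ℝ (fun y => fderiv ℝ u y (bv n i)) (x + t • z) (bv n i) := fun i =>
    (((dir_contDiff hu _).continuous_fderiv (by simp)).comp
      (affine_contDiff (m := 0) x t).continuous).clm_apply continuous_const
  rw [integral_finsetSum]
  · simp only [lap, Finset.mul_sum]
    rw [integral_finsetSum]
    · rw [Finset.mul_sum, ← Finset.sum_neg_distrib]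
      refine Finset.sum_congr rfl fun i _ => ?_
      exact ibp_aff hG hc (dir_contDiff hu (bv n i)) x t (bv n i)
    · intro i _
      exact Continuous.integrable_of_hasCompactSupport (hG.continuous.mul (hcV2 i)) hc.mul_right
  · intro i _
    refine Continuous.integrable_of_hasCompactSupport (Continuous.mul ?_ (hcV i)) ?_
    · exact (hG.continuous_fderiv (by simp)).clm_apply continuous_const
    · exact (hc.fderiv_apply (𝕜 := ℝ) _).mul_right

lemma rW_contDiff1 (i : ℕ) : ContDiff ℝ 1 (rW (n := n) i) := (rW_contDiff i).of_le (by
  exact_mod_cast le_top)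

lemma mv_hasDerivAt {u : En n → ℝ} (hu : ContDiff ℝ 2 u) (x : En n) (t : ℝ) :
    HasDerivAt (fun t : ℝ => ∫ z, rW 1 z * u (x + t • z))
      (- (t * ∫ z, rW 0 z * lap n u (x + t • z))) t := by
  have h := integ_hasDerivAt (rW_cont (n := n) 1) (fun z hz => rW_zero 1 hz)
    (hu.of_le (by norm_num)) x t
  rw [← div_id (rW_contDiff1 0) (hcs_of fun z hz => rW_zero 0 hz) hu x t]
  convert h using 2
  ext z
  rw [fderiv_eq_sum _ z, Finset.mul_sum]
  refine Finset.sum_congr rfl fun i _ => ?_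
  rw [rW_fderiv]; ring

lemma rW_integrable (i : ℕ) : Integrable (rW (n := n) i) :=
  Continuous.integrable_of_hasCompactSupport (rW_cont i) (hcs_of fun z hz => rW_zero i hz)

lemma rW1_int_pos : 0 < ∫ z : En n, rW 1 z := by
  obtain ⟨c, hc, h⟩ := rW1_lower
  have h1 : ∫ z in closedBall (0:En n) (3/4), c ≤ ∫ z : En n, rW 1 z := by
    rw [← integral_indicator measurableSet_closedBall]
    apply integral_mono
    · rw [integrable_indicator_iff measurableSet_closedBall]
      exact integrableOn_const (measure_closedBall_lt_top.ne)
    · exact rW_integrable 1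
    · intro z
      by_cases hz : z ∈ closedBall (0:En n) (3/4)
      · rw [indicator_of_mem hz]; exact h n z (by simpa using hz)
      · rw [indicator_of_notMem hz]; exact rW1_nonneg z
  refine lt_of_lt_of_le ?_ h1
  rw [setIntegral_const]
  have : 0 < volume.real (closedBall (0:En n) (3/4)) := by
    rw [measureReal_def]
    exact ENNReal.toReal_pos (measure_closedBall_pos _ _ (by norm_num)).ne'
      measure_closedBall_lt_top.ne
  positivity

lemma weight_bound {θ f : En n → ℝ} (hθi : Integrable θ) (hc : ∀ z, 1 ≤ ‖z‖ → θ z = 0) {F R : ℝ} (hR : 0 ≤ R)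
    {x : En n} (hf : ∀ y ∈ closedBall x R, |f y| ≤ F) {t : ℝ} (ht : 0 ≤ t) (htR : t ≤ R) :
    |∫ z, θ z * f (x + t • z)| ≤ F * ∫ z, |θ z| := by
  have hF : 0 ≤ F := (abs_nonneg _).trans (hf x (by simpa using hR))
  rw [← integral_const_mul]
  rw [← Real.norm_eq_abs]
  refine norm_integral_le_of_norm_le (hθi.abs.const_mul F) (Eventually.of_forall fun z => ?_)
  by_cases hz : 1 ≤ ‖z‖
  · simp [hc z hz]
  · rw [Real.norm_eq_abs, abs_mul, mul_comm]
    refine mul_le_mul_of_nonneg_right (hf _ ?_) (abs_nonneg _)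
    simp only [mem_closedBall, dist_self_add_left, norm_smul, Real.norm_eq_abs, abs_of_nonneg ht]
    nlinarith [norm_nonneg z]

lemma mv_bound {u : En n → ℝ} (hu : ContDiff ℝ 2 u) {x : En n} {R F : ℝ} (hR : 0 ≤ R)
    (hF : ∀ y ∈ closedBall x R, |lap n u y| ≤ F) :
    |(∫ z, rW 1 z * u (x + R • z)) - (∫ z : En n, rW 1 z) * u x| ≤
      (∫ z : En n, |rW 0 z|) * (R^2 * F) := by
  have hF0 : 0 ≤ F := (abs_nonneg _).trans (hF x (by simpa using hR))
  have key := norm_image_sub_le_of_norm_deriv_le_segment_01' (f := fun τ : ℝ => ∫ z, rW 1 z * u (x + (τ * R) • z))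
    (f' := fun τ => - ((τ * R) * ∫ z, rW 0 z * lap n u (x + (τ * R) • z)) * R) (C := (∫ z : En n, |rW 0 z|) * (R^2 * F))
    ?_ ?_
  · simpa [integral_mul_const] using key
  · intro τ _
    have h1 : HasDerivAt (fun τ : ℝ => τ * R) R τ := by
      simpa using (hasDerivAt_id τ).mul_const R
    exact ((mv_hasDerivAt hu x (τ * R)).comp τ h1).hasDerivWithinAt
  · intro τ hτ
    have h0 : 0 ≤ τ * R := mul_nonneg hτ.1 hR
    have h1 : τ * R ≤ R := by nlinarith [hτ.2]
    have h2 := weight_bound (rW_integrable (n := n) 0) (fun z hz => rW_zero 0 hz) hR hF h0 h1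
    rw [norm_mul, norm_neg, norm_mul, Real.norm_of_nonneg h0, Real.norm_of_nonneg hR, Real.norm_eq_abs]
    have hI : 0 ≤ ∫ z : En n, |rW 0 z| := integral_nonneg fun z => abs_nonneg _
    calc τ * R * |∫ z, rW 0 z * lap n u (x + (τ * R) • z)| * R
        ≤ R * (F * ∫ z : En n, |rW 0 z|) * R := by gcongr
      _ = _ := by ring

end

section

open MeasureTheory Real Set Metric Bornology Filter
open scoped RealInnerProductSpace ENNReal NNReal Pointwise

variable {n : ℕ}

def Gk (a b z : En n) : ℝ := rW 2 z * (⟪z, a⟫ * ⟪z, b⟫) + rW 1 z * ⟪a, b⟫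
def Hk (a b z : En n) : ℝ := rW 3 z * (⟪z, a⟫ * ⟪z, b⟫) + rW 2 z * ⟪a, b⟫

lemma inner_contDiff1 (b : En n) : ContDiff ℝ 1 (fun z : En n => ⟪z, b⟫) :=
  contDiff_id.inner ℝ contDiff_const

lemma inner_hasFDerivAt (b z : En n) : HasFDerivAt (fun z : En n => ⟪z, b⟫) (innerSL ℝ b) z := by
  have : (fun z : En n => ⟪z, b⟫) = innerSL ℝ b := by
    ext y; simp [real_inner_comm]
  rw [this]; exact (innerSL ℝ b).hasFDerivAt

lemma rWlin_contDiff (i : ℕ) (b : En n) : ContDiff ℝ 1 (fun z : En n => rW i z * ⟪z, b⟫) :=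
  (rW_contDiff1 i).mul (inner_contDiff1 b)

lemma rWlin_fderiv (i : ℕ) (a b z : En n) :
    fderiv ℝ (fun z : En n => rW i z * ⟪z, b⟫) z a =
      rW (i+1) z * (⟪z, a⟫ * ⟪z, b⟫) + rW i z * ⟪a, b⟫ := by
  have h := (rW_hasFDerivAt i z).mul (inner_hasFDerivAt b z)
  rw [show (fun z : En n => rW i z * ⟪z, b⟫) = (rW i * fun z : En n => ⟪z, b⟫) from rfl, h.fderiv]
  simp [real_inner_comm]
  ring

lemma Gk_contDiff (a b : En n) : ContDiff ℝ 1 (Gk a b) :=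
  ((rW_contDiff1 2).mul ((inner_contDiff1 a).mul (inner_contDiff1 b))).add
    ((rW_contDiff1 1).mul contDiff_const)

lemma Hk_cont (a b : En n) : Continuous (Hk a b) :=
  (((rW_contDiff1 3).mul ((inner_contDiff1 a).mul (inner_contDiff1 b))).add
    ((rW_contDiff1 2).mul contDiff_const)).continuous

lemma Gk_zero (a b : En n) (z : En n) (hz : 1 ≤ ‖z‖) : Gk a b z = 0 := by
  simp [Gk, rW_zero _ hz]
lemma Hk_zero (a b : En n) (z : En n) (hz : 1 ≤ ‖z‖) : Hk a b z = 0 := by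
  simp [Hk, rW_zero _ hz]

lemma Gk_fderiv (a b z e : En n) : fderiv ℝ (Gk a b) z e =
    Hk a b z * ⟪z, e⟫ + rW 2 z * ⟪z, b⟫ * ⟪e, a⟫ + rW 2 z * ⟪z, a⟫ * ⟪e, b⟫ := by
  have h := ((rW_hasFDerivAt 2 z).mul ((inner_hasFDerivAt a z).mul (inner_hasFDerivAt b z))).add
    ((rW_hasFDerivAt 1 z).mul_const ⟪a, b⟫)
  have h2 : fderiv ℝ (Gk a b) z = _ := h.fderiv
  rw [h2]
  simp [Hk, real_inner_comm]
  ring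

lemma HU_id {u : En n → ℝ} (hu : ContDiff ℝ 1 u) (a b x : En n) (t : ℝ) :
    ∫ z, Hk a b z * u (x + t • z) = -(t * ∫ z, rW 2 z * ⟪z, b⟫ * fderiv ℝ u (x + t • z) a) := by
  rw [← ibp_aff (rWlin_contDiff 2 b) (hcs_of fun z hz => by simp [rW_zero 2 hz]) hu x t a]
  congr 1; ext z; rw [rWlin_fderiv]; rfl

lemma Hk_symm (a b z : En n) : Hk a b z = Hk b a z := by
  unfold Hk; rw [real_inner_comm b a]; ring

lemma HU_id2 {u : En n → ℝ} (hu : ContDiff ℝ 2 u) (a b x : En n) (t : ℝ) :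
    ∫ z, Hk a b z * u (x + t • z) =
      t^2 * ∫ z, rW 1 z * fderiv ℝ (fun y => fderiv ℝ u y a) (x + t • z) b := by
  rw [HU_id (hu.of_le (by norm_num)) a b x t]
  have := ibp_aff (rW_contDiff1 1) (hcs_of fun z hz => rW_zero 1 hz) (dir_contDiff hu a) x t b
  simp only [rW_fderiv] at this
  rw [this]; ring

lemma k_deriv {u : En n → ℝ} (hu : ContDiff ℝ 2 u) (a b x : En n) {t : ℝ} (ht : 0 < t) :
    ∫ z, Hk a b z * fderiv ℝ u (x + t • z) z =
      2 / t * (∫ z, Hk a b z * u (x + t • z)) - t * ∫ z, Gk a b z * lap n u (x + t • z) := by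
  have hu1 : ContDiff ℝ 1 u := hu.of_le (by norm_num)
  have h1 := div_id (Gk_contDiff a b) (hcs_of (Gk_zero a b)) hu x t
  have h2 := HU_id hu1 a b x t
  have h3 := HU_id hu1 b a x t
  simp only [Hk_symm b a] at h3
  have e1 : ∀ z, (∑ i, fderiv ℝ (Gk a b) z (bv n i) * fderiv ℝ u (x + t • z) (bv n i)) =
      Hk a b z * fderiv ℝ u (x + t • z) z + rW 2 z * ⟪z, b⟫ * fderiv ℝ u (x + t • z) a
        + rW 2 z * ⟪z, a⟫ * fderiv ℝ u (x + t • z) b := by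
    intro z
    rw [fderiv_eq_sum _ z, fderiv_eq_sum _ a, fderiv_eq_sum _ b, Finset.mul_sum, Finset.mul_sum,
      Finset.mul_sum, ← Finset.sum_add_distrib, ← Finset.sum_add_distrib]
    refine Finset.sum_congr rfl fun i _ => ?_
    rw [Gk_fderiv, real_inner_comm a (bv n i), real_inner_comm b (bv n i)]; ring
  have caff : Continuous fun z : En n => x + t • z := (affine_contDiff (m := 0) x t).continuous
  have cfd : Continuous fun z : En n => fderiv ℝ u (x + t • z) :=
    (hu1.continuous_fderiv (by simp)).comp caff
  have i1 : Integrable fun z => Hk a b z * fderiv ℝ u (x + t • z) z :=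
    Continuous.integrable_of_hasCompactSupport ((Hk_cont a b).mul (cfd.clm_apply continuous_id))
      (hcs_of fun z hz => by simp [Hk_zero a b z hz])
  have i2 : ∀ b a : En n, Integrable fun z => rW 2 z * ⟪z, b⟫ * fderiv ℝ u (x + t • z) a := fun b a =>
    Continuous.integrable_of_hasCompactSupport
      ((rWlin_contDiff 2 b).continuous.mul (cfd.clm_apply continuous_const))
      (hcs_of fun z hz => by simp [rW_zero 2 hz])
  simp only [e1] at h1
  have h4 := integral_add (i1.add (i2 b a)) (i2 a b)
  have h5 := integral_add i1 (i2 b a)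
  simp only [Pi.add_apply] at h4 h5
  rw [h4, h5] at h1
  field_simp
  have t0 := ht.ne'
  linear_combination t * h1 - h2 - h3

/-- pointwise bound function for the kernels -/
def Kbd (z : En n) : ℝ := |rW 3 z| + |rW 2 z| + |rW 1 z|

lemma Kbd_int : Integrable (Kbd (n := n)) :=
  ((rW_integrable 3).abs.add (rW_integrable 2).abs).add (rW_integrable 1).abs

lemma Kbd_nonneg (z : En n) : 0 ≤ Kbd z := by unfold Kbd; positivity

lemma lin_bd {z a b : En n} (hz : ‖z‖ ≤ 1) : |⟪z, a⟫ * ⟪z, b⟫| ≤ ‖a‖ * ‖b‖ := by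
  rw [abs_mul]
  have h1 := (abs_real_inner_le_norm z a).trans (mul_le_of_le_one_left (norm_nonneg a) hz)
  have h2 := (abs_real_inner_le_norm z b).trans (mul_le_of_le_one_left (norm_nonneg b) hz)
  gcongr

lemma Hk_bd (a b z : En n) : |Hk a b z| ≤ (‖a‖ * ‖b‖) * Kbd z := by
  by_cases hz : 1 ≤ ‖z‖
  · rw [Hk_zero a b z hz, abs_zero]; have := Kbd_nonneg z; positivity
  · have h1 := lin_bd (a := a) (b := b) (not_le.1 hz).le
    have h2 := abs_real_inner_le_norm a b
    unfold Hk Kbd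
    calc _ ≤ |rW 3 z| * |⟪z, a⟫ * ⟪z, b⟫| + |rW 2 z| * |⟪a, b⟫| := by
            refine (abs_add_le _ _).trans ?_; rw [abs_mul, abs_mul (rW 2 z)]
      _ ≤ |rW 3 z| * (‖a‖ * ‖b‖) + |rW 2 z| * (‖a‖ * ‖b‖) := by gcongr
      _ ≤ _ := by nlinarith [mul_nonneg (mul_nonneg (norm_nonneg a) (norm_nonneg b)) (abs_nonneg (rW 1 z))]

lemma Gk_bd (a b z : En n) : |Gk a b z| ≤ (‖a‖ * ‖b‖) * Kbd z := by
  by_cases hz : 1 ≤ ‖z‖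
  · rw [Gk_zero a b z hz, abs_zero]; have := Kbd_nonneg z; positivity
  · have h1 := lin_bd (a := a) (b := b) (not_le.1 hz).le
    have h2 := abs_real_inner_le_norm a b
    unfold Gk Kbd
    calc _ ≤ |rW 2 z| * |⟪z, a⟫ * ⟪z, b⟫| + |rW 1 z| * |⟪a, b⟫| := by
            refine (abs_add_le _ _).trans ?_; rw [abs_mul, abs_mul (rW 1 z)]
      _ ≤ |rW 2 z| * (‖a‖ * ‖b‖) + |rW 1 z| * (‖a‖ * ‖b‖) := by gcongr
      _ ≤ _ := by nlinarith [mul_nonneg (mul_nonneg (norm_nonneg a) (norm_nonneg b)) (abs_nonneg (rW 3 z))]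

lemma Gk_integrable (a b : En n) : Integrable (Gk a b) :=
  Continuous.integrable_of_hasCompactSupport (Gk_contDiff a b).continuous (hcs_of (Gk_zero a b))
lemma Hk_integrable (a b : En n) : Integrable (Hk a b) :=
  Continuous.integrable_of_hasCompactSupport (Hk_cont a b) (hcs_of (Hk_zero a b))

lemma Gk_int_abs (a b : En n) : ∫ z, |Gk a b z| ≤ (‖a‖ * ‖b‖) * ∫ z : En n, Kbd z := by
  rw [← integral_const_mul]
  exact integral_mono (Gk_integrable a b).abs (Kbd_int.const_mul _) (Gk_bd a b)
lemma Hk_int_abs (a b : En n) : ∫ z, |Hk a b z| ≤ (‖a‖ * ‖b‖) * ∫ z : En n, Kbd z := by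
  rw [← integral_const_mul]
  exact integral_mono (Hk_integrable a b).abs (Kbd_int.const_mul _) (Hk_bd a b)

lemma Gk_int_zero (a b : En n) : ∫ z, Gk a b z = 0 := by
  have := ibp_aff (rWlin_contDiff 1 b) (hcs_of fun z hz => by simp [rW_zero 1 hz])
    (contDiff_const (c := (1:ℝ))) 0 0 a
  simp only [rWlin_fderiv] at this
  simpa [Gk] using this

lemma hess_apply {u : En n → ℝ} {x : En n} (hu : ContDiffAt ℝ 2 u x) (a b : En n) :
    fderiv ℝ (fun y => fderiv ℝ u y a) x b = hess n u x b a := by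
  have h : DifferentiableAt ℝ (fderiv ℝ u) x :=
    (hu.fderiv_right (m := 1) (by norm_num)).differentiableAt (by simp)
  have h2 := h.hasFDerivAt.clm_apply (hasFDerivAt_const a x)
  rw [h2.fderiv]; simp [hess]

lemma schauder_dir {u : En n → ℝ} (hu : ContDiff ℝ 2 u) {x : En n} {R S H γ : ℝ} (hR : 0 < R)
    (hγ : 0 < γ) (hS : ∀ y ∈ closedBall x R, |u y| ≤ S) (hH0 : 0 ≤ H)
    (hH : ∀ y ∈ closedBall x R, |lap n u y - lap n u x| ≤ H * ‖y - x‖ ^ γ) (a b : En n) :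
    (∫ z : En n, rW 1 z) * |hess n u x b a| ≤
      (‖a‖ * ‖b‖) * (∫ z : En n, Kbd z) * (R⁻¹^2 * S + H * R ^ γ / γ) := by
  set N := (‖a‖ * ‖b‖) * (∫ z : En n, Kbd z) with hN
  have hN0 : 0 ≤ N := mul_nonneg (by positivity) (integral_nonneg Kbd_nonneg)
  set h : ℝ → ℝ := fun t => ∫ z, rW 1 z * fderiv ℝ (fun y => fderiv ℝ u y a) (x + t • z) b with hh
  have hcont : Continuous h := by
    have hcd : Continuous fun y => fderiv ℝ (fun y => fderiv ℝ u y a) y b :=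
      ((dir_contDiff hu a).continuous_fderiv (by simp)).clm_apply continuous_const
    refine continuous_parametric_integral_of_continuous (μ := volume)
      (f := fun t z => rW 1 z * fderiv ℝ (fun y => fderiv ℝ u y a) (x + t • z) b)
      (s := closedBall (0 : En n) 1) ?_ (isCompact_closedBall _ _) |>.congr ?_
    · exact ((rW_cont 1).comp continuous_snd).mul (hcd.comp (by fun_prop))
    · intro t
      apply setIntegral_eq_integral_of_forall_compl_eq_zero
      intro z hz
      rw [rW_zero 1 (by simp at hz; linarith)]; simp
  have hk : ∀ t : ℝ, 0 < t → h t = (∫ z, Hk a b z * u (x + t • z)) / t^2 := by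
    intro t ht
    rw [HU_id2 hu a b x t, eq_div_iff (by positivity), mul_comm]
  have hder : ∀ t : ℝ, 0 < t → HasDerivAt h (-(t⁻¹ * ∫ z, Gk a b z * lap n u (x + t • z))) t := by
    intro t ht
    have h1 := integ_hasDerivAt (Hk_cont a b) (Hk_zero a b) (hu.of_le (by norm_num)) x t
    have h2 := h1.div (hasDerivAt_pow 2 t) (by positivity)
    rw [k_deriv hu a b x ht] at h2
    have h3 : h =ᶠ[nhds t] fun t => (∫ z, Hk a b z * u (x + t • z)) / t^2 := by
      filter_upwards [Ioi_mem_nhds ht] with τ hτ using hk τ hτ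
    refine (h2.congr_of_eventuallyEq h3).congr_deriv ?_
    field_simp
    push_cast
    ring
  have hdb : ∀ t : ℝ, 0 < t → t ≤ R →
      |∫ z, Gk a b z * lap n u (x + t • z)| ≤ N * H * t ^ γ := by
    intro t ht htR
    have e : ∫ z, Gk a b z * lap n u (x + t • z) =
        ∫ z, Gk a b z * (fun y => lap n u y - lap n u x) (x + t • z) := by
      have i1 : Integrable fun z => Gk a b z * lap n u (x + t • z) :=
        Continuous.integrable_of_hasCompactSupport ((Gk_contDiff a b).continuous.mul
          ((lap_cont hu).comp (affine_contDiff (m := 0) x t).continuous))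
          (hcs_of fun z hz => by simp [Gk_zero a b z hz])
      simp only [mul_sub]
      rw [integral_sub i1 ((Gk_integrable a b).mul_const _), integral_mul_const, Gk_int_zero]
      simp
    rw [e]
    have hb := weight_bound (θ := Gk a b) (f := fun y => lap n u y - lap n u x) (F := H * t ^ γ)
      (R := t) (x := x) (t := t) (Gk_integrable a b) (Gk_zero a b) ht.le ?_ ht.le le_rfl
    · refine hb.trans ?_
      have : 0 ≤ t ^ γ := by positivity
      calc _ ≤ H * t ^ γ * N := by gcongr; exact Gk_int_abs a b
        _ = _ := by ring
    · intro y hy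
      have hy' : ‖y - x‖ ≤ t := by simpa [dist_eq_norm] using hy
      refine (hH y (closedBall_subset_closedBall htR hy)).trans ?_
      gcongr
  have hR1 : |h R| ≤ N * (R⁻¹^2 * S) := by
    have hS0 : 0 ≤ S := (abs_nonneg _).trans (hS x (by simpa using hR.le))
    rw [hk R hR, abs_div, abs_of_nonneg (sq_nonneg R)]
    have := weight_bound (Hk_integrable a b) (Hk_zero a b) hR.le hS hR.le le_rfl
    calc _ ≤ (S * N) / R^2 := by
          gcongr
          refine this.trans ?_
          gcongr; exact Hk_int_abs a b
      _ = _ := by field_simp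
  have h0 : h 0 = (∫ z : En n, rW 1 z) * hess n u x b a := by
    simp only [hh, zero_smul, add_zero, hess_apply hu.contDiffAt]
    rw [integral_mul_const]
  have hpow : ∀ t : ℝ, 0 < t → HasDerivAt (fun t => N * H * t ^ γ / γ) (N * H * t ^ (γ - 1)) t := by
    intro t ht
    refine (((Real.hasDerivAt_rpow_const (p := γ) (Or.inl ht.ne')).const_mul (N * H)).div_const γ).congr_deriv ?_
    field_simp
  have hpc : Continuous fun t : ℝ => N * H * t ^ γ / γ := by
    have := Real.continuous_rpow_const (q := γ) hγ.le
    fun_prop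
  have hdb2 : ∀ t : ℝ, 0 < t → t ≤ R →
      |t⁻¹ * ∫ z, Gk a b z * lap n u (x + t • z)| ≤ N * H * t ^ (γ - 1) := by
    intro t ht htR
    rw [abs_mul, abs_of_pos (inv_pos.2 ht), Real.rpow_sub ht, Real.rpow_one]
    calc _ ≤ t⁻¹ * (N * H * t ^ γ) := by gcongr; exact hdb t ht htR
      _ = _ := by field_simp
  have m1 : AntitoneOn (fun t => h t - N * H * t ^ γ / γ) (Icc 0 R) := by
    apply antitoneOn_of_deriv_nonpos (convex_Icc 0 R) (hcont.sub hpc).continuousOn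
    · intro t ht
      rw [interior_Icc] at ht
      exact ((hder t ht.1).sub (hpow t ht.1)).differentiableAt.differentiableWithinAt
    · intro t ht
      rw [interior_Icc] at ht
      have e := ((hder t ht.1).sub (hpow t ht.1)).deriv
      refine e.le.trans ?_
      have := abs_le.1 (hdb2 t ht.1 ht.2.le)
      linarith
  have m2 : AntitoneOn (fun t => -h t - N * H * t ^ γ / γ) (Icc 0 R) := by
    apply antitoneOn_of_deriv_nonpos (convex_Icc 0 R) (hcont.neg.sub hpc).continuousOn
    · intro t ht
      rw [interior_Icc] at ht
      exact ((hder t ht.1).neg.sub (hpow t ht.1)).differentiableAt.differentiableWithinAt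
    · intro t ht
      rw [interior_Icc] at ht
      have e := ((hder t ht.1).neg.sub (hpow t ht.1)).deriv
      refine e.le.trans ?_
      have := abs_le.1 (hdb2 t ht.1 ht.2.le)
      linarith
  have q1 := m1 (left_mem_Icc.2 hR.le) (right_mem_Icc.2 hR.le) hR.le
  have q2 := m2 (left_mem_Icc.2 hR.le) (right_mem_Icc.2 hR.le) hR.le
  simp only [Real.zero_rpow hγ.ne', mul_zero, zero_div] at q1 q2
  have q3 := abs_le.1 hR1
  have : |h 0| ≤ N * (R⁻¹^2 * S + H * R ^ γ / γ) := by
    rw [abs_le]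
    have e : N * (R⁻¹^2 * S + H * R ^ γ / γ) = N * (R⁻¹^2 * S) + N * H * R ^ γ / γ := by ring
    rw [e]
    obtain ⟨q3, q4⟩ := q3
    constructor <;> linarith
  rw [h0, abs_mul, abs_of_pos rW1_int_pos] at this
  exact this

lemma schauder_glob (n : ℕ) {γ : ℝ} (hγ : 0 < γ) : ∃ C > 0, ∀ u : En n → ℝ, ContDiff ℝ 2 u →
    ∀ x : En n, ∀ R S H : ℝ, 0 < R → 0 ≤ H → (∀ y ∈ closedBall x R, |u y| ≤ S) →
    (∀ y ∈ closedBall x R, |lap n u y - lap n u x| ≤ H * ‖y - x‖ ^ γ) →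
    ‖hess n u x‖ ≤ C * (R⁻¹^2 * S + H * R ^ γ) := by
  set K := ∫ z : En n, Kbd z
  have hK : 0 ≤ K := integral_nonneg Kbd_nonneg
  set I := ∫ z : En n, rW 1 z
  have hI : 0 < I := rW1_int_pos
  refine ⟨K / I * (1 + 1/γ) + 1, by positivity, ?_⟩
  intro u hu x R S H hR hH0 hS hH
  have hS0 : 0 ≤ S := (abs_nonneg _).trans (hS x (by simpa using hR.le))
  have hQ : 0 ≤ R⁻¹^2 * S + H * R ^ γ := by positivity
  refine ContinuousLinearMap.opNorm_le_bound₂ _ (by positivity) fun b a => ?_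
  have := schauder_dir hu hR hγ hS hH0 hH a b
  have h1 : R⁻¹^2 * S + H * R ^ γ / γ ≤ (1 + 1/γ) * (R⁻¹^2 * S + H * R ^ γ) := by
    have e1 : 0 ≤ R⁻¹^2 * S / γ := by positivity
    have e2 : 0 ≤ H * R ^ γ := by positivity
    have : (1 + 1/γ) * (R⁻¹^2 * S + H * R ^ γ) = R⁻¹^2 * S + H * R ^ γ / γ + (R⁻¹^2 * S / γ + H * R ^ γ) := by
      field_simp; ring
    linarith
  have h2 : |hess n u x b a| ≤ (‖a‖ * ‖b‖) * K * ((1 + 1/γ) * (R⁻¹^2 * S + H * R ^ γ)) / I := by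
    rw [le_div_iff₀ hI, mul_comm]
    refine this.trans ?_
    gcongr
  rw [Real.norm_eq_abs]
  refine h2.trans ?_
  have e : (‖a‖ * ‖b‖) * K * ((1 + 1/γ) * (R⁻¹^2 * S + H * R ^ γ)) / I =
      K / I * (1 + 1/γ) * (R⁻¹^2 * S + H * R ^ γ) * ‖b‖ * ‖a‖ := by field_simp
  rw [e]
  gcongr
  linarith

end

section

open MeasureTheory Real Set Metric Bornology Filter
open scoped RealInnerProductSpace ENNReal NNReal Pointwise

variable {n : ℕ}

lemma ext_global {Ω : Set (En n)} (hΩ : IsOpen Ω) {u : En n → ℝ} (hu : ContDiffOn ℝ 2 u Ω)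
    {x : En n} {R : ℝ} (hR : 0 ≤ R) (hB : closedBall x R ⊆ Ω) :
    ∃ v : En n → ℝ, ContDiff ℝ 2 v ∧ ∀ y ∈ closedBall x R, v =ᶠ[nhds y] u := by
  obtain ⟨δ, hδ, hsub⟩ := (isCompact_closedBall x R).exists_cthickening_subset_open hΩ hB
  have hsub2 : closedBall x (R + δ) ⊆ Ω := by
    rw [cthickening_closedBall hδ.le hR, add_comm] at hsub
    exact hsub
  let f : ContDiffBump x := ⟨R + δ/2, R + δ, by linarith, by linarith⟩
  refine ⟨fun y => f y * u y, ?_, ?_⟩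
  · rw [contDiff_iff_contDiffAt]
    intro y
    by_cases hy : y ∈ Ω
    · exact f.contDiffAt.mul (hu.contDiffAt (hΩ.mem_nhds hy))
    · have hy2 : y ∉ tsupport f := by
        rw [f.tsupport_eq]
        exact fun h => hy (hsub2 h)
      have : (fun y => f y * u y) =ᶠ[nhds y] fun _ => 0 := by
        filter_upwards [(isClosed_tsupport f).isOpen_compl.mem_nhds hy2] with z hz
        rw [image_eq_zero_of_notMem_tsupport hz, zero_mul]
      exact contDiffAt_const.congr_of_eventuallyEq this
  · intro y hy
    have hy2 : y ∈ ball x (R + δ/2) := by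
      simp only [mem_closedBall, mem_ball] at *
      linarith
    filter_upwards [isOpen_ball.mem_nhds hy2] with z hz
    rw [f.one_of_mem_closedBall (ball_subset_closedBall hz), one_mul]

lemma lap_congr {u v : En n → ℝ} {x : En n} (h : v =ᶠ[nhds x] u) : lap n v x = lap n u x := by
  unfold lap
  refine Finset.sum_congr rfl fun i _ => ?_
  have h1 : (fun y => fderiv ℝ v y (EuclideanSpace.single i (1:ℝ))) =ᶠ[nhds x]
      fun y => fderiv ℝ u y (EuclideanSpace.single i (1:ℝ)) := by
    filter_upwards [h.fderiv (𝕜 := ℝ)] with y hy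
    rw [hy]
  rw [h1.fderiv_eq]

lemma hess_congr {u v : En n → ℝ} {x : En n} (h : v =ᶠ[nhds x] u) : hess n v x = hess n u x := by
  unfold hess
  exact (h.fderiv (𝕜 := ℝ)).fderiv_eq

lemma lap_eq_hess {u : En n → ℝ} {x : En n} (hu : ContDiffAt ℝ 2 u x) :
    lap n u x = ∑ i, hess n u x (bv n i) (bv n i) := by
  unfold lap
  exact Finset.sum_congr rfl fun i _ => hess_apply hu _ _

lemma ev_diff {u : En n → ℝ} {x : En n} (hu : ContDiffAt ℝ 2 u x) :
    ∀ᶠ y in nhds x, DifferentiableAt ℝ u y := by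
  filter_upwards [hu.eventually (by simp)] with y hy using hy.differentiableAt (by simp)

lemma fderiv_diff {u : En n → ℝ} {x : En n} (hu : ContDiffAt ℝ 2 u x) :
    DifferentiableAt ℝ (fderiv ℝ u) x :=
  (hu.fderiv_right (m := 1) (by norm_num)).differentiableAt (by simp)

lemma hess_sub {u v : En n → ℝ} {x : En n} (hu : ContDiffAt ℝ 2 u x) (hv : ContDiffAt ℝ 2 v x) :
    hess n (fun y => u y - v y) x = hess n u x - hess n v x := by
  unfold hess
  have h : fderiv ℝ (fun y => u y - v y) =ᶠ[nhds x] fun y => fderiv ℝ u y - fderiv ℝ v y := by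
    filter_upwards [ev_diff hu, ev_diff hv] with y h1 h2
    exact fderiv_sub h1 h2
  rw [h.fderiv_eq]
  exact fderiv_sub (fderiv_diff hu) (fderiv_diff hv)

lemma hess_add {u v : En n → ℝ} {x : En n} (hu : ContDiffAt ℝ 2 u x) (hv : ContDiffAt ℝ 2 v x) :
    hess n (fun y => u y + v y) x = hess n u x + hess n v x := by
  unfold hess
  have h : fderiv ℝ (fun y => u y + v y) =ᶠ[nhds x] fun y => fderiv ℝ u y + fderiv ℝ v y := by
    filter_upwards [ev_diff hu, ev_diff hv] with y h1 h2
    exact fderiv_add h1 h2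
  rw [h.fderiv_eq]
  exact fderiv_add (fderiv_diff hu) (fderiv_diff hv)

lemma hess_const_mul {u : En n → ℝ} {x : En n} (hu : ContDiffAt ℝ 2 u x) (c : ℝ) :
    hess n (fun y => c * u y) x = c • hess n u x := by
  unfold hess
  have h : fderiv ℝ (fun y => c * u y) =ᶠ[nhds x] fun y => c • fderiv ℝ u y := by
    filter_upwards [ev_diff hu] with y h1
    exact fderiv_const_mul h1 c
  rw [h.fderiv_eq]
  exact fderiv_const_smul (fderiv_diff hu) c

lemma lap_sub {u v : En n → ℝ} {x : En n} (hu : ContDiffAt ℝ 2 u x) (hv : ContDiffAt ℝ 2 v x) :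
    lap n (fun y => u y - v y) x = lap n u x - lap n v x := by
  rw [lap_eq_hess (hu.sub hv), lap_eq_hess hu, lap_eq_hess hv, hess_sub hu hv]
  simp

lemma lap_add {u v : En n → ℝ} {x : En n} (hu : ContDiffAt ℝ 2 u x) (hv : ContDiffAt ℝ 2 v x) :
    lap n (fun y => u y + v y) x = lap n u x + lap n v x := by
  rw [lap_eq_hess (hu.add hv), lap_eq_hess hu, lap_eq_hess hv, hess_add hu hv]
  simp [Finset.sum_add_distrib]

lemma lap_const_mul {u : En n → ℝ} {x : En n} (hu : ContDiffAt ℝ 2 u x) (c : ℝ) :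
    lap n (fun y => c * u y) x = c * lap n u x := by
  rw [lap_eq_hess (contDiffAt_const.mul hu), lap_eq_hess hu, hess_const_mul hu c]
  simp [Finset.mul_sum]

lemma hess_affine (c : ℝ) (T : En n →L[ℝ] ℝ) (x : En n) : hess n (fun y => c + T y) x = 0 := by
  unfold hess
  have : fderiv ℝ (fun y => c + T y) = fun _ => T := by
    ext1 y
    rw [fderiv_const_add]; exact T.fderiv
  rw [this]; simp

lemma affine_contDiffAt {m : WithTop ℕ∞} (c : ℝ) (T : En n →L[ℝ] ℝ) (x : En n) :
    ContDiffAt ℝ m (fun y => c + T y) x :=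
  contDiffAt_const.add T.contDiff.contDiffAt

lemma schauder_loc (n : ℕ) {γ : ℝ} (hγ : 0 < γ) : ∃ C > 0, ∀ Ω : Set (En n), IsOpen Ω →
    ∀ u : En n → ℝ, ContDiffOn ℝ 2 u Ω →
    ∀ x : En n, ∀ R S H : ℝ, 0 < R → closedBall x R ⊆ Ω → 0 ≤ H → ∀ c : ℝ, ∀ T : En n →L[ℝ] ℝ,
    (∀ y ∈ closedBall x R, |u y - (c + T y)| ≤ S) →
    (∀ y ∈ closedBall x R, |lap n u y - lap n u x| ≤ H * ‖y - x‖ ^ γ) →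
    ‖hess n u x‖ ≤ C * (R⁻¹^2 * S + H * R ^ γ) := by
  obtain ⟨C, hC, h⟩ := schauder_glob n hγ
  refine ⟨C, hC, ?_⟩
  intro Ω hΩ u hu x R S H hR hB hH0 c T hS hH
  have hu' : ContDiffOn ℝ 2 (fun y => u y - (c + T y)) Ω :=
    hu.sub (contDiff_const.add T.contDiff).contDiffOn
  obtain ⟨v, hv, hvu⟩ := ext_global hΩ hu' hR.le hB
  have hua : ∀ y ∈ closedBall x R, ContDiffAt ℝ 2 u y := fun y hy =>
    hu.contDiffAt (hΩ.mem_nhds (hB hy))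
  have hlap : ∀ y ∈ closedBall x R, lap n v y = lap n u y := by
    intro y hy
    rw [lap_congr (hvu y hy), lap_sub (hua y hy) (affine_contDiffAt c T y),
      lap_eq_hess (affine_contDiffAt c T y), hess_affine]
    simp
  have hx : x ∈ closedBall x R := by simpa using hR.le
  have e : hess n v x = hess n u x := by
    rw [hess_congr (hvu x hx), hess_sub (hua x hx) (affine_contDiffAt c T x), hess_affine]
    ext a b; simp
  rw [← e]
  refine h v hv x R S H hR hH0 (fun y hy => ?_) (fun y hy => ?_)
  · rw [(hvu y hy).eq_of_nhds]; exact hS y hy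
  · rw [hlap y hy, hlap x hx]; exact hH y hy

lemma harnack_step (n : ℕ) : ∃ c > 0, c ≤ 1 ∧ ∃ C > 0, ∀ Ω : Set (En n), IsOpen Ω →
    ∀ u : En n → ℝ, ContDiffOn ℝ 2 u Ω → ∀ x x' : En n, ∀ ρ F : ℝ, 0 < ρ → closedBall x' (2*ρ) ⊆ Ω →
    ‖x - x'‖ ≤ ρ → (∀ y ∈ closedBall x' (2*ρ), 0 ≤ u y) →
    (∀ y ∈ closedBall x' (2*ρ), |lap n u y| ≤ F) →
    c * u x - C * (ρ^2 * F) ≤ u x' := by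
  obtain ⟨c, hc, hcl⟩ := rW1_lower
  obtain ⟨M0, hM0⟩ := (isCompact_closedBall (0 : En n) 1).exists_bound_of_continuousOn
    (rW_cont (n := n) 1).continuousOn
  set M := M0 + c with hMdef
  have hM : ∀ z : En n, rW 1 z ≤ M := by
    intro z
    by_cases hz : z ∈ closedBall (0 : En n) 1
    · have := (le_abs_self _).trans (hM0 z hz)
      linarith
    · rw [rW_zero 1 (by simp at hz; linarith)]
      have := (norm_nonneg _).trans (hM0 0 (by simp))
      linarith
  have hM00 : 0 ≤ M0 := (norm_nonneg _).trans (hM0 0 (by simp))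
  have hMpos : 0 < M := by linarith
  have hcM : c / M ≤ 1 := by rw [div_le_one hMpos]; linarith
  set I := ∫ z : En n, rW 1 z with hI
  have hIpos : 0 < I := rW1_int_pos
  set J := ∫ z : En n, |rW 0 z| with hJ
  have hJ0 : 0 ≤ J := integral_nonneg fun z => abs_nonneg _
  set q : ℝ := (4:ℝ)⁻¹ ^ n with hq
  have hq0 : 0 < q := by positivity
  have hq1 : q ≤ 1 := pow_le_one₀ (by norm_num) (by norm_num)
  refine ⟨q * (c / M), by positivity, by nlinarith [div_pos hc hMpos], 5 * J / I + 1, by positivity, ?_⟩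
  intro Ω hΩ u hu x x' ρ F hρ hB hxx hpos hF
  obtain ⟨v, hv, hvu⟩ := ext_global hΩ hu (by positivity) hB
  have hvpos : ∀ y ∈ closedBall x' (2*ρ), 0 ≤ v y := fun y hy => by
    rw [(hvu y hy).eq_of_nhds]; exact hpos y hy
  have hvF : ∀ y ∈ closedBall x' (2*ρ), |lap n v y| ≤ F := fun y hy => by
    rw [lap_congr (hvu y hy)]; exact hF y hy
  have hx' : x' ∈ closedBall x' (2*ρ) := by simp; positivity
  have hx : x ∈ closedBall x' (2*ρ) := by
    simp [dist_eq_norm]; linarith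
  have hF0 : 0 ≤ F := (abs_nonneg _).trans (hF x' hx')
  have hsub : closedBall x (ρ/2) ⊆ closedBall x' (2*ρ) := by
    apply closedBall_subset_closedBall'
    rw [dist_eq_norm]; linarith
  have m1 := mv_bound hv (x := x') (R := 2*ρ) (by positivity) hvF
  have m2 := mv_bound hv (x := x) (R := ρ/2) (by positivity) (fun y hy => hvF y (hsub hy))
  have caff : ∀ (x : En n) (t : ℝ), Continuous fun z : En n => x + t • z :=
    fun x t => (affine_contDiff (m := 0) x t).continuous
  have key : q * (c / M) * (∫ z, rW 1 z * v (x + (ρ/2) • z)) ≤ ∫ z, rW 1 z * v (x' + (2*ρ) • z) := by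
    set f : En n → ℝ := fun z => rW 1 z * v (x' + (2*ρ) • z) with hf
    set w : En n := (2*ρ)⁻¹ • (x - x') with hw
    have hwn : ‖w‖ ≤ 1/2 := by
      rw [hw, norm_smul, norm_inv, Real.norm_of_nonneg (by positivity : (0:ℝ) ≤ 2*ρ)]
      calc (2*ρ)⁻¹ * ‖x - x'‖ ≤ (2*ρ)⁻¹ * ρ := by gcongr
        _ = 1/2 := by field_simp
    have e1 : ∫ z, f z = q * ∫ z, f (w + (4:ℝ)⁻¹ • z) := by
      have h1 := Measure.integral_comp_smul (volume : Measure (En n)) (fun z => f (w + z)) (4:ℝ)⁻¹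
      rw [h1, integral_add_left_eq_self f w]
      simp [hq, abs_of_pos]
    rw [e1, mul_assoc, ← integral_const_mul]
    refine mul_le_mul_of_nonneg_left ?_ hq0.le
    have ep : ∀ z : En n, x' + (2*ρ) • (w + (4:ℝ)⁻¹ • z) = x + (ρ/2) • z := by
      intro z
      rw [hw, smul_add, smul_smul, smul_smul, mul_inv_cancel₀ (by positivity), one_smul]
      have : (2 * ρ * 4⁻¹) = ρ/2 := by ring
      rw [this]; abel
    have cs1 : HasCompactSupport fun z : En n => f (w + (4:ℝ)⁻¹ • z) := by
      refine HasCompactSupport.intro (isCompact_closedBall (0 : En n) 6) ?_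
      intro z hz
      have hz' : 6 < ‖z‖ := by simpa using hz
      have : 1 ≤ ‖w + (4:ℝ)⁻¹ • z‖ := by
        have h3 : ‖(4:ℝ)⁻¹ • z‖ - ‖w‖ ≤ ‖w + (4:ℝ)⁻¹ • z‖ := by
          have := norm_sub_norm_le ((4:ℝ)⁻¹ • z) (-w)
          rw [norm_neg, sub_neg_eq_add, add_comm _ w] at this
          exact this
        rw [norm_smul, norm_inv, Real.norm_of_nonneg (by norm_num : (0:ℝ) ≤ 4)] at h3
        linarith
      simp [hf, rW_zero 1 this]
    apply integral_mono
    · refine Integrable.const_mul ?_ _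
      exact Continuous.integrable_of_hasCompactSupport ((rW_cont 1).mul (hv.continuous.comp (caff _ _)))
        (hcs_of fun z hz => by simp [rW_zero 1 hz])
    · refine Continuous.integrable_of_hasCompactSupport ?_ cs1
      exact ((rW_cont 1).mul (hv.continuous.comp (caff _ _))).comp (caff _ _)
    · intro z
      simp only [hf, ep]
      by_cases hz : 1 ≤ ‖z‖
      · rw [rW_zero 1 hz]
        simp only [zero_mul, mul_zero]
        by_cases h1 : 1 ≤ ‖w + (4:ℝ)⁻¹ • z‖
        · rw [rW_zero 1 h1]; simp
        · refine mul_nonneg (rW1_nonneg _) (hvpos _ ?_)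
          rw [← ep z]
          simp only [mem_closedBall, dist_self_add_left, norm_smul]
          rw [Real.norm_of_nonneg (by positivity : (0:ℝ) ≤ 2*ρ)]
          nlinarith
      · have hz1 := (not_le.1 hz).le
        have h1 : ‖w + (4:ℝ)⁻¹ • z‖ ≤ 3/4 := by
          have h4 : ‖(4:ℝ)⁻¹ • z‖ = 4⁻¹ * ‖z‖ := by
            rw [norm_smul, norm_inv, Real.norm_of_nonneg (by norm_num : (0:ℝ) ≤ 4)]
          have := norm_add_le w ((4:ℝ)⁻¹ • z)
          linarith
        have h2 := hcl n _ h1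
        have h3 : 0 ≤ v (x + (ρ/2) • z) := by
          apply hvpos _ (hsub _)
          simp only [mem_closedBall, dist_self_add_left, norm_smul]
          rw [Real.norm_of_nonneg (by positivity : (0:ℝ) ≤ ρ/2)]
          nlinarith
        rw [← mul_assoc]
        refine mul_le_mul_of_nonneg_right ?_ h3
        calc c / M * rW 1 z ≤ c / M * M := by gcongr; exact hM z
          _ = c := by field_simp
          _ ≤ _ := h2
  rw [← (hvu x hx).eq_of_nhds, ← (hvu x' hx').eq_of_nhds]
  rw [abs_le] at m1 m2
  have k1 : q * (c/M) * (I * v x - J * ((ρ/2)^2 * F)) ≤ q * (c/M) * (∫ z, rW 1 z * v (x + (ρ/2) • z)) := by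
    gcongr
    linarith [m2.1]
  have k2 : q * (c / M) ≤ 1 := by nlinarith [div_pos hc hMpos]
  have k3 : q * (c/M) * (J * ((ρ/2)^2 * F)) ≤ J * (ρ^2 * F) := by
    have h1 : 0 ≤ J * (ρ^2*F) := by positivity
    have : q * (c/M) * (J * ((ρ/2)^2 * F)) ≤ 1 * (J * ((ρ/2)^2 * F)) := by gcongr
    nlinarith
  have k4 : I * (q * (c/M) * v x) - 5 * J * (ρ^2 * F) ≤ I * v x' := by
    nlinarith [m1.2]
  have k5 : I * (q * (c / M) * v x - (5 * J / I + 1) * (ρ^2 * F)) ≤ I * v x' := by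
    have e : I * (q * (c / M) * v x - (5 * J / I + 1) * (ρ^2 * F)) =
      I * (q * (c/M) * v x) - 5 * J * (ρ^2 * F) - I * (ρ^2 * F) := by
      have h5 : I * (5*J/I) = 5*J := by field_simp
      linear_combination (-(ρ^2*F)) * h5
    rw [e]
    have : 0 ≤ I * (ρ^2*F) := by positivity
    linarith
  exact le_of_mul_le_mul_left k5 hIpos

end

section

open MeasureTheory Real Set Metric Bornology Filter
open scoped RealInnerProductSpace ENNReal NNReal Pointwise

/-- Radial power weight restricted to norms in a set. -/
def rad (n : ℕ) (T : Set ℝ) (q : ℝ) (z : En n) : ℝ := T.indicator (fun r => r ^ (q - n)) ‖z‖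

def kn (n : ℕ) : ℝ := n * (volume : Measure (En n)).real (ball 0 1)

lemma kn_pos {n : ℕ} (hn : 1 ≤ n) : 0 < kn n := by
  unfold kn
  have h1 : 0 < (volume : Measure (En n)).real (ball 0 1) :=
    ENNReal.toReal_pos (measure_ball_pos volume _ one_pos).ne' measure_ball_lt_top.ne
  have : (0:ℝ) < n := by exact_mod_cast hn
  positivity

lemma rad_nonneg {n : ℕ} {T : Set ℝ} {q : ℝ} (z : En n) : 0 ≤ rad n T q z := by
  classical
  unfold rad
  rw [indicator_apply]
  split_ifs
  · exact rpow_nonneg (norm_nonneg _) _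
  · exact le_rfl

lemma rad_main {n : ℕ} (hn : 1 ≤ n) {T : Set ℝ} (hT : MeasurableSet T) (hT0 : T ⊆ Ioi 0) {q : ℝ}
    (h : IntegrableOn (fun r : ℝ => r ^ (q - 1)) T) :
    Integrable (rad n T q) ∧ ∫ z, rad n T q z = kn n * ∫ r in T, r ^ (q - 1) := by
  have : Nonempty (Fin n) := ⟨⟨0, hn⟩⟩
  have e : ∀ y ∈ Ioi (0:ℝ), y ^ (Module.finrank ℝ (En n) - 1) • T.indicator (fun r => r ^ (q - n)) y
      = T.indicator (fun r => r ^ (q - 1)) y := by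
    intro y hy
    have hy0 : (0:ℝ) < y := hy
    by_cases hyT : y ∈ T
    · simp only [indicator_of_mem hyT, finrank_euclideanSpace, Fintype.card_fin, smul_eq_mul]
      rw [← rpow_natCast, ← rpow_add hy0]
      congr 1
      push_cast [hn]
      ring
    · simp [indicator_of_notMem hyT]
  constructor
  · unfold rad
    rw [integrable_fun_norm_addHaar (μ := volume) (f := T.indicator (fun r => r ^ (q - n)))]
    have : IntegrableOn (T.indicator (fun r : ℝ => r ^ (q - 1))) (Ioi 0) :=
      (h.integrable_indicator hT).integrableOn
    exact this.congr_fun (fun y hy => (e y hy).symm) measurableSet_Ioi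
  · unfold rad
    rw [integral_fun_norm_addHaar volume (T.indicator (fun r => r ^ (q - n))),
      setIntegral_congr_fun measurableSet_Ioi e, setIntegral_indicator hT,
      inter_eq_self_of_subset_right hT0]
    simp [kn, finrank_euclideanSpace, mul_assoc]

lemma rad_near {n : ℕ} (hn : 1 ≤ n) {a τ : ℝ} (ha : 0 < a) (hτ : 0 < τ) :
    Integrable (rad n (Ioo 0 τ) a) ∧ ∫ z, rad n (Ioo 0 τ) a z = kn n / a * τ ^ a := by
  obtain ⟨h1, h2⟩ := rad_main hn (T := Ioo 0 τ) measurableSet_Ioo (fun x hx => hx.1) (q := a)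
    ((intervalIntegral.integrableOn_Ioo_rpow_iff hτ).2 (by linarith))
  refine ⟨h1, ?_⟩
  rw [h2, ← integral_Ioc_eq_integral_Ioo, ← intervalIntegral.integral_of_le hτ.le,
    integral_rpow (Or.inl (by linarith)), sub_add_cancel, zero_rpow ha.ne']
  ring

lemma rad_far {n : ℕ} (hn : 1 ≤ n) {b τ : ℝ} (hb : 0 < b) (hτ : 0 < τ) :
    Integrable (rad n (Ici τ) (-b)) ∧ ∫ z, rad n (Ici τ) (-b) z = kn n / b * τ ^ (-b) := by
  obtain ⟨h1, h2⟩ := rad_main hn (T := Ici τ) measurableSet_Ici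
    (fun x (hx : τ ≤ x) => hτ.trans_le hx) (q := -b)
    ((integrableOn_Ici_iff_integrableOn_Ioi (by simp)).2 (integrableOn_Ioi_rpow_of_lt (by linarith) hτ))
  refine ⟨h1, ?_⟩
  rw [h2, integral_Ici_eq_integral_Ioi, integral_Ioi_rpow_of_lt (by linarith) hτ, sub_add_cancel]
  field_simp

lemma rad_log {n : ℕ} (hn : 1 ≤ n) {τ : ℝ} (hτ : 0 < τ) (hτ1 : τ ≤ 1) :
    Integrable (rad n (Ico τ 1) 0) ∧ ∫ z, rad n (Ico τ 1) 0 z = kn n * |log τ| := by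
  have e : (fun r : ℝ => r ^ ((0:ℝ) - 1)) = fun r => r⁻¹ := by
    ext r; rw [zero_sub, rpow_neg_one]
  have hI : IntervalIntegrable (fun r : ℝ => r ^ ((0:ℝ) - 1)) volume τ 1 := by
    rw [e, intervalIntegrable_inv_iff]; right
    rw [uIcc_of_le hτ1]; intro h; linarith [h.1]
  obtain ⟨h1, h2⟩ := rad_main hn (T := Ico τ 1) measurableSet_Ico
    (fun x hx => hτ.trans_le hx.1) (q := 0)
    ((intervalIntegrable_iff_integrableOn_Ico_of_le hτ1).1 hI)
  refine ⟨h1, ?_⟩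
  rw [h2, integral_Ico_eq_integral_Ioc, ← intervalIntegral.integral_of_le hτ1, e,
    integral_inv_of_pos hτ one_pos, one_div, log_inv, abs_of_nonpos (log_nonpos hτ.le hτ1)]

end

section

open MeasureTheory Real Set Metric Bornology Filter
open scoped RealInnerProductSpace ENNReal NNReal Pointwise

variable {n : ℕ}

def sd (u : En n → ℝ) (x z : En n) : ℝ := 2 * u x - u (x + z) - u (x - z)

lemma grad_lip {Ω S : Set (En n)} (hΩ : IsOpen Ω) {u : En n → ℝ} (hu : ContDiffOn ℝ 2 u Ω)
    (hS : Convex ℝ S) (hSΩ : S ⊆ Ω) {Λ : ℝ} (hΛ : ∀ y ∈ S, ‖hess n u y‖ ≤ Λ) {a b : En n}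
    (ha : a ∈ S) (hb : b ∈ S) : ‖fderiv ℝ u b - fderiv ℝ u a‖ ≤ Λ * ‖b - a‖ := by
  refine hS.norm_image_sub_le_of_norm_fderiv_le (𝕜 := ℝ) (fun y hy => ?_) hΛ ha hb
  exact fderiv_diff (hu.contDiffAt (hΩ.mem_nhds (hSΩ hy)))

lemma taylor1 {Ω S : Set (En n)} (hΩ : IsOpen Ω) {u : En n → ℝ} (hu : ContDiffOn ℝ 2 u Ω)
    (hS : Convex ℝ S) (hSΩ : S ⊆ Ω) {Λ : ℝ} (hΛ : ∀ y ∈ S, ‖hess n u y‖ ≤ Λ) {a b : En n}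
    (ha : a ∈ S) (hb : b ∈ S) : |u b - u a - fderiv ℝ u a (b - a)| ≤ Λ * ‖b - a‖ ^ 2 := by
  have hΛ0 : 0 ≤ Λ := (norm_nonneg (hess n u a)).trans (hΛ a ha)
  have hseg : segment ℝ a b ⊆ S := hS.segment_subset ha hb
  have := (convex_segment a b).norm_image_sub_le_of_norm_fderiv_le' (𝕜 := ℝ) (f := u)
    (φ := fderiv ℝ u a) (C := Λ * ‖b - a‖) (fun y hy => ?_) (fun y hy => ?_)
    (left_mem_segment ℝ a b) (right_mem_segment ℝ a b)
  · rw [Real.norm_eq_abs] at this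
    linarith [this, pow_two ‖b - a‖, mul_assoc Λ ‖b-a‖ ‖b-a‖]
  · exact (hu.contDiffAt (hΩ.mem_nhds (hSΩ (hseg hy)))).differentiableAt (by simp)
  · refine (grad_lip hΩ hu hS hSΩ hΛ ha (hseg hy)).trans ?_
    gcongr
    have := norm_sub_le_of_mem_segment hy
    exact this

lemma sd_le {Ω S : Set (En n)} (hΩ : IsOpen Ω) {u : En n → ℝ} (hu : ContDiffOn ℝ 2 u Ω)
    (hS : Convex ℝ S) (hSΩ : S ⊆ Ω) {Λ : ℝ} (hΛ : ∀ y ∈ S, ‖hess n u y‖ ≤ Λ) {x z : En n}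
    (h0 : x ∈ S) (h1 : x + z ∈ S) (h2 : x - z ∈ S) : |sd u x z| ≤ 2 * Λ * ‖z‖ ^ 2 := by
  have t1 := taylor1 hΩ hu hS hSΩ hΛ h0 h1
  have t2 := taylor1 hΩ hu hS hSΩ hΛ h0 h2
  rw [add_sub_cancel_left] at t1
  rw [sub_sub_cancel_left, map_neg, norm_neg] at t2
  unfold sd
  rw [abs_le] at *
  constructor <;> linarith [t1.1, t1.2, t2.1, t2.2]

lemma sd_diff {Ω : Set (En n)} (hΩ : IsOpen Ω) {u : En n → ℝ} (hu : ContDiffOn ℝ 2 u Ω)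
    {c : En n} {R r : ℝ} (hSΩ : closedBall c R ⊆ Ω) {Λ : ℝ}
    (hΛ : ∀ y ∈ closedBall c R, ‖hess n u y‖ ≤ Λ) {x y z : En n}
    (hx : x ∈ closedBall c r) (hy : y ∈ closedBall c r) (hz : ‖z‖ + r ≤ R) :
    |sd u x z - sd u y z| ≤ 2 * Λ * ‖z‖ * ‖x - y‖ := by
  have m0 : ∀ w ∈ closedBall c r, w ∈ closedBall c R := fun w hw => by
    simp only [mem_closedBall] at *; linarith [norm_nonneg z]
  have m1 : ∀ w ∈ closedBall c r, w + z ∈ closedBall c R := fun w hw => by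
    simp only [mem_closedBall, dist_eq_norm] at *
    have : w + z - c = (w - c) + z := by abel
    rw [this]
    linarith [norm_add_le (w - c) z]
  have m2 : ∀ w ∈ closedBall c r, w - z ∈ closedBall c R := fun w hw => by
    simp only [mem_closedBall, dist_eq_norm] at *
    have : w - z - c = (w - c) - z := by abel
    rw [this]
    linarith [norm_sub_le (w - c) z]
  have hd : ∀ w ∈ closedBall c R, DifferentiableAt ℝ u w := fun w hw =>
    (hu.contDiffAt (hΩ.mem_nhds (hSΩ hw))).differentiableAt (by simp)
  have hD : ∀ w ∈ closedBall c r, HasFDerivAt (fun w => sd u w z)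
      ((2:ℝ) • fderiv ℝ u w - fderiv ℝ u (w + z) - fderiv ℝ u (w - z)) w := by
    intro w hw
    have h1 := (hd w (m0 w hw)).hasFDerivAt.const_mul (2:ℝ)
    have h2 := (hasFDerivAt_comp_add_right z).2 (hd _ (m1 w hw)).hasFDerivAt
    have h3 := (hasFDerivAt_comp_sub z).2 (hd _ (m2 w hw)).hasFDerivAt
    exact (h1.sub h2).sub h3
  have := (convex_closedBall c r).norm_image_sub_le_of_norm_hasFDerivWithin_le (𝕜 := ℝ)
    (f := fun w => sd u w z) (C := 2 * Λ * ‖z‖)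
    (fun w hw => (hD w hw).hasFDerivWithinAt) (fun w hw => ?_) hy hx
  · exact this
  · have g1 := grad_lip hΩ hu (convex_closedBall c R) hSΩ hΛ (m1 w hw) (m0 w hw)
    have g2 := grad_lip hΩ hu (convex_closedBall c R) hSΩ hΛ (m2 w hw) (m0 w hw)
    rw [sub_add_cancel_left, norm_neg] at g1
    rw [sub_sub_cancel] at g2
    have e : (2:ℝ) • fderiv ℝ u w - fderiv ℝ u (w + z) - fderiv ℝ u (w - z) =
      (fderiv ℝ u w - fderiv ℝ u (w + z)) + (fderiv ℝ u w - fderiv ℝ u (w - z)) := by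
      rw [two_smul]; abel
    rw [e]
    refine (norm_add_le _ _).trans ?_
    linarith

lemma grad_le {Ω : Set (En n)} (hΩ : IsOpen Ω) {u : En n → ℝ} (hu : ContDiffOn ℝ 2 u Ω)
    {x : En n} {ρ : ℝ} (hρ : 0 < ρ) (hSΩ : closedBall x ρ ⊆ Ω) {Λ M : ℝ}
    (hΛ : ∀ y ∈ closedBall x ρ, ‖hess n u y‖ ≤ Λ) (hM : ∀ y ∈ closedBall x ρ, |u y| ≤ M) :
    ‖fderiv ℝ u x‖ ≤ 2 * M / ρ + Λ * ρ := by
  have hx : x ∈ closedBall x ρ := by simp [hρ.le]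
  have hM0 : 0 ≤ M := (abs_nonneg _).trans (hM x hx)
  have hΛ0 : 0 ≤ Λ := (norm_nonneg (hess n u x)).trans (hΛ x hx)
  refine ContinuousLinearMap.opNorm_le_of_unit_norm (by positivity) ?_
  intro e he
  have hm : x + ρ • e ∈ closedBall x ρ := by simp [norm_smul, he, abs_of_pos hρ]
  have t := taylor1 hΩ hu (convex_closedBall x ρ) hSΩ hΛ hx hm
  rw [add_sub_cancel_left, map_smul, norm_smul, he, Real.norm_of_nonneg hρ.le, mul_one,
    smul_eq_mul] at t
  have b1 := hM x hx
  have b2 := hM _ hm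
  have : ρ * |fderiv ℝ u x e| ≤ 2 * M + Λ * ρ^2 := by
    rw [← abs_of_pos hρ, ← abs_mul, abs_of_pos hρ]
    rw [abs_le] at *
    constructor <;> linarith [t.1, t.2, b1.1, b1.2, b2.1, b2.2]
  rw [Real.norm_eq_abs]
  have h3 : 2 * M / ρ + Λ * ρ = (2 * M + Λ * ρ^2) / ρ := by field_simp
  rw [h3, le_div_iff₀ hρ]; linarith

end

section

open MeasureTheory Real Set Metric Bornology Filter
open scoped RealInnerProductSpace ENNReal NNReal Pointwise

variable {n : ℕ}

def Kt (n : ℕ) (s τ : ℝ) (z : En n) : ℝ := (max ‖z‖ τ) ^ (-((n:ℝ) + 2 * s))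

lemma Kt_nonneg {s τ : ℝ} (z : En n) : 0 ≤ Kt n s τ z :=
  rpow_nonneg ((norm_nonneg _).trans (le_max_left _ _)) _

lemma Kt_cont {s τ : ℝ} (hτ : 0 < τ) : Continuous (Kt n s τ) := by
  unfold Kt
  refine Continuous.rpow_const (continuous_norm.max continuous_const) fun z => Or.inl ?_
  exact (hτ.trans_le (le_max_right _ _)).ne'

lemma Kt_int (hn : 1 ≤ n) {s τ : ℝ} (hs : 0 < s) (hτ : 0 < τ) :
    Integrable (Kt n s τ) ∧ ∫ z, Kt n s τ z ≤ (kn n / n + kn n / (2*s)) * τ ^ (-(2*s)) := by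
  have hn0 : (0:ℝ) < n := by exact_mod_cast hn
  have : Nonempty (Fin n) := ⟨⟨0, hn⟩⟩
  obtain ⟨a1, a2⟩ := rad_near hn (a := n) hn0 hτ
  obtain ⟨b1, b2⟩ := rad_far hn (b := 2*s) (by positivity) hτ
  have hb : ∀ᵐ z : En n, Kt n s τ z ≤ τ ^ (-((n:ℝ)+2*s)) * rad n (Ioo 0 τ) n z + rad n (Ici τ) (-(2*s)) z := by
    filter_upwards [compl_mem_ae_iff.2 (measure_singleton (0 : En n))] with z hz
    have hz0 : 0 < ‖z‖ := norm_pos_iff.2 hz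
    unfold Kt
    by_cases h : ‖z‖ < τ
    · rw [max_eq_right h.le]
      have : rad n (Ioo 0 τ) n z = 1 := by
        unfold rad; rw [indicator_of_mem (show ‖z‖ ∈ Ioo 0 τ from ⟨hz0, h⟩)]; simp
      rw [this]; linarith [rad_nonneg (T := Ici τ) (q := -(2*s)) z]
    · push Not at h
      rw [max_eq_left h]
      have : rad n (Ici τ) (-(2*s)) z = ‖z‖ ^ (-((n:ℝ)+2*s)) := by
        unfold rad; rw [indicator_of_mem (show ‖z‖ ∈ Ici τ from h)]; congr 1; ring
      rw [this]
      have := rad_nonneg (T := Ioo 0 τ) (q := n) z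
      have : 0 ≤ τ ^ (-((n:ℝ)+2*s)) := by positivity
      nlinarith
  have hI : Integrable (fun z : En n => τ ^ (-((n:ℝ)+2*s)) * rad n (Ioo 0 τ) n z + rad n (Ici τ) (-(2*s)) z) :=
    (a1.const_mul _).add b1
  have hK : Integrable (Kt n s τ) := by
    refine hI.mono' (Kt_cont hτ).aestronglyMeasurable ?_
    filter_upwards [hb] with z hz
    rwa [Real.norm_of_nonneg (Kt_nonneg z)]
  refine ⟨hK, (integral_mono_ae hK hI hb).trans (le_of_eq ?_)⟩
  rw [integral_add (a1.const_mul _) b1, integral_const_mul, a2, b2]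
  have : τ ^ (-((n:ℝ)+2*s)) * (kn n / n * τ ^ (n:ℝ)) = kn n / n * τ ^ (-(2*s)) := by
    have e : τ ^ (-(2*s)) = τ ^ (-((n:ℝ)+2*s)) * τ ^ (n:ℝ) := by
      rw [← rpow_add hτ]; congr 1; ring
    rw [e]; ring
  rw [this]; ring

lemma near_bd {s τ a B A : ℝ} (hs : 0 < s) (hτ : 0 < τ) (z : En n) (h0 : z = 0 → A = 0)
    (h1 : ‖z‖ < τ → |A| ≤ B * ‖z‖ ^ a) :
    |A / ‖z‖ ^ ((n:ℝ) + 2*s) - A * Kt n s τ z| ≤ B * rad n (Ioo 0 τ) (a - 2*s) z := by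
  by_cases hz : z = 0
  · rw [h0 hz]; simp [hz, rad]
  have hz0 : 0 < ‖z‖ := norm_pos_iff.2 hz
  by_cases h : ‖z‖ < τ
  · have e1 : rad n (Ioo 0 τ) (a - 2*s) z = ‖z‖ ^ a * ‖z‖ ^ (-((n:ℝ)+2*s)) := by
      unfold rad; rw [indicator_of_mem (show ‖z‖ ∈ Ioo 0 τ from ⟨hz0, h⟩), ← rpow_add hz0]; congr 1; ring
    rw [e1, div_eq_mul_inv, ← rpow_neg hz0.le, ← mul_sub, abs_mul, ← mul_assoc]
    have hK : Kt n s τ z ≤ ‖z‖ ^ (-((n:ℝ)+2*s)) := by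
      unfold Kt
      exact rpow_le_rpow_of_nonpos hz0 (le_max_left _ _) (by have : (0:ℝ) ≤ n := n.cast_nonneg; linarith)
    have hK0 := Kt_nonneg (s := s) (τ := τ) z
    refine mul_le_mul (h1 h) ?_ (abs_nonneg _) ((abs_nonneg _).trans (h1 h))
    rw [abs_of_nonneg (by linarith)]; linarith
  · push Not at h
    have e1 : rad n (Ioo 0 τ) (a - 2*s) z = 0 := by
      unfold rad; rw [indicator_of_notMem (fun h' => absurd h'.2 (not_lt.2 h))]
    unfold Kt
    rw [e1, max_eq_left h, rpow_neg hz0.le, div_eq_mul_inv]; simp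

lemma sd_cont {u : En n → ℝ} (hu : Continuous u) (x : En n) : Continuous (sd u x) := by
  unfold sd; fun_prop

lemma sd_zero (u : En n → ℝ) (x : En n) : sd u x 0 = 0 := by simp [sd]; ring

lemma sd_bdd {u : En n → ℝ} {M : ℝ} (hM : ∀ y, |u y| ≤ M) (x z : En n) : |sd u x z| ≤ 4 * M := by
  have h1 := hM x
  have h2 := hM (x + z)
  have h3 := hM (x - z)
  unfold sd
  rw [abs_le] at *
  constructor <;> linarith [h1.1, h1.2, h2.1, h2.2, h3.1, h3.2]

lemma sdK_int (hn : 1 ≤ n) {s τ : ℝ} (hs : 0 < s) (hτ : 0 < τ) {u : En n → ℝ} (hu : Continuous u) {M : ℝ}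
    (hM : ∀ y, |u y| ≤ M) (x : En n) : Integrable fun z => sd u x z * Kt n s τ z :=
  (Kt_int hn hs hτ).1.bdd_mul (c := 4 * M) (sd_cont hu x).aestronglyMeasurable
    (Eventually.of_forall fun z => sd_bdd hM x z)

lemma sdN_int (hn : 1 ≤ n) {s τ : ℝ} (hs : 0 < s) (hs1 : s < 1) (hτ : 0 < τ) {u : En n → ℝ}
    (hu : Continuous u) {x : En n} {B : ℝ} (hB : ∀ z, ‖z‖ < τ → |sd u x z| ≤ B * ‖z‖ ^ 2) :
    Integrable fun z => sd u x z / ‖z‖ ^ ((n:ℝ) + 2*s) - sd u x z * Kt n s τ z := by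
  refine ((rad_near hn (a := 2 - 2*s) (by linarith) hτ).1.const_mul B).mono' ?_ ?_
  · refine AEStronglyMeasurable.sub ?_ ((sd_cont hu x).mul (Kt_cont hτ)).aestronglyMeasurable
    refine Measurable.aestronglyMeasurable ?_
    refine (sd_cont hu x).measurable.div ?_
    exact measurable_norm.pow_const _
  · refine Eventually.of_forall fun z => ?_
    rw [Real.norm_eq_abs]
    refine near_bd hs hτ z (fun h => by rw [h, sd_zero]) fun h => ?_
    rw [rpow_two]; exact hB z h

lemma sd_int (hn : 1 ≤ n) {s τ : ℝ} (hs : 0 < s) (hs1 : s < 1) (hτ : 0 < τ) {u : En n → ℝ}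
    (hu : Continuous u) {M : ℝ} (hM : ∀ y, |u y| ≤ M) {x : En n} {B : ℝ}
    (hB : ∀ z, ‖z‖ < τ → |sd u x z| ≤ B * ‖z‖ ^ 2) :
    Integrable fun z => sd u x z / ‖z‖ ^ ((n:ℝ) + 2*s) := by
  have := (sdN_int hn hs hs1 hτ hu hB).add (sdK_int hn hs hτ hu hM x)
  refine this.congr (Eventually.of_forall fun z => ?_)
  simp

lemma rpow_diff {p A B h : ℝ} (hp : 0 < p) (hA : 0 < A) (hAB : A ≤ B) (h1 : B - A ≤ h) :
    A ^ (-p) - B ^ (-p) ≤ p * A ^ (-p) * (h / A) := by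
  have hB : 0 < B := hA.trans_le hAB
  have e : B ^ (-p) = A ^ (-p) * (B/A) ^ (-p) := by
    rw [← mul_rpow hA.le (by positivity), mul_div_cancel₀ _ hA.ne']
  have h2 : 1 - p * (h / A) ≤ (B/A) ^ (-p) := by
    rw [rpow_def_of_pos (by positivity)]
    have h3 := add_one_le_exp (log (B/A) * -p)
    have h4 := log_le_sub_one_of_pos (x := B/A) (by positivity)
    have h5 : B/A - 1 ≤ h/A := by
      rw [div_sub_one hA.ne']; gcongr
    nlinarith
  rw [e]
  have : 0 < A ^ (-p) := by positivity
  nlinarith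

lemma Kt_lip {s τ : ℝ} (hs : 0 < s) (hτ : 0 < τ) {a b : En n} (h : ‖a - b‖ ≤ τ) :
    |Kt n s τ a - Kt n s τ b| ≤
      ((n + 2*s) * 2 ^ ((n:ℝ) + 2*s + 1)) * ‖a - b‖ * ((max ‖a‖ τ)⁻¹ * Kt n s τ a) := by
  set p : ℝ := n + 2*s with hp
  have hn0 : (0:ℝ) ≤ n := n.cast_nonneg
  have hp0 : 0 < p := by linarith
  unfold Kt
  rw [← hp]
  set A := max ‖a‖ τ with hA
  set B := max ‖b‖ τ with hB
  have hA0 : τ ≤ A := le_max_right _ _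
  have hB0 : τ ≤ B := le_max_right _ _
  have hAp : 0 < A := by linarith
  have hBp : 0 < B := by linarith
  have h1 : |A - B| ≤ ‖a - b‖ := by
    have := abs_max_sub_max_le_abs ‖a‖ ‖b‖ τ
    exact this.trans (abs_norm_sub_norm_le a b)
  have h2 : (1:ℝ) ≤ 2 ^ (p+1) := one_le_rpow (by norm_num) (by linarith)
  rcases le_total A B with hAB | hAB
  · rw [abs_of_nonneg (sub_nonneg.2 (rpow_le_rpow_of_nonpos hAp hAB (by linarith)))]
    rw [abs_sub_comm, abs_of_nonneg (by linarith)] at h1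
    have := rpow_diff hp0 hAp hAB h1
    calc _ ≤ _ := this
      _ = (p * 1) * ‖a - b‖ * (A⁻¹ * A ^ (-p)) := by field_simp
      _ ≤ _ := by gcongr
  · rw [abs_of_nonpos (sub_nonpos.2 (rpow_le_rpow_of_nonpos hBp hAB (by linarith)))]
    rw [abs_of_nonneg (by linarith)] at h1
    have := rpow_diff hp0 hBp hAB h1
    have hAB2 : A / 2 ≤ B := by linarith
    have e1 : B ^ (-p) * B⁻¹ ≤ 2 ^ (p+1) * (A ^ (-p) * A⁻¹) := by
      have e2 : ∀ t : ℝ, 0 < t → t ^ (-p) * t⁻¹ = t ^ (-(p+1)) := by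
        intro t ht
        rw [← rpow_neg_one t, ← rpow_add ht]; congr 1; ring
      rw [e2 B hBp, e2 A hAp]
      calc B ^ (-(p+1)) ≤ (A/2) ^ (-(p+1)) := rpow_le_rpow_of_nonpos (by positivity) hAB2 (by linarith)
        _ = _ := by
          rw [div_rpow hAp.le (by norm_num), rpow_neg (by norm_num : (0:ℝ) ≤ 2), div_inv_eq_mul, mul_comm]
    calc _ = B ^ (-p) - A ^ (-p) := by ring
      _ ≤ _ := this
      _ = p * ‖a - b‖ * (B ^ (-p) * B⁻¹) := by rw [div_eq_mul_inv]; ring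
      _ ≤ p * ‖a - b‖ * (2 ^ (p+1) * (A ^ (-p) * A⁻¹)) := by gcongr
      _ = _ := by ring

end

section

open MeasureTheory Real Set Metric Bornology Filter
open scoped RealInnerProductSpace ENNReal NNReal Pointwise

variable {n : ℕ}

lemma Kt_neg {s τ : ℝ} (z : En n) : Kt n s τ (-z) = Kt n s τ z := by simp [Kt]

lemma sdK_eq (hn : 1 ≤ n) {s τ : ℝ} (hs : 0 < s) (hτ : 0 < τ) {u : En n → ℝ} (hu : Continuous u) {M : ℝ}
    (hM : ∀ y, |u y| ≤ M) (x : En n) :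
    ∫ z, sd u x z * Kt n s τ z = 2 * u x * (∫ z, Kt n s τ z) - 2 * ∫ w, u w * Kt n s τ (w - x) := by
  have hK := (Kt_int hn hs hτ).1
  have i1 : Integrable fun z => u (x + z) * Kt n s τ z :=
    hK.bdd_mul (c := M) (by fun_prop) (Eventually.of_forall fun z => hM _)
  have i2 : Integrable fun z => u (x - z) * Kt n s τ z :=
    hK.bdd_mul (c := M) (by fun_prop) (Eventually.of_forall fun z => hM _)
  have e1 : ∫ z, u (x + z) * Kt n s τ z = ∫ w, u w * Kt n s τ (w - x) := by
    rw [← integral_add_left_eq_self (fun w => u w * Kt n s τ (w - x)) x]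
    simp
  have e2 : ∫ z, u (x - z) * Kt n s τ z = ∫ z, u (x + z) * Kt n s τ z := by
    rw [← integral_neg_eq_self (fun z => u (x + z) * Kt n s τ z)]
    simp [Kt_neg, sub_eq_add_neg]
  calc ∫ z, sd u x z * Kt n s τ z
      = ∫ z, (2 * u x * Kt n s τ z - u (x + z) * Kt n s τ z - u (x - z) * Kt n s τ z) := by
        congr 1; ext z; unfold sd; ring
    _ = _ := by
        have j1 := integral_sub (hK.const_mul (2 * u x)) i1
        have j2 := integral_sub ((hK.const_mul (2 * u x)).sub i1) i2
        simp only [Pi.sub_apply] at j2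
        rw [j2, j1, integral_const_mul, e2, e1]
        ring

lemma sdK_diff (hn : 1 ≤ n) {s : ℝ} (hs : 0 < s) : ∃ C > 0, ∀ τ > 0, ∀ u : En n → ℝ, Continuous u →
    ∀ M : ℝ, (∀ y, |u y| ≤ M) → ∀ x y : En n, ∀ K d : ℝ, 0 ≤ K → τ ≤ d →
    (∀ z, |u (x + z)| ≤ K * (d + ‖z‖)) → ‖x - y‖ ≤ τ →
    |(∫ z, sd u x z * Kt n s τ z) - ∫ z, sd u y z * Kt n s τ z| ≤
      C * (|u x - u y| * τ ^ (-(2*s)) + K * d * τ ^ (-1 - 2*s) * ‖x - y‖) := by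
  have hn0 : (0:ℝ) < n := by exact_mod_cast hn
  set c0 := kn n / n + kn n / (2*s) with hc0
  have hc0p : 0 < c0 := by have := kn_pos hn; positivity
  set c1 : ℝ := (n + 2*s) * 2 ^ ((n:ℝ) + 2*s + 1) with hc1
  have hc1p : 0 < c1 := by positivity
  refine ⟨2 * c0 + 4 * c0 * c1, by positivity, ?_⟩
  intro τ hτ u hu M hM x y K d hK hd hz hxy
  obtain ⟨kI, kB⟩ := Kt_int (n := n) (s := s) hn hs hτ
  rw [← hc0] at kB
  rw [sdK_eq hn hs hτ hu hM x, sdK_eq hn hs hτ hu hM y]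
  set I := ∫ z : En n, Kt n s τ z with hI
  have hI0 : 0 ≤ I := integral_nonneg fun z => Kt_nonneg z
  have jI : ∀ x : En n, Integrable fun w => Kt n s τ (w - x) := fun x => kI.comp_sub_right x
  have uI : ∀ x : En n, Integrable fun w => u w * Kt n s τ (w - x) := fun x =>
    (jI x).bdd_mul (c := M) (by fun_prop) (Eventually.of_forall fun z => hM _)
  have key : |(∫ w, u w * Kt n s τ (w - x)) - ∫ w, u w * Kt n s τ (w - y)| ≤
      (K * (2 * d / τ) * (c1 * ‖x - y‖)) * I := by
    rw [← integral_sub (uI x) (uI y)]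
    have e : I = ∫ w : En n, Kt n s τ (w - x) := (integral_sub_right_eq_self (fun z => Kt n s τ z) x).symm
    rw [e, ← integral_const_mul]
    rw [← Real.norm_eq_abs]
    refine norm_integral_le_of_norm_le ((jI x).const_mul _) (Eventually.of_forall fun w => ?_)
    rw [← mul_sub, norm_mul, Real.norm_eq_abs, Real.norm_eq_abs]
    have e2 : (w - x) - (w - y) = -(x - y) := by abel
    have h1 := Kt_lip (n := n) hs hτ (a := w - x) (b := w - y) (by rw [e2, norm_neg]; exact hxy)
    rw [← hc1, e2, norm_neg] at h1
    have h2 := hz (w - x)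
    rw [add_sub_cancel] at h2
    set A := max ‖w - x‖ τ with hA
    have hAτ : τ ≤ A := le_max_right _ _
    have hAp : 0 < A := by linarith
    have hAw : ‖w - x‖ ≤ A := le_max_left _ _
    have hkn := Kt_nonneg (s := s) (τ := τ) (w - x)
    have h3 : (d + ‖w - x‖) * A⁻¹ ≤ 2 * d / τ := by
      rw [← div_eq_mul_inv, div_le_div_iff₀ hAp hτ]
      nlinarith
    calc |u w| * |Kt n s τ (w - x) - Kt n s τ (w - y)|
        ≤ (K * (d + ‖w - x‖)) * (c1 * ‖x - y‖ * (A⁻¹ * Kt n s τ (w - x))) :=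
          mul_le_mul h2 h1 (abs_nonneg _) ((abs_nonneg _).trans h2)
      _ = K * ((d + ‖w - x‖) * A⁻¹) * (c1 * ‖x - y‖) * Kt n s τ (w - x) := by ring
      _ ≤ K * (2 * d / τ) * (c1 * ‖x - y‖) * Kt n s τ (w - x) := by gcongr
  set T := τ ^ (-(2*s)) with hT
  have hT0 : 0 < T := by positivity
  have eT : τ ^ (-1 - 2*s) = T / τ := by
    rw [hT, show (-1 - 2*s) = -(2*s) - 1 by ring, rpow_sub_one hτ.ne']
  rw [eT]
  have hd0 : 0 < d := by linarith
  have k1 : |u x - u y| * I ≤ |u x - u y| * (c0 * T) := by gcongr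
  have k2 : (K * (2 * d / τ) * (c1 * ‖x - y‖)) * I ≤ (K * (2 * d / τ) * (c1 * ‖x - y‖)) * (c0 * T) := by
    gcongr
  have e : 2 * u x * I - 2 * (∫ w, u w * Kt n s τ (w - x)) - (2 * u y * I - 2 * ∫ w, u w * Kt n s τ (w - y))
     = 2 * ((u x - u y) * I) - 2 * ((∫ w, u w * Kt n s τ (w - x)) - ∫ w, u w * Kt n s τ (w - y)) := by ring
  rw [e]
  have k3 := abs_sub (2 * ((u x - u y) * I)) (2 * ((∫ w, u w * Kt n s τ (w - x)) - ∫ w, u w * Kt n s τ (w - y)))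
  rw [abs_mul, abs_mul, abs_mul, abs_of_pos (by norm_num : (0:ℝ) < 2), abs_of_nonneg hI0] at k3
  have p1 : 0 ≤ c0 * c1 * (|u x - u y| * T) := by positivity
  have p2 : 0 ≤ c0 * (K * d * (T/τ) * ‖x - y‖) := by positivity
  have e3 : (K * (2 * d / τ) * (c1 * ‖x - y‖)) * (c0 * T) = 2 * c0 * c1 * (K * d * (T/τ) * ‖x - y‖) := by
    ring
  rw [e3] at k2
  nlinarith

lemma cK_pos (hn : 1 ≤ n) {s : ℝ} (hs : 0 < s) (hs1 : s < 1) : 0 < cK n s := by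
  unfold cK
  have hn0 : (0:ℝ) < n := by exact_mod_cast hn
  have := Real.Gamma_pos_of_pos (s := ((n:ℝ) + 2*s)/2) (by positivity)
  have := Real.Gamma_pos_of_pos (s := 1 - s) (by linarith)
  positivity

lemma fracLap_eq (n : ℕ) (s : ℝ) (u : En n → ℝ) (x : En n) :
    fracLap n s u x = (cK n s / 2) * ∫ z : En n, sd u x z / ‖z‖ ^ ((n : ℝ) + 2 * s) := rfl

set_option maxHeartbeats 800000 in
lemma frac_hold (hn : 1 ≤ n) {s : ℝ} (hs : 0 < s) (hs1 : s < 1) : ∃ C > 0, ∀ Ω : Set (En n), IsOpen Ω →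
    ∀ u : En n → ℝ, ContDiffOn ℝ 2 u Ω → Continuous u → ∀ M : ℝ, (∀ y, |u y| ≤ M) →
    ∀ x : En n, ∀ ρ Λ K d : ℝ, 0 < ρ → closedBall x ρ ⊆ Ω → (∀ y ∈ closedBall x ρ, ‖hess n u y‖ ≤ Λ) →
    0 ≤ K → ρ ≤ d → (∀ z, |u (x + z)| ≤ K * (d + ‖z‖)) → ∀ y, ‖x - y‖ ≤ ρ / 4 →
    |fracLap n s u x - fracLap n s u y| ≤
      C * (Λ * ρ ^ (1 - s) + K * d * ρ ^ (-1 - s)) * ‖x - y‖ ^ (1 - s) := by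
  obtain ⟨C1, hC1, hfar⟩ := sdK_diff hn hs
  have hkn := kn_pos hn
  have hcK := cK_pos hn hs hs1
  set c2 := 4 * (kn n / (1 - s)) with hc2
  have h1s : 0 < 1 - s := by linarith
  have hc2p : 0 < c2 := by positivity
  refine ⟨(cK n s / 2) * (c2 + C1 * (4 ^ (2*s) * 6 + 4 ^ (1 + 2*s))), by positivity, ?_⟩
  intro Ω hΩ u hu huc M hM x ρ Λ K d hρ hB hΛ hK hd hz y hxy
  set τ := ρ / 4 with hτ
  have hτ0 : 0 < τ := by positivity
  have hxm : x ∈ closedBall x ρ := by simp [hρ.le]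
  have hΛ0 : 0 ≤ Λ := (norm_nonneg (hess n u x)).trans (hΛ x hxm)
  set h := ‖x - y‖ with hh
  have hh0 : 0 ≤ h := norm_nonneg _
  have mem : ∀ w ∈ closedBall x τ, ∀ z : En n, ‖z‖ < τ → w ∈ closedBall x ρ ∧ w + z ∈ closedBall x ρ ∧
      w - z ∈ closedBall x ρ := by
    intro w hw z hz
    simp only [mem_closedBall, dist_eq_norm] at *
    have e1 : w + z - x = (w - x) + z := by abel
    have e2 : w - z - x = (w - x) - z := by abel
    rw [e1, e2]
    refine ⟨by linarith, by linarith [norm_add_le (w - x) z], by linarith [norm_sub_le (w - x) z]⟩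
  have hxτ : x ∈ closedBall x τ := by simp [hτ0.le]
  have hyτ : y ∈ closedBall x τ := by rw [mem_closedBall, dist_comm, dist_eq_norm]; exact hxy
  have sdb : ∀ w ∈ closedBall x τ, ∀ z : En n, ‖z‖ < τ → |sd u w z| ≤ (2 * Λ) * ‖z‖ ^ 2 := by
    intro w hw z hz
    obtain ⟨m0, m1, m2⟩ := mem w hw z hz
    exact sd_le hΩ hu (convex_closedBall x ρ) hB hΛ m0 m1 m2
  have sdd : ∀ z : En n, ‖z‖ < τ → |sd u x z - sd u y z| ≤ (4 * Λ * h ^ (1-s)) * ‖z‖ ^ (1 + s) := by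
    intro z hz
    have a1 : |sd u x z - sd u y z| ≤ 4 * Λ * ‖z‖ ^ 2 := by
      have b1 := sdb x hxτ z hz
      have b2 := sdb y hyτ z hz
      have := abs_sub (sd u x z) (sd u y z)
      linarith
    have a2 := sd_diff hΩ hu hB hΛ hxτ hyτ (z := z) (by linarith)
    rw [← hh] at a2
    rcases le_total ‖z‖ h with hle | hle
    · by_cases hz0 : z = 0
      · rw [hz0, sd_zero, sd_zero]; simp; positivity
      have hz1 : 0 < ‖z‖ := norm_pos_iff.2 hz0
      have b1 := sdb x hxτ z hz
      have b2 := sdb y hyτ z hz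
      have a3 : ‖z‖ ^ 2 ≤ h ^ (1-s) * ‖z‖ ^ (1+s) := by
        calc ‖z‖ ^ 2 = ‖z‖ ^ (1-s) * ‖z‖ ^ (1+s) := by
              rw [← rpow_add hz1, ← rpow_two]; congr 1; ring
          _ ≤ _ := by gcongr
      calc _ ≤ _ := a1
        _ ≤ 4 * Λ * (h ^ (1-s) * ‖z‖ ^ (1+s)) := by gcongr
        _ = _ := by ring
    · have a3 : ‖z‖ * h ≤ h ^ (1-s) * ‖z‖ ^ (1+s) := by
        by_cases hh1 : h = 0
        · rw [hh1, zero_rpow h1s.ne']; simp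
        have hh2 : 0 < h := lt_of_le_of_ne hh0 (Ne.symm hh1)
        have hz1 : 0 < ‖z‖ := hh2.trans_le hle
        calc ‖z‖ * h = h ^ (1-s) * (‖z‖ * h ^ s) := by
              have : h = h ^ (1-s) * h ^ s := by rw [← rpow_add hh2]; simp
              nth_rewrite 1 [this]; ring
          _ ≤ h ^ (1-s) * (‖z‖ * ‖z‖ ^ s) := by gcongr
          _ = _ := by rw [rpow_add hz1, rpow_one]
      calc _ ≤ _ := a2
        _ = 2 * Λ * (‖z‖ * h) := by ring
        _ ≤ 4 * Λ * (h ^ (1-s) * ‖z‖ ^ (1+s)) := by gcongr; norm_num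
        _ = _ := by ring
  have hρ1 : τ ^ (1-s) ≤ ρ ^ (1-s) := by
    apply rpow_le_rpow hτ0.le _ h1s.le
    rw [hτ]; linarith
  have hH0 : 0 ≤ h ^ (1-s) := rpow_nonneg hh0 _
  have N1 := sdN_int hn hs hs1 hτ0 huc (x := x) (sdb x hxτ)
  have N2 := sdN_int hn hs hs1 hτ0 huc (x := y) (sdb y hyτ)
  have F1 := sdK_int hn hs hτ0 huc hM x
  have F2 := sdK_int hn hs hτ0 huc hM y
  have near : |(∫ z, (sd u x z / ‖z‖ ^ ((n:ℝ) + 2*s) - sd u x z * Kt n s τ z)) -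
      ∫ z, (sd u y z / ‖z‖ ^ ((n:ℝ) + 2*s) - sd u y z * Kt n s τ z)| ≤ c2 * (Λ * ρ ^ (1-s) * h ^ (1-s)) := by
    rw [← integral_sub N1 N2, ← Real.norm_eq_abs]
    obtain ⟨r1, r2⟩ := rad_near hn (a := 1 - s) h1s hτ0
    have := norm_integral_le_of_norm_le (r1.const_mul (4 * Λ * h ^ (1-s)))
      (f := fun z => (sd u x z / ‖z‖ ^ ((n:ℝ) + 2*s) - sd u x z * Kt n s τ z) -
        (sd u y z / ‖z‖ ^ ((n:ℝ) + 2*s) - sd u y z * Kt n s τ z)) (Eventually.of_forall fun z => ?_)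
    · refine this.trans ?_
      rw [integral_const_mul, r2]
      calc 4 * Λ * h ^ (1-s) * (kn n / (1-s) * τ ^ (1-s)) ≤ 4 * Λ * h ^ (1-s) * (kn n / (1-s) * ρ ^ (1-s)) := by gcongr
        _ = _ := by rw [hc2]; ring
    · have e : (sd u x z / ‖z‖ ^ ((n:ℝ) + 2*s) - sd u x z * Kt n s τ z) -
        (sd u y z / ‖z‖ ^ ((n:ℝ) + 2*s) - sd u y z * Kt n s τ z) =
        (sd u x z - sd u y z) / ‖z‖ ^ ((n:ℝ) + 2*s) - (sd u x z - sd u y z) * Kt n s τ z := by ring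
      rw [e, Real.norm_eq_abs]
      have := near_bd hs hτ0 z (A := sd u x z - sd u y z) (fun h => by rw [h, sd_zero, sd_zero, sub_zero]) (sdd z)
      rwa [show 1 + s - 2*s = 1 - s by ring] at this
  have far := hfar τ hτ0 u huc M hM x y K d hK (by linarith) hz hxy
  rw [← hh] at far
  have hhρ : h ≤ ρ ^ s * h ^ (1-s) := by
    by_cases hh1 : h = 0
    · rw [hh1]; positivity
    have hh2 : 0 < h := lt_of_le_of_ne hh0 (Ne.symm hh1)
    calc h = h ^ s * h ^ (1-s) := by rw [← rpow_add hh2]; simp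
      _ ≤ _ := by gcongr; linarith
  have hdp : 0 < d := by linarith
  have ud : |u x - u y| ≤ (4 * K * d / ρ + 2 * Λ * ρ) * h := by
    have g := grad_le hΩ hu hρ hB hΛ (M := 2 * K * d) (fun w hw => by
      have := hz (w - x)
      rw [add_sub_cancel] at this
      rw [mem_closedBall, dist_eq_norm] at hw
      refine this.trans ?_
      nlinarith)
    have hyρ : y ∈ closedBall x ρ := closedBall_subset_closedBall (by linarith) hyτ
    have t := taylor1 hΩ hu (convex_closedBall x ρ) hB hΛ hxm hyρ
    have e : ‖y - x‖ = h := by rw [hh, norm_sub_rev]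
    have o := (fderiv ℝ u x).le_opNorm (y - x)
    rw [Real.norm_eq_abs] at o
    rw [e] at o t
    have o2 : ‖fderiv ℝ u x‖ * h ≤ (2 * (2 * K * d) / ρ + Λ * ρ) * h := by gcongr
    have o3 : Λ * h ^ 2 ≤ Λ * ρ * h := by
      have : h ≤ ρ := by linarith
      nlinarith [mul_nonneg hΛ0 hh0]
    have e2 : 2 * (2 * K * d) / ρ = 4 * K * d / ρ := by ring
    rw [e2] at o2
    rw [abs_le] at *
    constructor <;> linarith [t.1, t.2, o.1, o.2]
  have eτ1 : τ ^ (-(2*s)) = 4 ^ (2*s) * ρ ^ (-(2*s)) := by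
    rw [hτ, div_rpow hρ.le (by norm_num), rpow_neg (by norm_num : (0:ℝ) ≤ 4), div_inv_eq_mul, mul_comm]
  have eτ2 : τ ^ (-1 - 2*s) = 4 ^ (1+2*s) * ρ ^ (-1 - 2*s) := by
    rw [hτ, div_rpow hρ.le (by norm_num), show -1 - 2*s = -(1+2*s) by ring, rpow_neg (by norm_num : (0:ℝ) ≤ 4), div_inv_eq_mul, mul_comm]
  have r1 : ρ ^ (-1 - s) = ρ ^ (-1 - 2*s) * ρ ^ s := by rw [← rpow_add hρ]; congr 1; ring
  have r2 : ρ ^ (1 - s) = ρ ^ (-1 - 2*s) * ρ ^ s * ρ ^ 2 := by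
    rw [← rpow_two, ← rpow_add hρ, ← rpow_add hρ]; congr 1; ring
  have r3 : ρ ^ (-(2*s)) = ρ ^ (-1 - 2*s) * ρ := by
    nth_rewrite 3 [← rpow_one ρ]; rw [← rpow_add hρ]; congr 1; ring
  set P := ρ ^ (-1 - 2*s) with hP
  have hP0 : 0 < P := by positivity
  set Q := ρ ^ s with hQ
  have hQ0 : 0 < Q := by positivity
  set H := h ^ (1-s) with hH
  have far2 : |u x - u y| * τ ^ (-(2*s)) + K * d * τ ^ (-1 - 2*s) * h ≤
      (4 ^ (2*s) * 6 + 4 ^ (1 + 2*s)) * ((Λ * ρ ^ (1-s) + K * d * ρ ^ (-1 - s)) * H) := by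
    rw [eτ1, eτ2, r1, r2, r3]
    have f1 : |u x - u y| * (4 ^ (2*s) * (P * ρ)) ≤ ((4 * K * d / ρ + 2 * Λ * ρ) * (Q * H)) * (4 ^ (2*s) * (P * ρ)) := by
      gcongr
      exact ud.trans (by gcongr)
    have f2 : K * d * (4 ^ (1+2*s) * P) * h ≤ K * d * (4 ^ (1+2*s) * P) * (Q * H) := by gcongr
    have f3 : ((4 * K * d / ρ + 2 * Λ * ρ) * (Q * H)) * (4 ^ (2*s) * (P * ρ)) =
      4 ^ (2*s) * (4 * (K * d * (P * Q)) + 2 * (Λ * (P * Q * ρ^2))) * H := by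
      field_simp
    rw [f3] at f1
    have g1 : 0 ≤ 4 ^ (2*s) * (K * d * (P * Q)) * H := by positivity
    have g2 : 0 ≤ 4 ^ (2*s) * (Λ * (P * Q * ρ^2)) * H := by positivity
    have g3 : 0 ≤ 4 ^ (1+2*s) * (Λ * (P * Q * ρ^2)) * H := by positivity
    generalize (4:ℝ) ^ (2*s) = q1 at *
    generalize (4:ℝ) ^ (1+2*s) = q2 at *
    linarith
  rw [fracLap_eq, fracLap_eq, ← mul_sub, abs_mul, abs_of_pos (by positivity : 0 < cK n s / 2)]
  have s1 : ∀ w, Integrable (fun z => sd u w z / ‖z‖ ^ ((n:ℝ) + 2*s) - sd u w z * Kt n s τ z) →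
      Integrable (fun z => sd u w z * Kt n s τ z) → ∫ z, sd u w z / ‖z‖ ^ ((n:ℝ) + 2*s) =
      (∫ z, (sd u w z / ‖z‖ ^ ((n:ℝ) + 2*s) - sd u w z * Kt n s τ z)) + ∫ z, sd u w z * Kt n s τ z := by
    intro w i1 i2
    rw [← integral_add i1 i2]
    congr 1; ext z; ring
  rw [s1 x N1 F1, s1 y N2 F2]
  set a1 := ∫ z, (sd u x z / ‖z‖ ^ ((n:ℝ) + 2*s) - sd u x z * Kt n s τ z)
  set a2 := ∫ z, (sd u y z / ‖z‖ ^ ((n:ℝ) + 2*s) - sd u y z * Kt n s τ z)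
  set b1 := ∫ z, sd u x z * Kt n s τ z
  set b2 := ∫ z, sd u y z * Kt n s τ z
  have t1 : |a1 + b1 - (a2 + b2)| ≤ |a1 - a2| + |b1 - b2| := by
    rw [show a1 + b1 - (a2 + b2) = (a1 - a2) + (b1 - b2) by ring]
    exact abs_add_le _ _
  have t2 : |b1 - b2| ≤ C1 * ((4 ^ (2*s) * 6 + 4 ^ (1 + 2*s)) * ((Λ * ρ ^ (1-s) + K * d * ρ ^ (-1 - s)) * H)) :=
    far.trans (by gcongr)
  have t3 : 0 ≤ c2 * (K * d * ρ ^ (-1 - s) * H) := by positivity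
  rw [mul_assoc, mul_assoc]
  refine mul_le_mul_of_nonneg_left ?_ (by positivity)
  linarith

end

section

open MeasureTheory Real Set Metric Bornology Filter
open scoped RealInnerProductSpace ENNReal NNReal Pointwise

/-- A globally defined C² defining function of a bounded domain with uniform constants. -/
structure Geo (n : ℕ) (Ω : Set (En n)) where
  W : En n → ℝ
  smooth : ContDiff ℝ 2 W
  isOpen : IsOpen Ω
  pos_iff : ∀ x, x ∈ Ω ↔ 0 < W x
  front : ∀ x ∈ frontier Ω, W x = 0
  L : ℝ
  L1 : 1 ≤ L
  bd : ∀ x, |W x| ≤ L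
  gr : ∀ x, ‖fderiv ℝ W x‖ ≤ L
  he : ∀ x, ‖hess n W x‖ ≤ L
  R : ℝ
  R1 : 1 ≤ R
  sub : Ω ⊆ closedBall 0 R
  c : ℝ
  c0 : 0 < c
  κ : ℝ
  κ0 : 0 < κ
  nor : ∀ x ∈ closure Ω, W x < κ → ∃ e : En n, ‖e‖ = 1 ∧ c ≤ fderiv ℝ W x e
  ne : (frontier Ω).Nonempty
  Cd : ℝ
  Cd0 : 0 < Cd
  near : ∀ x ∈ Ω, ∃ z ∈ frontier Ω, ‖x - z‖ ≤ Cd * W x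

lemma exists_unit {n : ℕ} (hn : 1 ≤ n) (T : En n →L[ℝ] ℝ) : ∃ e : En n, ‖e‖ = 1 ∧ ‖T‖ = T e := by
  by_cases hT : T = 0
  · refine ⟨EuclideanSpace.single ⟨0, hn⟩ 1, by simp, by simp [hT]⟩
  · set G := (InnerProductSpace.toDual ℝ (En n)).symm T with hG
    have hGn : ‖G‖ = ‖T‖ := by simp [hG]
    have hTp : 0 < ‖T‖ := norm_pos_iff.2 hT
    have hGT : ∀ v, T v = ⟪G, v⟫ := fun v => by
      rw [hG, InnerProductSpace.toDual_symm_apply]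
    refine ⟨‖G‖⁻¹ • G, ?_, ?_⟩
    · rw [norm_smul, norm_inv, norm_norm, inv_mul_cancel₀ (by rw [hGn]; exact hTp.ne')]
    · rw [hGT, inner_smul_right, real_inner_self_eq_norm_sq, hGn]
      field_simp

lemma geo_exists {n : ℕ} (hn : 1 ≤ n) (D : C2Domain n) : Nonempty (Geo n D.carrier) := by
  have : Nonempty (Fin n) := ⟨⟨0, hn⟩⟩
  set Ω := D.carrier with hΩ
  have hmem : ∀ x, x ∈ Ω ↔ D.phi x < 0 := fun x => by rw [hΩ, D.carrier_eq]; rfl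
  have hopen : IsOpen Ω := by
    rw [hΩ, D.carrier_eq]; exact isOpen_lt D.phi_smooth.continuous continuous_const
  obtain ⟨R0, hR0⟩ := D.bounded.subset_closedBall 0
  set R := max R0 1 with hR
  have hR1 : 1 ≤ R := le_max_right _ _
  have hsub : Ω ⊆ closedBall 0 R := hR0.trans (closedBall_subset_closedBall (le_max_left _ _))
  have hclsub : closure Ω ⊆ closedBall 0 R := closure_minimal hsub isClosed_closedBall
  let f : ContDiffBump (0 : En n) := ⟨R + 1, R + 2, by linarith, by linarith⟩
  set W : En n → ℝ := fun x => f x * (- D.phi x) with hW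
  have hsm : ContDiff ℝ 2 W := f.contDiff.mul D.phi_smooth.neg
  have hcs : HasCompactSupport W := f.hasCompactSupport.mul_right
  have hloc : ∀ x ∈ closure Ω, W =ᶠ[nhds x] fun y => - D.phi y := by
    intro x hx
    have : ball (0 : En n) (R+1) ∈ nhds x := by
      apply isOpen_ball.mem_nhds
      have := hclsub hx
      rw [mem_closedBall] at this; rw [mem_ball]; linarith
    filter_upwards [this] with y hy
    rw [hW]
    simp only
    rw [f.one_of_mem_closedBall (ball_subset_closedBall hy), one_mul]
  have hpos : ∀ x, x ∈ Ω ↔ 0 < W x := by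
    intro x
    constructor
    · intro hx
      rw [(hloc x (subset_closure hx)).eq_of_nhds]
      have := (hmem x).1 hx
      linarith
    · intro hx
      rw [hmem]
      by_contra h
      push Not at h
      have : W x ≤ 0 := mul_nonpos_of_nonneg_of_nonpos f.nonneg (by linarith)
      linarith
  have hfd : Continuous (fderiv ℝ W) := hsm.continuous_fderiv (by simp)
  have hcont : Continuous (fun x => hess n W x) := by
    unfold hess
    exact (hsm.fderiv_right (m := 1) (by norm_num)).continuous_fderiv (by simp)
  obtain ⟨L1, hL1⟩ := hsm.continuous.bounded_above_of_compact_support hcs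
  obtain ⟨L2, hL2⟩ := hfd.bounded_above_of_compact_support (hcs.fderiv (𝕜 := ℝ))
  have hcs2 : HasCompactSupport (fderiv ℝ (fderiv ℝ W)) := (hcs.fderiv (𝕜 := ℝ)).fderiv (𝕜 := ℝ)
  obtain ⟨L3, hL3⟩ : ∃ C, ∀ x, ‖hess n W x‖ ≤ C :=
    Continuous.bounded_above_of_compact_support (E := En n →L[ℝ] En n →L[ℝ] ℝ) hcont hcs2
  set L := max (max L1 L2) (max L3 1) with hL
  have l1 : L1 ≤ L := (le_max_left _ _).trans (le_max_left _ _)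
  have l2 : L2 ≤ L := (le_max_right _ _).trans (le_max_left _ _)
  have l3 : L3 ≤ L := (le_max_left _ _).trans (le_max_right _ _)
  have l4 : 1 ≤ L := (le_max_right _ _).trans (le_max_right _ _)
  have hLp : 0 < L := by linarith
  have hcl : IsCompact (closure Ω) := D.bounded.isCompact_closure
  have hfr : IsCompact (frontier Ω) := hcl.of_isClosed_subset isClosed_frontier frontier_subset_closure
  have hfront : ∀ x ∈ frontier Ω, W x = 0 := by
    intro x hx
    have h1 : ¬ 0 < W x := by
      rw [← hpos, hopen.frontier_eq] at *
      exact hx.2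
    have h2 : 0 ≤ W x := by
      have : closure Ω ⊆ {x | 0 ≤ W x} :=
        closure_minimal (fun y hy => ((hpos y).1 hy).le) (isClosed_le continuous_const hsm.continuous)
      exact this (frontier_subset_closure hx)
    linarith
  have hgr : ∀ x ∈ frontier Ω, 0 < ‖fderiv ℝ W x‖ := by
    intro x hx
    rw [norm_pos_iff, (hloc x (frontier_subset_closure hx)).fderiv_eq]
    intro h
    apply D.grad_ne x hx
    have h2 : fderiv ℝ D.phi x = 0 := by
      have := fderiv_fun_neg (𝕜 := ℝ) (f := D.phi) (x := x)
      rw [this] at h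
      exact neg_eq_zero.1 h
    unfold gradient
    rw [h2]; simp
  have hOne : Ω.Nonempty := D.connected.nonempty
  have hne : (frontier Ω).Nonempty := by
    rw [nonempty_frontier_iff]
    refine ⟨hOne, fun h => ?_⟩
    have := D.bounded
    rw [← hΩ, h] at this
    exact NormedSpace.unbounded_univ ℝ (En n) this
  obtain ⟨x0, hx0, hmin⟩ := hfr.exists_isMinOn hne hfd.norm.continuousOn
  set c := ‖fderiv ℝ W x0‖ / 2 with hc
  have hc0 : 0 < c := by have := hgr x0 hx0; positivity
  have hZ : ∃ κ > 0, ∀ x ∈ closure Ω, W x < κ → c ≤ ‖fderiv ℝ W x‖ := by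
    set Z := closure Ω ∩ {x | ‖fderiv ℝ W x‖ ≤ c} with hZ
    have hZc : IsCompact Z := hcl.inter_right (isClosed_le hfd.norm continuous_const)
    by_cases hZe : Z.Nonempty
    · obtain ⟨z, hz, hzm⟩ := hZc.exists_isMinOn hZe hsm.continuous.continuousOn
      refine ⟨W z, ?_, ?_⟩
      · rw [gt_iff_lt, ← hpos]
        by_contra h
        have hzf : z ∈ frontier Ω := by rw [hopen.frontier_eq]; exact ⟨hz.1, h⟩
        have h1 : ‖fderiv ℝ W x0‖ ≤ ‖fderiv ℝ W z‖ := hmin hzf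
        have h2 : ‖fderiv ℝ W z‖ ≤ c := hz.2
        linarith
      · intro x hx hxz
        by_contra h
        push Not at h
        have : W z ≤ W x := hzm (⟨hx, h.le⟩ : x ∈ Z)
        linarith
    · refine ⟨1, one_pos, fun x hx _ => ?_⟩
      by_contra h
      push Not at h
      exact hZe ⟨x, hx, h.le⟩
  obtain ⟨κ, hκ, hκc⟩ := hZ
  have hnor : ∀ x ∈ closure Ω, W x < κ → ∃ e : En n, ‖e‖ = 1 ∧ c ≤ fderiv ℝ W x e := by
    intro x hx hxk
    obtain ⟨e, he, h⟩ := exists_unit hn (fderiv ℝ W x)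
    exact ⟨e, he, h ▸ hκc x hx hxk⟩
  set κ2 := min κ (c^2 / (4 * L)) with hκ2
  have hκ20 : 0 < κ2 := by positivity
  set Cd := max (2 / c) (2 * R / κ2) with hCd
  have hCd0 : 0 < Cd := lt_of_lt_of_le (by positivity) (le_max_left _ _)
  have hnear : ∀ x ∈ Ω, ∃ z ∈ frontier Ω, ‖x - z‖ ≤ Cd * W x := by
    intro x hx
    have hWx := (hpos x).1 hx
    by_cases h : W x < κ2
    · obtain ⟨e, he, hce⟩ := hnor x (subset_closure hx) (h.trans_le (min_le_left _ _))
      set t := 2 * W x / c with ht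
      have ht0 : 0 < t := by positivity
      have tay := taylor1 isOpen_univ hsm.contDiffOn convex_univ (subset_univ _) (fun y _ => (hL3 y).trans l3)
        (mem_univ x) (mem_univ (x - t • e))
      rw [sub_sub_cancel_left, norm_neg, map_neg, norm_smul, he, mul_one, Real.norm_of_nonneg ht0.le,
        map_smul, smul_eq_mul] at tay
      have ht2 : t ≤ c / (2 * L) := by
        have : W x < c^2/(4*L) := h.trans_le (min_le_right _ _)
        rw [ht, div_le_iff₀ hc0]
        calc 2 * W x ≤ 2 * (c^2/(4*L)) := by linarith
          _ = _ := by field_simp; ring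
      have hout : x - t • e ∉ Ω := by
        rw [hpos, not_lt]
        have h1 : L * t ^ 2 ≤ t * c / 2 := by
          have : L * t ≤ c / 2 := by
            calc L * t ≤ L * (c / (2*L)) := by gcongr
              _ = c / 2 := by field_simp
          nlinarith
        have h2 : t * c = 2 * W x := by rw [ht]; field_simp
        have h3 : t * c ≤ t * fderiv ℝ W x e := by gcongr
        have := (abs_le.1 tay).2
        linarith
      have hnu : Ω ≠ univ := fun h => hout (h ▸ mem_univ _)
      obtain ⟨z, hz, hzd⟩ := exists_mem_frontier_infDist_compl_eq_dist hx hnu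
      refine ⟨z, hz, ?_⟩
      rw [← dist_eq_norm, ← hzd]
      refine (infDist_le_dist_of_mem (show x - t • e ∈ Ωᶜ from hout)).trans ?_
      rw [dist_eq_norm, sub_sub_cancel, norm_smul, he, mul_one, Real.norm_of_nonneg ht0.le, ht]
      calc 2 * W x / c = 2 / c * W x := by ring
        _ ≤ _ := by gcongr; exact le_max_left _ _
    · push Not at h
      obtain ⟨z, hz⟩ := hne
      refine ⟨z, hz, ?_⟩
      have h1 := hsub hx
      have h2 := hclsub (frontier_subset_closure hz)
      rw [mem_closedBall, dist_zero_right] at h1 h2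
      calc ‖x - z‖ ≤ 2 * R := by linarith [norm_sub_le x z]
        _ = 2 * R / κ2 * κ2 := by field_simp
        _ ≤ _ := by gcongr; exact le_max_right _ _
  exact ⟨{ W := W, smooth := hsm, isOpen := hopen, pos_iff := hpos, front := hfront, L := L, L1 := l4,
           bd := fun x => (hL1 x).trans l1, gr := fun x => (hL2 x).trans l2, he := fun x => (hL3 x).trans l3,
           R := R, R1 := hR1, sub := hsub, c := c, c0 := hc0, κ := κ, κ0 := hκ, nor := hnor, ne := hne,
           Cd := Cd, Cd0 := hCd0, near := hnear }⟩

namespace Geo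
variable {n : ℕ} {Ω : Set (En n)} (G : Geo n Ω)

lemma L0 : 0 < G.L := by linarith [G.L1]

lemma lip (x y : En n) : |G.W y - G.W x| ≤ G.L * ‖y - x‖ :=
  convex_univ.norm_image_sub_le_of_norm_fderiv_le (𝕜 := ℝ) (f := G.W)
    (fun z _ => G.smooth.contDiffAt.differentiableAt (by simp)) (fun z _ => G.gr z) (mem_univ x) (mem_univ y)

lemma tay (x y : En n) : |G.W y - G.W x - fderiv ℝ G.W x (y - x)| ≤ G.L * ‖y - x‖ ^ 2 :=
  taylor1 isOpen_univ G.smooth.contDiffOn convex_univ (subset_univ _) (fun y _ => G.he y)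
        (mem_univ x) (mem_univ y)

def P (x : En n) : ℝ := max (G.W x) 0

lemma P_nonneg (x : En n) : 0 ≤ G.P x := le_max_right _ _

lemma P_eq {x : En n} (hx : x ∈ Ω) : G.P x = G.W x := max_eq_left ((G.pos_iff x).1 hx).le

lemma P_out {x : En n} (hx : x ∉ Ω) : G.P x = 0 := by
  rw [G.pos_iff, not_lt] at hx
  exact max_eq_right hx

lemma P_le (x : En n) : G.P x ≤ G.L := max_le ((le_abs_self _).trans (G.bd x)) G.L0.le

lemma P_cont : Continuous G.P := G.smooth.continuous.max continuous_const

lemma P_lip (x y : En n) : |G.P y - G.P x| ≤ G.L * ‖y - x‖ :=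
  (abs_max_sub_max_le_abs _ _ _).trans (G.lip x y)

lemma W_le {x : En n} (_hx : x ∈ Ω) : G.W x ≤ G.L * infDist x (frontier Ω) := by
  rw [mul_comm, ← div_le_iff₀ G.L0]
  rw [le_infDist G.ne]
  intro z hz
  rw [div_le_iff₀ G.L0, dist_eq_norm]
  have := G.lip z x
  rw [G.front z hz, sub_zero] at this
  linarith [le_abs_self (G.W x)]

lemma dist_le {x : En n} (hx : x ∈ Ω) : infDist x (frontier Ω) ≤ G.Cd * G.W x := by
  obtain ⟨z, hz, h⟩ := G.near x hx
  refine (infDist_le_dist_of_mem hz).trans ?_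
  rwa [dist_eq_norm]

lemma half {x y : En n} (hx : x ∈ Ω) (h : ‖y - x‖ ≤ G.W x / (2 * G.L)) :
    y ∈ Ω ∧ G.W x / 2 ≤ G.W y ∧ G.W y ≤ 2 * G.W x := by
  have hW := (G.pos_iff x).1 hx
  have h1 : G.L * ‖y - x‖ ≤ G.W x / 2 := by
    have h0 := G.L0
    calc G.L * ‖y - x‖ ≤ G.L * (G.W x / (2 * G.L)) := by gcongr
      _ = G.W x / 2 := by field_simp
  have h2 := abs_le.1 ((G.lip x y).trans h1)
  rw [G.pos_iff]
  refine ⟨by linarith [h2.1], by linarith [h2.1], by linarith [h2.2]⟩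

end Geo

end

section

open MeasureTheory Real Set Metric Bornology Filter
open scoped RealInnerProductSpace ENNReal NNReal Pointwise

variable {n : ℕ}

lemma hess_max {f : En n → ℝ} {x : En n} (hf : ContDiffAt ℝ 2 f x) (hm : IsLocalMax f x) (e : En n) :
    hess n f x e e ≤ 0 := by
  by_contra hcon
  push Not at hcon
  set φ : ℝ → ℝ := fun t => f (x + t • e) with hφ
  have hl : ∀ t : ℝ, HasDerivAt (fun t : ℝ => x + t • e) e t := fun t => by
    simpa using ((hasDerivAt_id t).smul_const e).const_add x
  have hc0 : Tendsto (fun t : ℝ => x + t • e) (nhds 0) (nhds x) := by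
    have := (hl 0).continuousAt.tendsto
    simpa using this
  have h1 : ∀ᶠ t in nhds (0:ℝ), deriv φ t = fderiv ℝ f (x + t • e) e := by
    filter_upwards [hc0.eventually (ev_diff hf)] with t ht
    exact (ht.hasFDerivAt.comp_hasDerivAt t (hl t)).deriv
  have h2 : HasDerivAt (deriv φ) (hess n f x e e) 0 := by
    have hd : HasFDerivAt (fderiv ℝ f) (hess n f x) (x + (0:ℝ) • e) := by
      rw [zero_smul, add_zero]; exact (fderiv_diff hf).hasFDerivAt
    have h3 : HasDerivAt (fun t : ℝ => fderiv ℝ f (x + t • e)) (hess n f x e) 0 :=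
      hd.comp_hasDerivAt (0:ℝ) (hl 0)
    have h4 : HasDerivAt (fun t : ℝ => fderiv ℝ f (x + t • e) e) (hess n f x e e) 0 := by
      have := h3.clm_apply (hasDerivAt_const (0:ℝ) e)
      simpa using this
    exact h4.congr_of_eventuallyEq h1
  have hmax : IsLocalMax φ 0 := by
    have : ∀ᶠ t in nhds (0:ℝ), f (x + t • e) ≤ f x := hc0.eventually hm
    filter_upwards [this] with t ht
    simpa [hφ] using ht
  have hfx : DifferentiableAt ℝ f (x + (0:ℝ) • e) := by
    rw [zero_smul, add_zero]; exact hf.differentiableAt (by simp)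
  have hcont : ContinuousAt φ 0 :=
    (hfx.hasFDerivAt.comp_hasDerivAt (0:ℝ) (hl 0)).continuousAt
  have hmin := isLocalMin_of_deriv_deriv_pos (f := φ) (x₀ := 0) (by rw [h2.deriv]; exact hcon)
    hmax.deriv_eq_zero hcont
  have hconst : φ =ᶠ[nhds 0] fun _ => φ 0 := by
    filter_upwards [hmax, hmin] with t h1 h2
    exact le_antisymm h1 h2
  have h5 : deriv φ =ᶠ[nhds 0] fun _ => (0:ℝ) := by
    have := hconst.deriv
    simpa using this
  have h6 : deriv (deriv φ) 0 = 0 := by rw [h5.deriv_eq]; simp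
  rw [h2.deriv] at h6
  linarith

lemma lap_max {f : En n → ℝ} {x : En n} (hf : ContDiffAt ℝ 2 f x) (hm : IsLocalMax f x) :
    lap n f x ≤ 0 := by
  rw [lap_eq_hess hf]
  exact Finset.sum_nonpos fun i _ => hess_max hf hm _

lemma lap_max_le {u ψ : En n → ℝ} {x : En n} (hu : ContDiffAt ℝ 2 u x) (hψ : ContDiffAt ℝ 2 ψ x)
    (hm : IsLocalMax (fun y => u y - ψ y) x) : lap n u x ≤ lap n ψ x := by
  have := lap_max (hu.sub hψ) hm
  rw [lap_sub hu hψ] at this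
  linarith

lemma lap_comp {W : En n → ℝ} {x : En n} (hW : ContDiffAt ℝ 2 W x) {f f1 : ℝ → ℝ} {f2 : ℝ}
    (h1 : ∀ᶠ t in nhds (W x), HasDerivAt f (f1 t) t) (h2 : HasDerivAt f1 f2 (W x)) :
    lap n (fun y => f (W y)) x =
      f2 * ∑ i, (fderiv ℝ W x (bv n i)) ^ 2 + f1 (W x) * lap n W x := by
  unfold lap
  rw [Finset.mul_sum, Finset.mul_sum, ← Finset.sum_add_distrib]
  refine Finset.sum_congr rfl fun i _ => ?_
  have hc : ContinuousAt W x := hW.continuousAt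
  have e1 : (fun y => fderiv ℝ (fun y => f (W y)) y (bv n i)) =ᶠ[nhds x]
      fun y => f1 (W y) * fderiv ℝ W y (bv n i) := by
    filter_upwards [ev_diff hW, hc.eventually h1] with y hy hy1
    have := hy1.comp_hasFDerivAt y hy.hasFDerivAt
    have h3 : fderiv ℝ (fun y => f (W y)) y = f1 (W y) • fderiv ℝ W y := this.fderiv
    rw [h3]; simp
  have e2 : fderiv ℝ (fun y => fderiv ℝ (fun y => f (W y)) y (bv n i)) x (bv n i)
    = fderiv ℝ (fun y => f1 (W y) * fderiv ℝ W y (bv n i)) x (bv n i) := by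
    rw [e1.fderiv_eq]
  refine e2.trans ?_
  have d1 : HasFDerivAt (fun y => f1 (W y)) (f2 • fderiv ℝ W x) x :=
    h2.comp_hasFDerivAt x (hW.differentiableAt (by simp)).hasFDerivAt
  have d2 : DifferentiableAt ℝ (fun y => fderiv ℝ W y (bv n i)) x :=
    (fderiv_diff hW).clm_apply (differentiableAt_const _)
  have d3 : HasFDerivAt (fun y => f1 (W y) * fderiv ℝ W y (bv n i)) _ x := d1.mul d2.hasFDerivAt
  rw [d3.fderiv]
  simp only [ContinuousLinearMap.add_apply, ContinuousLinearMap.smul_apply, smul_eq_mul]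
  unfold bv
  ring

lemma grad_sq_ge (T : En n →L[ℝ] ℝ) {e : En n} (he : ‖e‖ = 1) {c : ℝ} (hc : 0 ≤ c) (h : c ≤ T e) :
    c ^ 2 ≤ ∑ i, (T (bv n i)) ^ 2 := by
  have e1 : T e = ∑ i, e i * T (bv n i) := by
    conv_lhs => rw [← sum_bv e]
    rw [map_sum]; simp
  have e2 : ∑ i, (e i)^2 = 1 := by
    rw [← EuclideanSpace.real_norm_sq_eq, he]; norm_num
  have := Finset.sum_mul_sq_le_sq_mul_sq Finset.univ (fun i => e i) (fun i => T (bv n i))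
  rw [e2, one_mul, ← e1] at this
  nlinarith

lemma grad_sq_le (T : En n →L[ℝ] ℝ) {L : ℝ} (h : ‖T‖ ≤ L) : ∑ i, (T (bv n i)) ^ 2 ≤ n * L ^ 2 := by
  have : ∀ i ∈ (Finset.univ : Finset (Fin n)), (T (bv n i)) ^ 2 ≤ L ^ 2 := by
    intro i _
    have h1 := T.le_opNorm (bv n i)
    have h2 : ‖bv n i‖ = 1 := by simp [bv]
    rw [h2, mul_one, Real.norm_eq_abs] at h1
    exact sq_le_sq' (by linarith [(abs_le.1 (h1.trans h)).1]) (abs_le.1 (h1.trans h)).2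
  simpa using Finset.sum_le_card_nsmul _ _ _ this

lemma lap_abs_le {u : En n → ℝ} {x : En n} (hu : ContDiffAt ℝ 2 u x) {L : ℝ} (h : ‖hess n u x‖ ≤ L) :
    |lap n u x| ≤ n * L := by
  rw [lap_eq_hess hu]
  refine (Finset.abs_sum_le_sum_abs _ _).trans ?_
  have : ∀ i ∈ (Finset.univ : Finset (Fin n)), |hess n u x (bv n i) (bv n i)| ≤ L := by
    intro i _
    have h1 := (hess n u x).le_opNorm₂ (bv n i) (bv n i)
    have h2 : ‖bv n i‖ = 1 := by simp [bv]
    rw [h2, mul_one, mul_one, Real.norm_eq_abs] at h1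
    exact h1.trans h
  simpa using Finset.sum_le_card_nsmul _ _ _ this

lemma rpow_tangent {q t0 t : ℝ} (hq : 1 ≤ q) (h0 : 0 < t0) (ht : 0 ≤ t) :
    t0 ^ q + q * t0 ^ (q - 1) * (t - t0) ≤ t ^ q := by
  have h := one_add_mul_self_le_rpow_one_add (s := t / t0 - 1) (by
    have : 0 ≤ t / t0 := by positivity
    linarith) hq
  rw [add_sub_cancel, div_rpow ht h0.le, le_div_iff₀ (by positivity)] at h
  have e : t0 ^ (q - 1) = t0 ^ q / t0 := rpow_sub_one h0.ne' q
  rw [e]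
  calc _ = (1 + q * (t/t0 - 1)) * t0 ^ q := by field_simp
    _ ≤ _ := h

lemma max_exists {Ω : Set (En n)} (G : Geo n Ω) {u ψ : En n → ℝ} (hu : Continuous u) (hψ : Continuous ψ)
    (h0 : ∀ x ∉ Ω, u x ≤ ψ x) {x : En n} (hx : ψ x < u x) :
    ∃ x0 ∈ Ω, ψ x0 < u x0 ∧ ∀ y, u y - ψ y ≤ u x0 - ψ x0 := by
  have hxΩ : x ∈ Ω := by
    by_contra h
    linarith [h0 x h]
  have hc : IsCompact (closedBall (0 : En n) G.R) := isCompact_closedBall _ _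
  obtain ⟨x0, hx0, hm⟩ := hc.exists_isMaxOn ⟨x, G.sub hxΩ⟩ (hu.sub hψ).continuousOn
  have h1 : u x - ψ x ≤ u x0 - ψ x0 := hm (G.sub hxΩ)
  have h2 : ψ x0 < u x0 := by linarith
  refine ⟨x0, ?_, h2, ?_⟩
  · by_contra h
    linarith [h0 x0 h]
  · intro y
    by_cases hy : y ∈ Ω
    · exact hm (G.sub hy)
    · linarith [h0 y hy]

lemma frac_lower (hn : 1 ≤ n) {s : ℝ} (hs : 0 < s) (hs1 : s < 1) {u : En n → ℝ} {x : En n} {m : En n → ℝ}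
    (hm : Integrable m) (hm0 : ∀ z, 0 ≤ m z) (h : ∀ z, -m z ≤ sd u x z / ‖z‖ ^ ((n:ℝ) + 2*s)) :
    -((cK n s / 2) * ∫ z, m z) ≤ fracLap n s u x := by
  rw [fracLap_eq, ← mul_neg]
  have := cK_pos hn hs hs1
  refine mul_le_mul_of_nonneg_left ?_ (by positivity)
  by_cases hi : Integrable fun z => sd u x z / ‖z‖ ^ ((n:ℝ) + 2*s)
  · rw [← integral_neg]
    exact integral_mono hm.neg hi h
  · rw [integral_undef hi]
    have h0 : 0 ≤ ∫ z, m z := integral_nonneg hm0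
    linarith

end

section

open MeasureTheory Real Set Metric Bornology Filter
open scoped RealInnerProductSpace ENNReal NNReal Pointwise

variable {n : ℕ}

lemma rad_of_mem {T : Set ℝ} {s a : ℝ} {z : En n} (h : ‖z‖ ∈ T) (hz : 0 < ‖z‖) :
    rad n T (a - 2*s) z = ‖z‖ ^ a / ‖z‖ ^ ((n:ℝ) + 2*s) := by
  rw [rad, indicator_of_mem h, ← rpow_sub hz]
  congr 1; ring

lemma rad_not_mem {T : Set ℝ} {q : ℝ} {z : En n} (h : ‖z‖ ∉ T) : rad n T q z = 0 := by
  rw [rad, indicator_of_notMem h]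

lemma split_lower {s τ a b B D A : ℝ} (hτ : 0 < τ) (z : En n) (h0 : z = 0 → A = 0)
    (hB : 0 ≤ B) (hD : 0 ≤ D)
    (h1 : ‖z‖ < τ → -(B * ‖z‖ ^ a) ≤ A) (h2 : τ ≤ ‖z‖ → -(D * ‖z‖ ^ b) ≤ A) :
    -(B * rad n (Ioo 0 τ) (a - 2*s) z + D * rad n (Ici τ) (b - 2*s) z) ≤ A / ‖z‖ ^ ((n:ℝ) + 2*s) := by
  by_cases hz : z = 0
  · rw [h0 hz, zero_div]
    have := mul_nonneg hB (rad_nonneg (n := n) (T := Ioo 0 τ) (q := a - 2*s) z)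
    have := mul_nonneg hD (rad_nonneg (n := n) (T := Ici τ) (q := b - 2*s) z)
    linarith
  have hz0 : 0 < ‖z‖ := norm_pos_iff.2 hz
  have hp : 0 < ‖z‖ ^ ((n:ℝ) + 2*s) := rpow_pos_of_pos hz0 _
  rcases lt_or_ge ‖z‖ τ with h | h
  · rw [rad_of_mem (T := Ioo 0 τ) ⟨hz0, h⟩ hz0, rad_not_mem (T := Ici τ) (by simpa using h)]
    rw [mul_zero, add_zero, ← mul_div_assoc, ← neg_div]
    exact (div_le_div_iff_of_pos_right hp).2 (h1 h)
  · rw [rad_of_mem (T := Ici τ) h hz0, rad_not_mem (T := Ioo 0 τ) (by simp [hz0, h])]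
    rw [mul_zero, zero_add, ← mul_div_assoc, ← neg_div]
    exact (div_le_div_iff_of_pos_right hp).2 (h2 h)

structure Sol (n : ℕ) (s a : ℝ) (Ω : Set (En n)) (g u : En n → ℝ) : Prop where
  gb : ∀ x ∈ Ω, |g x| ≤ 1
  gl : ∀ x ∈ Ω, ∀ y ∈ Ω, |g x - g y| ≤ ‖x - y‖
  cd : ContDiffOn ℝ 2 u Ω
  ct : Continuous u
  eq : ∀ x ∈ Ω, lap n u x = a * fracLap n s u x - g x
  out : ∀ x ∉ Ω, u x = 0

lemma lap_neg' (u : En n → ℝ) (x : En n) : lap n (fun y => -u y) x = -lap n u x := by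
  unfold lap
  rw [← Finset.sum_neg_distrib]
  refine Finset.sum_congr rfl fun i _ => ?_
  have : (fun y => fderiv ℝ (fun y => -u y) y (EuclideanSpace.single i (1:ℝ)))
    = fun y => -(fderiv ℝ u y (EuclideanSpace.single i (1:ℝ))) := by
    funext y
    rw [fderiv_fun_neg]; rfl
  rw [this, fderiv_fun_neg]; rfl

lemma frac_neg (s : ℝ) (u : En n → ℝ) (x : En n) : fracLap n s (fun y => -u y) x = -fracLap n s u x := by
  rw [fracLap_eq, fracLap_eq, ← mul_neg, ← integral_neg]
  congr 1
  refine integral_congr_ae (Eventually.of_forall fun z => ?_)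
  simp only [sd]
  ring

lemma Sol.neg {s a : ℝ} {Ω : Set (En n)} {g u : En n → ℝ} (S : Sol n s a Ω g u) :
    Sol n s a Ω (fun y => -g y) (fun y => -u y) where
  gb x hx := by rw [abs_neg]; exact S.gb x hx
  gl x hx y hy := by
    have := S.gl x hx y hy
    rw [← abs_neg] at this
    convert this using 2; ring
  cd := S.cd.neg
  ct := S.ct.neg
  eq x hx := by rw [lap_neg', frac_neg, S.eq x hx]; ring
  out x hx := by rw [S.out x hx, neg_zero]

lemma cmpSol (hn : 1 ≤ n) {s a : ℝ} (hs : 0 < s) (hs1 : s < 1) (ha : 0 ≤ a) {Ω : Set (En n)} (hΩ : IsOpen Ω)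
    {g u ψ : En n → ℝ} (S : Sol n s a Ω g u) {x0 : En n} (hx0 : x0 ∈ Ω)
    (hm : ∀ y, u y - ψ y ≤ u x0 - ψ x0) (hψ : ContDiffAt ℝ 2 ψ x0) {m : En n → ℝ}
    (hmi : Integrable m) (hm0 : ∀ z, 0 ≤ m z) (h : ∀ z, -m z ≤ sd ψ x0 z / ‖z‖ ^ ((n:ℝ) + 2*s)) :
    -(a * ((cK n s / 2) * ∫ z, m z)) - 1 ≤ lap n ψ x0 := by
  have h1 := lap_max_le (S.cd.contDiffAt (hΩ.mem_nhds hx0)) hψ (Eventually.of_forall hm)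
  have h2 := frac_lower hn hs hs1 (u := u) (x := x0) hmi hm0 (by
    intro z
    refine (h z).trans ?_
    gcongr
    simp only [sd]
    linarith [hm (x0 + z), hm (x0 - z)])
  rw [S.eq x0 hx0] at h1
  have h3 := mul_le_mul_of_nonneg_left h2 ha
  have h4 := (abs_le.1 (S.gb x0 hx0)).2
  linarith

lemma fderiv_normsq (p x e : En n) : fderiv ℝ (fun y : En n => ‖y - p‖ ^ 2) x e = 2 * inner ℝ (x - p) e := by
  have : HasFDerivAt (fun y : En n => ‖y - p‖ ^ 2) _ x := ((hasFDerivAt_id x).sub_const p).norm_sq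
  rw [this.fderiv]
  simp [inner_sub_left]

lemma lap_normsq (p x : En n) : lap n (fun y => ‖y - p‖ ^ 2) x = 2 * n := by
  unfold lap
  have : ∀ i ∈ (Finset.univ : Finset (Fin n)), fderiv ℝ (fun y => fderiv ℝ (fun y : En n => ‖y - p‖ ^ 2) y
      (EuclideanSpace.single i (1:ℝ))) x (EuclideanSpace.single i (1:ℝ)) = 2 := by
    intro i _
    have e1 : (fun y => fderiv ℝ (fun y : En n => ‖y - p‖ ^ 2) y (EuclideanSpace.single i (1:ℝ)))
       = fun y => 2 * (y i - p i) := by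
      funext y
      rw [fderiv_normsq, EuclideanSpace.inner_single_right]; simp
    rw [e1]
    have h1 : HasFDerivAt (fun y : En n => y i) (EuclideanSpace.proj i : En n →L[ℝ] ℝ) x :=
      (EuclideanSpace.proj i : En n →L[ℝ] ℝ).hasFDerivAt
    rw [((h1.sub_const (p i)).const_mul 2).fderiv]
    simp
  rw [Finset.sum_congr rfl this]
  simp; ring

lemma normsq_cd (p x : En n) : ContDiffAt ℝ 2 (fun y : En n => ‖y - p‖ ^ 2) x :=
  (contDiff_id.sub contDiff_const).norm_sq ℝ |>.contDiffAt

lemma sup_upper (hn : 1 ≤ n) {s a : ℝ} (hs : 0 < s) (hs1 : s < 1) (ha : 0 ≤ a) {Ω : Set (En n)} (G : Geo n Ω)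
    {g u : En n → ℝ} (S : Sol n s a Ω g u) (x : En n) : u x ≤ 4 * G.R ^ 2 := by
  set ψ : En n → ℝ := fun y => max (4 * G.R ^ 2 - ‖y - 0‖ ^ 2) 0 with hψd
  have hψc : Continuous ψ := by fun_prop
  have hR := G.R1
  by_contra hcon
  push Not at hcon
  have hψle : ∀ y, ψ y ≤ 4 * G.R ^ 2 := fun y => max_le (by nlinarith [sq_nonneg ‖y - 0‖]) (by positivity)
  obtain ⟨x0, hx0, h1, h2⟩ := max_exists G S.ct hψc (fun y hy => by
    rw [S.out y hy]; exact le_max_right _ _) (lt_of_le_of_lt (hψle x) hcon)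
  have hx0R : ‖x0‖ ≤ G.R := by simpa using G.sub hx0
  have hsq : ‖x0‖ ^ 2 ≤ G.R ^ 2 := by gcongr
  have hev : ψ =ᶠ[nhds x0] fun y => 4 * G.R ^ 2 - ‖y - 0‖ ^ 2 := by
    have : ∀ᶠ y in nhds x0, 0 < 4 * G.R ^ 2 - ‖y - 0‖ ^ 2 := by
      refine ContinuousAt.eventually_lt (by fun_prop) (by fun_prop) ?_
      simp only [sub_zero]
      nlinarith
    filter_upwards [this] with y hy
    exact max_eq_left hy.le
  have hcd : ContDiffAt ℝ 2 (fun y : En n => 4 * G.R ^ 2 - ‖y - 0‖ ^ 2) x0 :=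
    contDiffAt_const.sub (normsq_cd 0 x0)
  have hψx : ψ x0 = 4 * G.R ^ 2 - ‖x0‖ ^ 2 := by rw [hev.eq_of_nhds, sub_zero]
  have h3 := cmpSol hn hs hs1 ha G.isOpen S hx0 h2 (hcd.congr_of_eventuallyEq hev) (m := fun _ => 0)
    (integrable_zero _ _ _) (fun _ => le_rfl) (by
      intro z
      rw [neg_zero]
      refine div_nonneg ?_ (by positivity)
      have e1 : ψ (x0 + z) = max (4 * G.R ^ 2 - ‖x0 + z‖ ^ 2) 0 := by simp [hψd]
      have e2 : ψ (x0 - z) = max (4 * G.R ^ 2 - ‖x0 - z‖ ^ 2) 0 := by simp [hψd]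
      have e3 := parallelogram_law_with_norm ℝ x0 z
      simp only [sd]
      rw [hψx, e1, e2]
      have := sq_nonneg ‖x0 + z‖
      have := sq_nonneg ‖x0 - z‖
      have := sq_nonneg ‖z‖
      rcases max_cases (4 * G.R ^ 2 - ‖x0 + z‖ ^ 2) 0 with ⟨h, _⟩ | ⟨h, _⟩ <;>
      rcases max_cases (4 * G.R ^ 2 - ‖x0 - z‖ ^ 2) 0 with ⟨h', _⟩ | ⟨h', _⟩ <;> rw [h, h'] <;> nlinarith)
  rw [lap_congr hev, lap_sub contDiffAt_const (normsq_cd 0 x0), lap_normsq] at h3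
  have : lap n (fun _ => 4 * G.R ^ 2) x0 = 0 := by simp [lap]
  rw [this] at h3
  have : (1:ℝ) ≤ n := by exact_mod_cast hn
  simp at h3
  linarith

lemma sup_bd (hn : 1 ≤ n) {s a : ℝ} (hs : 0 < s) (hs1 : s < 1) (ha : 0 ≤ a) {Ω : Set (En n)} (G : Geo n Ω)
    {g u : En n → ℝ} (S : Sol n s a Ω g u) (x : En n) : |u x| ≤ 4 * G.R ^ 2 := by
  rw [abs_le]
  have h1 := sup_upper hn hs hs1 ha G S x
  have h2 := sup_upper hn hs hs1 ha G S.neg x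
  constructor <;> linarith

end

section

open MeasureTheory Real Set Metric Bornology Filter
open scoped RealInnerProductSpace ENNReal NNReal Pointwise

variable {n : ℕ}

/-- sublinear bound for `P (x+z) + P (x-z) - 2 P x`. -/
lemma P_sd {Ω : Set (En n)} (G : Geo n Ω) {s : ℝ} (hs : 0 < s) (hs1 : s < 1) (x z : En n) :
    G.P (x + z) + G.P (x - z) - 2 * G.P x ≤ 2 * G.L * ‖z‖ ^ s := by
  have hL := G.L1
  have h1 := (abs_le.1 (G.P_lip x (x + z))).2
  have h2 := (abs_le.1 (G.P_lip x (x - z))).2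
  have e1 : x + z - x = z := by abel
  have e2 : x - z - x = -z := by abel
  rw [e1] at h1
  rw [e2, norm_neg] at h2
  rcases le_total ‖z‖ 1 with h | h
  · have : ‖z‖ ≤ ‖z‖ ^ s := by
      have := rpow_le_rpow_of_exponent_ge' (norm_nonneg z) h hs.le hs1.le
      simpa using this
    nlinarith
  · have : 1 ≤ ‖z‖ ^ s := one_le_rpow h hs.le
    have h3 := G.P_le (x + z)
    have h4 := G.P_le (x - z)
    have h5 := G.P_nonneg x
    nlinarith

lemma P_sd_near {Ω : Set (En n)} (G : Geo n Ω) {x z : En n} (hx : x ∈ Ω) (hz : ‖z‖ ≤ G.W x / (2 * G.L)) :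
    G.P (x + z) + G.P (x - z) - 2 * G.P x ≤ 2 * G.L * ‖z‖ ^ 2 := by
  have e1 : x + z - x = z := by abel
  have e2 : x - z - x = -z := by abel
  have a1 := (G.half (y := x + z) hx (by rw [e1]; exact hz)).1
  have a2 := (G.half (y := x - z) hx (by rw [e2, norm_neg]; exact hz)).1
  rw [G.P_eq a1, G.P_eq a2, G.P_eq hx]
  have h1 := (abs_le.1 (G.tay x (x + z))).2
  have h2 := (abs_le.1 (G.tay x (x - z))).2
  rw [e1] at h1
  rw [e2, norm_neg, map_neg] at h2
  linarith

set_option maxHeartbeats 2000000 in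
lemma barrier_up (hn : 1 ≤ n) {s A0 : ℝ} (hs : 0 < s) (hs1 : s < 1) (hA0 : 0 < A0) {Ω : Set (En n)}
    (G : Geo n Ω) : ∃ K > 0, ∀ a ∈ Icc 0 A0, ∀ g u, Sol n s a Ω g u → ∀ x, u x ≤ K * G.P x := by
  have hL := G.L1
  have hL0 := G.L0
  have hkn := kn_pos hn
  have hcK := cK_pos hn hs hs1
  set β := (1 + s) / 2 with hβ
  set q := 2 - β with hq
  have hq1 : 1 < q := by rw [hq, hβ]; linarith
  set ε := 1 / (2 * q * G.L ^ (q - 1)) with hε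
  have hε0 : 0 < ε := by positivity
  have hεb : ∀ t, 0 ≤ t → t ≤ G.L → ε * q * t ^ (q - 1) ≤ 1/2 := by
    intro t h0 h1
    have : t ^ (q - 1) ≤ G.L ^ (q - 1) := rpow_le_rpow h0 h1 (by linarith)
    have h2 : 0 < G.L ^ (q - 1) := by positivity
    calc ε * q * t ^ (q - 1) ≤ ε * q * G.L ^ (q - 1) := by gcongr
      _ = 1/2 := by rw [hε]; field_simp
  set H : ℝ → ℝ := fun t => t - ε * t ^ q with hH
  have hHlow : ∀ t, 0 ≤ t → t ≤ G.L → t / 2 ≤ H t := by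
    intro t h0 h1
    rcases h0.eq_or_lt with h | h
    · rw [hH, ← h]; simp [zero_rpow (by linarith : q ≠ 0)]
    have e : t ^ q = t ^ (q - 1) * t := by rw [← rpow_add_one h.ne']; congr 1; ring
    have h2 := hεb t h0 h1
    have h3 : ε * t ^ (q - 1) ≤ 1/2 := by
      refine le_trans ?_ h2
      have : 0 ≤ ε * t ^ (q - 1) := by positivity
      nlinarith
    simp only [hH]; rw [e]; nlinarith
  set Cm := 2 * G.L * (kn n / (2 - 2*s)) * (2 * G.L) ^ s + 2 * G.L * (kn n / s) * (2 * G.L) ^ s with hCm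
  have h22 : 0 < 2 - 2*s := by linarith
  have hCm0 : 0 < Cm := by positivity
  set δ := ε * q * (q - 1) * G.c ^ 2 with hδ
  have hq10 : 0 < q - 1 := by linarith
  have hδ0 : 0 < δ := by have := G.c0; positivity
  set B := n * G.L + 1 + A0 * (cK n s / 2) * Cm with hB
  have hB0 : 0 < B := by positivity
  set t1 := min (min 1 G.κ) ((δ / (2 * B)) ^ (1 / (β - s))) with ht1
  have hκ := G.κ0
  have ht10 : 0 < t1 := by positivity
  have hR := G.R1
  set A := max 1 (8 * G.R ^ 2 / t1) with hA
  have hA1 : 1 ≤ A := le_max_left _ _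
  refine ⟨A, by linarith, ?_⟩
  intro a ha g u S x
  have hHle : ∀ y, H (G.P y) ≤ G.P y := by
    intro y
    have := rpow_nonneg (G.P_nonneg y) q
    simp only [hH]; nlinarith
  set ψ : En n → ℝ := fun y => A * H (G.P y) with hψ
  suffices hsuf : u x ≤ ψ x from hsuf.trans (mul_le_mul_of_nonneg_left (hHle x) (by linarith))
  have hψc : Continuous ψ := by
    have := G.P_cont
    have h2 : Continuous fun y => G.P y ^ q := this.rpow_const fun _ => Or.inr (by linarith)
    simp only [hψ, hH]
    fun_prop
  by_contra hcon
  push Not at hcon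
  obtain ⟨x0, hx0, h1, h2⟩ := max_exists G S.ct hψc (fun y hy => by
    rw [S.out y hy, hψ]
    simp only [G.P_out hy]
    have := hHlow 0 le_rfl hL0.le
    nlinarith) hcon
  set t := G.W x0 with ht
  have ht0 : 0 < t := (G.pos_iff x0).1 hx0
  have htL : t ≤ G.L := (le_abs_self _).trans (G.bd x0)
  have hPt : G.P x0 = t := G.P_eq hx0
  have htt1 : t < t1 := by
    have h3 := (abs_le.1 (sup_bd hn hs hs1 ha.1 G S x0)).2
    have h4 := hHlow t ht0.le htL
    simp only [hψ] at h1
    rw [hPt] at h1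
    have h5 : 8 * G.R ^ 2 ≤ A * t1 := by
      rw [← div_le_iff₀ ht10]; exact le_max_right _ _
    by_contra h
    push Not at h
    nlinarith
  have htone : t < 1 := htt1.trans_le ((min_le_left _ _).trans (min_le_left _ _))
  have htκ : t < G.κ := htt1.trans_le ((min_le_left _ _).trans (min_le_right _ _))
  have htd : t ^ (β - s) < δ / (2 * B) := by
    have hp : 0 < β - s := by rw [hβ]; linarith
    have h3 : t < (δ / (2 * B)) ^ (1 / (β - s)) := htt1.trans_le (min_le_right _ _)
    have h4 := rpow_lt_rpow ht0.le h3 hp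
    rwa [← rpow_mul (by positivity), one_div_mul_cancel hp.ne', rpow_one] at h4
  -- local form
  set f : ℝ → ℝ := fun r => A * (r - ε * r ^ q) with hf
  set f1 : ℝ → ℝ := fun r => A * (1 - ε * (q * r ^ (q - 1))) with hf1
  have hev : ψ =ᶠ[nhds x0] fun y => f (G.W y) := by
    filter_upwards [G.isOpen.mem_nhds hx0] with y hy
    simp only [hψ, hH, hf, G.P_eq hy]
  have hd1 : ∀ r : ℝ, 0 < r → HasDerivAt f (f1 r) r := by
    intro r hr
    have := ((hasDerivAt_id r).sub ((hasDerivAt_rpow_const (p := q) (Or.inl hr.ne')).const_mul ε)).const_mul A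
    exact this
  have hd2 : HasDerivAt f1 (A * (-(ε * (q * ((q - 1) * t ^ (q - 1 - 1)))))) t := by
    have := (((hasDerivAt_rpow_const (x := t) (p := q - 1) (Or.inl ht0.ne')).const_mul q).const_mul ε
      |>.const_sub 1).const_mul A
    exact this
  have hWcd : ContDiffAt ℝ 2 G.W x0 := G.smooth.contDiffAt
  have hlap := lap_comp (f := f) (f1 := f1) hWcd ((lt_mem_nhds ht0).mono hd1) hd2
  have hcd : ContDiffAt ℝ 2 ψ x0 := by
    refine ContDiffAt.congr_of_eventuallyEq ?_ hev
    have : ContDiffAt ℝ 2 (fun y => G.W y ^ q) x0 := hWcd.rpow_const_of_ne ht0.ne'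
    exact contDiffAt_const.mul (hWcd.sub (contDiffAt_const.mul this))
  set τ := t / (2 * G.L) with hτ
  have hτ0 : 0 < τ := by positivity
  have hτ1 : τ ≤ 1 := by rw [hτ, div_le_one (by positivity)]; linarith
  obtain ⟨i1, j1⟩ := rad_near hn h22 hτ0
  obtain ⟨i2, j2⟩ := rad_far hn hs hτ0
  have hHtan : ∀ r, 0 ≤ r → H r ≤ H t + (1 - ε * q * t ^ (q - 1)) * (r - t) := by
    intro r hr
    have := mul_le_mul_of_nonneg_left (rpow_tangent hq1.le ht0 hr) hε0.le
    simp only [hH]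
    linarith
  have hslope := hεb t ht0.le htL
  have hslope0 : 0 ≤ ε * q * t ^ (q - 1) := by positivity
  have hsdψ : ∀ z E, 0 ≤ E → G.P (x0 + z) + G.P (x0 - z) - 2 * G.P x0 ≤ E → -(A * E) ≤ sd ψ x0 z := by
    intro z E hE0 hE
    have k1 := hHtan _ (G.P_nonneg (x0 + z))
    have k2 := hHtan _ (G.P_nonneg (x0 - z))
    simp only [sd, hψ]
    rw [hPt] at hE ⊢
    have k3 : (1 - ε * q * t ^ (q - 1)) * (G.P (x0 + z) + G.P (x0 - z) - 2 * t) ≤ E := by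
      rcases le_total (G.P (x0 + z) + G.P (x0 - z) - 2 * t) 0 with h | h
      · refine (mul_nonpos_of_nonneg_of_nonpos (by linarith) h).trans hE0
      · refine le_trans ?_ hE
        refine mul_le_of_le_one_left h (by linarith)
    have k4 : 2 * H t - H (G.P (x0 + z)) - H (G.P (x0 - z)) ≥ -E := by linarith
    have k5 := mul_le_mul_of_nonneg_left k4 (by linarith : (0:ℝ) ≤ A)
    linarith
  have h3 := cmpSol hn hs hs1 ha.1 G.isOpen S hx0 h2 hcd
    (m := fun z => (A * (2 * G.L)) * rad n (Ioo 0 τ) (2 - 2*s) z + (A * (2 * G.L)) * rad n (Ici τ) (s - 2*s) z)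
    ((i1.const_mul _).add (by
      have : s - 2*s = -s := by ring
      rw [this]; exact i2.const_mul _)) (fun z => by
      have := rad_nonneg (n := n) (T := Ioo 0 τ) (q := 2 - 2*s) z
      have := rad_nonneg (n := n) (T := Ici τ) (q := s - 2*s) z
      positivity) (fun z => split_lower hτ0 z (by rintro rfl; exact sd_zero _ _) (by positivity) (by positivity)
        (fun hz => by
          have := hsdψ z _ (by positivity) (P_sd_near G hx0 hz.le)
          rw [rpow_two]; linarith)
        (fun hz => by
          have := hsdψ z _ (by positivity) (P_sd G hs hs1 x0 z)
          linarith))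
  have hintg : ∫ z, ((A * (2 * G.L)) * rad n (Ioo 0 τ) (2 - 2*s) z + (A * (2 * G.L)) * rad n (Ici τ) (s - 2*s) z)
      ≤ A * Cm * t ^ (-s) := by
    have es : s - 2*s = -s := by ring
    rw [es, integral_add (i1.const_mul _) (i2.const_mul _), integral_const_mul, integral_const_mul, j1, j2]
    have e1 : τ ^ (-s) = (2 * G.L) ^ s * t ^ (-s) := by
      rw [hτ, div_rpow ht0.le (by positivity), rpow_neg (x := 2 * G.L) (by positivity)]
      field_simp
    have e2 : τ ^ (2 - 2*s) ≤ τ ^ (-s) := rpow_le_rpow_of_exponent_ge hτ0 hτ1 (by linarith)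
    calc _ ≤ A * (2 * G.L) * (kn n / (2 - 2*s) * τ ^ (-s)) + A * (2 * G.L) * (kn n / s * τ ^ (-s)) := by gcongr
      _ = _ := by rw [e1, hCm]; ring
  rw [lap_congr hev, hlap] at h3
  obtain ⟨e, he, hce⟩ := G.nor x0 (subset_closure hx0) htκ
  have h4 := grad_sq_ge _ he G.c0.le hce
  have h5 := (abs_le.1 (lap_abs_le hWcd (G.he x0))).2
  have eq2 : q - 1 - 1 = -β := by rw [hq]; ring
  rw [eq2] at h3
  have htb : 0 < t ^ (-β) := by positivity
  have h6 : A * (-(ε * (q * ((q - 1) * t ^ (-β))))) * ∑ i, (fderiv ℝ G.W x0 (bv n i)) ^ 2 ≤ -(A * (δ * t ^ (-β))) := by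
    have : 0 ≤ A * (ε * (q * ((q - 1) * t ^ (-β)))) := by positivity
    have := mul_le_mul_of_nonneg_left h4 this
    rw [hδ]; linarith
  have h7 : f1 t * lap n G.W x0 ≤ A * (n * G.L) := by
    have : 0 ≤ f1 t := by simp only [hf1]; exact mul_nonneg (by linarith) (by linarith)
    have h8 : f1 t ≤ A := by
      simp only [hf1]
      exact mul_le_of_le_one_right (by linarith) (by linarith)
    calc _ ≤ f1 t * (n * G.L) := mul_le_mul_of_nonneg_left h5 this
      _ ≤ _ := by gcongr
  have h8 : a * (cK n s / 2 * ∫ z, ((A * (2 * G.L)) * rad n (Ioo 0 τ) (2 - 2*s) z + (A * (2 * G.L)) * rad n (Ici τ) (s - 2*s) z))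
     ≤ A * (A0 * (cK n s / 2) * Cm * t ^ (-s)) := by
    calc _ ≤ a * (cK n s / 2 * (A * Cm * t ^ (-s))) := by
          have := ha.1
          gcongr
      _ ≤ A0 * (cK n s / 2 * (A * Cm * t ^ (-s))) := by
          have := ha.2
          gcongr
      _ = _ := by ring
  have hts : 1 ≤ t ^ (-s) := one_le_rpow_of_pos_of_le_one_of_nonpos ht0 htone.le (by linarith)
  have h9 : A * (δ * t ^ (-β)) ≤ A * (2 * B * t ^ (-s)) := by
    have k1 : A * (δ * t ^ (-β)) ≤ A * (n * G.L + 1 + A0 * (cK n s / 2) * Cm * t ^ (-s)) := by linarith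
    refine k1.trans (mul_le_mul_of_nonneg_left ?_ (by linarith))
    have : (n * G.L + 1) ≤ (n * G.L + 1) * t ^ (-s) := le_mul_of_one_le_right (by positivity) hts
    have : 0 ≤ B * t ^ (-s) := by positivity
    rw [hB] at *
    linarith
  have h10 : δ * t ^ (-β) ≤ 2 * B * t ^ (-s) := le_of_mul_le_mul_left h9 (by linarith)
  have e5 : t ^ (-s) = t ^ (β - s) * t ^ (-β) := by rw [← rpow_add ht0]; congr 1; ring
  rw [e5] at h10
  rw [lt_div_iff₀ (by positivity)] at htd
  nlinarith

lemma barrier (hn : 1 ≤ n) {s A0 : ℝ} (hs : 0 < s) (hs1 : s < 1) (hA0 : 0 < A0) {Ω : Set (En n)}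
    (G : Geo n Ω) : ∃ K > 0, ∀ a ∈ Icc 0 A0, ∀ g u, Sol n s a Ω g u → ∀ x, |u x| ≤ K * G.P x := by
  obtain ⟨K, hK, h⟩ := barrier_up hn hs hs1 hA0 G
  refine ⟨K, hK, fun a ha g u S x => ?_⟩
  rw [abs_le]
  have h1 := h a ha g u S x
  have h2 := h a ha _ _ S.neg x
  constructor <;> linarith

end

section

open MeasureTheory Real Set Metric Bornology Filter
open scoped RealInnerProductSpace ENNReal NNReal Pointwise

variable {n : ℕ}

lemma hess_cont {Ω : Set (En n)} (hΩ : IsOpen Ω) {u : En n → ℝ} (hu : ContDiffOn ℝ 2 u Ω) :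
    ContinuousOn (hess n u) Ω := by
  have h1 : ContDiffOn ℝ 1 (fderiv ℝ u) Ω := hu.fderiv_of_isOpen hΩ (by norm_num)
  exact h1.continuousOn_fderiv_of_isOpen hΩ le_rfl

lemma self_le_rpow {r L s : ℝ} (hs : 0 < s) (hs1 : s < 1) (hL : 1 ≤ L) (hr : 0 ≤ r) (h : r ≤ L) :
    r ≤ L * r ^ (1 - s) ∧ r ^ (1 - s) ≤ L := by
  constructor
  · rcases hr.eq_or_lt with h0 | h0
    · rw [← h0]; have := rpow_nonneg (le_refl (0:ℝ)) (1 - s); positivity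
    have e : r = r ^ s * r ^ (1 - s) := by rw [← rpow_add h0]; simp
    have : r ^ s ≤ L := by
      calc r ^ s ≤ L ^ s := rpow_le_rpow hr h hs.le
        _ ≤ L ^ (1:ℝ) := rpow_le_rpow_of_exponent_le hL hs1.le
        _ = L := rpow_one L
    calc r = r ^ s * r ^ (1 - s) := e
      _ ≤ _ := by gcongr
  · calc r ^ (1 - s) ≤ L ^ (1 - s) := rpow_le_rpow hr h (by linarith)
        _ ≤ L ^ (1:ℝ) := rpow_le_rpow_of_exponent_le hL (by linarith)
        _ = L := rpow_one L

/-- Hölder bound of the Laplacian of a solution. -/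
lemma lap_hold (hn : 1 ≤ n) {s A0 : ℝ} (hs : 0 < s) (hs1 : s < 1) (hA0 : 0 < A0) {Ω : Set (En n)}
    (G : Geo n Ω) : ∃ C > 0, ∀ a ∈ Icc 0 A0, ∀ g u, Sol n s a Ω g u → ∀ K, 0 ≤ K → (∀ x, |u x| ≤ K * G.P x) →
      ∀ x ∈ Ω, ∀ r Λ, 0 < r → r ≤ G.W x / (2 * G.L) → (∀ y ∈ closedBall x r, ‖hess n u y‖ ≤ Λ) →
      ∀ y, ‖y - x‖ ≤ r / 4 →
      |lap n u y - lap n u x| ≤ C * ((Λ + K * G.W x / r ^ 2) * r ^ (1 - s) + 1) * ‖y - x‖ ^ (1 - s) := by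
  obtain ⟨C, hC, h⟩ := frac_hold (n := n) hn hs hs1
  have hL := G.L1
  refine ⟨A0 * C * G.L + G.L, by positivity, ?_⟩
  intro a ha g u S K hK hu x hx r Λ hr hrW hΛ y hy
  have hw : 0 < G.W x := (G.pos_iff x).1 hx
  have hwL : G.W x ≤ G.L := (le_abs_self _).trans (G.bd x)
  have hsub : closedBall x r ⊆ Ω := by
    intro y hy
    rw [mem_closedBall, dist_eq_norm] at hy
    exact (G.half hx (hy.trans hrW)).1
  have hrw : r ≤ G.W x := hrW.trans (div_le_self hw.le (by linarith))
  have hΛ0 : 0 ≤ Λ := (norm_nonneg (hess n u x)).trans (hΛ x (mem_closedBall_self hr.le))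
  have h1 := h Ω G.isOpen u S.cd S.ct (4 * G.R ^ 2) (sup_bd hn hs hs1 ha.1 G S) x r Λ (K * G.L) (G.W x) hr hsub hΛ
    (by positivity) hrw (by
      intro z
      refine (hu _).trans ?_
      have h2 := (abs_le.1 (G.P_lip x (x + z))).2
      rw [add_sub_cancel_left, G.P_eq hx] at h2
      rw [mul_assoc]
      refine mul_le_mul_of_nonneg_left ?_ hK
      nlinarith) y (by rw [norm_sub_rev]; exact hy)
  rw [norm_sub_rev] at h1
  have hyΩ : y ∈ Ω := hsub (by rw [mem_closedBall, dist_eq_norm]; linarith)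
  have h2 := S.gl y hyΩ x hx
  have e : lap n u y - lap n u x = -(a * (fracLap n s u x - fracLap n s u y)) - (g y - g x) := by
    rw [S.eq y hyΩ, S.eq x hx]; ring
  rw [e]
  have er : r ^ (-1 - s) = r ^ (1 - s) / r ^ 2 := by
    rw [← rpow_two, ← rpow_sub hr]; congr 1; ring
  rw [er] at h1
  have hp := rpow_nonneg (norm_nonneg (y - x)) (1 - s)
  have h3 := (self_le_rpow hs hs1 hL (norm_nonneg (y - x)) (by linarith)).1
  have hrp := rpow_nonneg hr.le (1 - s)
  have key : Λ * r ^ (1 - s) + K * G.L * G.W x * (r ^ (1 - s) / r ^ 2) ≤ G.L * ((Λ + K * G.W x / r ^ 2) * r ^ (1 - s)) := by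
    have : Λ * r ^ (1 - s) ≤ G.L * (Λ * r ^ (1 - s)) := le_mul_of_one_le_left (by positivity) hL
    calc _ ≤ G.L * (Λ * r ^ (1 - s)) + K * G.L * G.W x * (r ^ (1 - s) / r ^ 2) := by linarith
      _ = _ := by field_simp
  set Q := (Λ + K * G.W x / r ^ 2) * r ^ (1 - s) with hQ
  have hQ0 : 0 ≤ Q := by positivity
  calc _ ≤ |(a * (fracLap n s u x - fracLap n s u y))| + |g y - g x| := by
        refine (abs_sub _ _).trans ?_
        rw [abs_neg]
    _ ≤ A0 * (C * (G.L * Q) * ‖y - x‖ ^ (1 - s)) + G.L * ‖y - x‖ ^ (1 - s) := by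
        refine add_le_add ?_ (h2.trans h3)
        rw [abs_mul, abs_of_nonneg ha.1]
        refine mul_le_mul ha.2 (h1.trans ?_) (abs_nonneg _) hA0.le
        gcongr
    _ ≤ _ := by
        have t1 : 0 ≤ A0 * C * G.L * ‖y - x‖ ^ (1 - s) := by positivity
        have t2 : 0 ≤ G.L * Q * ‖y - x‖ ^ (1 - s) := by positivity
        nlinarith

set_option maxHeartbeats 1000000 in
lemma int_hess (hn : 1 ≤ n) {s A0 : ℝ} (hs : 0 < s) (hs1 : s < 1) (hA0 : 0 < A0) {Ω : Set (En n)}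
    (G : Geo n Ω) : ∃ C > 0, ∀ a ∈ Icc 0 A0, ∀ g u, Sol n s a Ω g u → ∀ x ∈ Ω, ‖hess n u x‖ ≤ C / G.W x := by
  obtain ⟨K, hK, hbar⟩ := barrier hn hs hs1 hA0 G
  obtain ⟨C, hC, hlh⟩ := lap_hold hn hs hs1 hA0 G
  have hp : 0 < 1 - s := by linarith
  obtain ⟨C1, hC1, hsch⟩ := schauder_loc n hp
  have hL := G.L1
  set ε := min (1/4) ((1 / (8 * C1 * C * G.L ^ 2)) ^ (1 / (1 - s))) with hε
  have hε0 : 0 < ε := by positivity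
  have hε4 : ε ≤ 1/4 := min_le_left _ _
  have hεp : 4 * C1 * C * G.L ^ 2 * ε ^ (1 - s) ≤ 1/2 := by
    have h1 : ε ^ (1 - s) ≤ 1 / (8 * C1 * C * G.L ^ 2) := by
      have := rpow_le_rpow hε0.le (min_le_right (1/4) ((1 / (8 * C1 * C * G.L ^ 2)) ^ (1 / (1 - s)))) hp.le
      rwa [← rpow_mul (by positivity), one_div_mul_cancel hp.ne', rpow_one] at this
    calc _ ≤ 4 * C1 * C * G.L ^ 2 * (1 / (8 * C1 * C * G.L ^ 2)) := by gcongr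
      _ = 1/2 := by field_simp; norm_num
  set B := 8 * C1 * K / ε ^ 2 + K + 4 * C1 * C * G.L ^ 3 with hB
  have hB0 : 0 < B := by positivity
  refine ⟨8 * B * G.L ^ 2, by positivity, ?_⟩
  intro a ha g u S x0 hx0
  have hbu := hbar a ha g u S
  set w := G.W x0 with hw
  have hw0 : 0 < w := (G.pos_iff x0).1 hx0
  have hwL : w ≤ G.L := (le_abs_self _).trans (G.bd x0)
  set R0 := w / (2 * G.L) with hR0
  have hR00 : 0 < R0 := by positivity
  have hsub : closedBall x0 R0 ⊆ Ω := by
    intro y hy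
    rw [mem_closedBall, dist_eq_norm] at hy
    exact (G.half hx0 hy).1
  have hcon : ContinuousOn (fun y => (R0 - ‖y - x0‖) ^ 2 * ‖hess n u y‖) (closedBall x0 R0) := by
    have h1 : ContinuousOn (fun y => ‖hess n u y‖) (closedBall x0 R0) :=
      ContinuousOn.norm (E := En n →L[ℝ] En n →L[ℝ] ℝ) ((hess_cont G.isOpen S.cd).mono hsub)
    have h2 : ContinuousOn (fun y : En n => (R0 - ‖y - x0‖) ^ 2) (closedBall x0 R0) := by fun_prop
    exact h2.mul h1
  obtain ⟨y, hy, hmax⟩ := (isCompact_closedBall x0 R0).exists_isMaxOn ⟨x0, mem_closedBall_self hR00.le⟩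
    (f := fun y => (R0 - ‖y - x0‖) ^ 2 * ‖hess n u y‖)
    hcon
  set N := (R0 - ‖y - x0‖) ^ 2 * ‖hess n u y‖ with hN
  have hmax' : ∀ z ∈ closedBall x0 R0, (R0 - ‖z - x0‖) ^ 2 * ‖hess n u z‖ ≤ N := fun z hz => hmax hz
  have hyR : ‖y - x0‖ ≤ R0 := by rwa [mem_closedBall, dist_eq_norm] at hy
  have hN0 : 0 ≤ N := by positivity
  have hNb : N ≤ 2 * B * w := by
    rcases hyR.eq_or_lt with h | h
    · rw [hN, h]; simp; positivity
    set r := (R0 - ‖y - x0‖) / 2 with hr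
    have hr0 : 0 < r := by rw [hr]; linarith
    have eN : N = 4 * r ^ 2 * ‖hess n u y‖ := by rw [hN, hr]; ring
    have hyΩ := hsub hy
    obtain ⟨_, hy1, hy2⟩ := G.half hx0 hyR
    have hrR : r ≤ R0 / 2 := by rw [hr]; linarith [norm_nonneg (y - x0)]
    have hyΩ0 : 0 < G.W y := (G.pos_iff y).1 hyΩ
    have hrW : r ≤ G.W y / (2 * G.L) := by
      refine hrR.trans ?_
      rw [hR0, div_div, mul_comm (2 * G.L), ← div_div]
      gcongr
    have hΛ : ∀ z ∈ closedBall y r, ‖hess n u z‖ ≤ N / r ^ 2 := by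
      intro z hz
      rw [mem_closedBall, dist_eq_norm] at hz
      have h1 : ‖z - x0‖ ≤ ‖z - y‖ + ‖y - x0‖ := norm_sub_le_norm_sub_add_norm_sub z y x0
      have h2 := hmax' z (by rw [mem_closedBall, dist_eq_norm]; linarith)
      rw [le_div_iff₀ (by positivity)]
      refine le_trans ?_ h2
      have : r ≤ R0 - ‖z - x0‖ := by linarith
      rw [mul_comm]
      gcongr
    have hl := hlh a ha g u S K hK.le hbu y hyΩ r _ hr0 hrW hΛ
    have hrw : r ≤ w := by
      have : R0 ≤ w := div_le_self hw0.le (by linarith)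
      linarith
    have hs1' := hsch Ω G.isOpen u S.cd y (ε * r) (2 * K * w) (C * ((N / r ^ 2 + K * G.W y / r ^ 2) * r ^ (1 - s) + 1))
      (by positivity) (by
        intro z hz
        rw [mem_closedBall, dist_eq_norm] at hz
        refine hsub ?_
        have h1 : ‖z - x0‖ ≤ ‖z - y‖ + ‖y - x0‖ := norm_sub_le_norm_sub_add_norm_sub z y x0
        rw [mem_closedBall, dist_eq_norm]
        nlinarith) (by positivity) 0 0 (by
        intro z hz
        rw [mem_closedBall, dist_eq_norm] at hz
        have h1 : ‖z - x0‖ ≤ ‖z - y‖ + ‖y - x0‖ := norm_sub_le_norm_sub_add_norm_sub z y x0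
        obtain ⟨q1, q2, q3⟩ := G.half (y := z) hx0 (by
          change ‖z - x0‖ ≤ R0
          nlinarith)
        have := hbu z
        rw [G.P_eq q1] at this
        simp only [ContinuousLinearMap.zero_apply, add_zero, sub_zero]
        nlinarith) (by
        intro z hz
        rw [mem_closedBall, dist_eq_norm] at hz
        exact hl z (by nlinarith))
    have e1 : (ε * r) ^ (1 - s) = ε ^ (1 - s) * r ^ (1 - s) := mul_rpow hε0.le hr0.le
    rw [e1] at hs1'
    have hrp := (self_le_rpow hs hs1 hL hr0.le (hrw.trans hwL)).2
    have hrp0 := rpow_nonneg hr0.le (1 - s)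
    have hεp0 := rpow_nonneg hε0.le (1 - s)
    have hεp1 : ε ^ (1 - s) ≤ 1 := rpow_le_one hε0.le (by linarith) hp.le
    rw [eN] at *
    have hh := norm_nonneg (hess n u y)
    set h' := ‖hess n u y‖
    have hWy : G.W y ≤ 2 * w := hy2
    have k1 : 4 * r ^ 2 * h' ≤ 8 * C1 * K / ε ^ 2 * w
        + 4 * C1 * C * ε ^ (1 - s) * (r ^ (1 - s) * r ^ (1 - s)) * (4 * r ^ 2 * h' + K * G.W y)
        + 4 * C1 * C * r ^ 2 * (ε ^ (1 - s) * r ^ (1 - s)) := by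
      refine (mul_le_mul_of_nonneg_left hs1' (by positivity : 0 ≤ 4 * r ^ 2)).trans (le_of_eq ?_)
      field_simp
      ring
    have k2 : 4 * C1 * C * ε ^ (1 - s) * (r ^ (1 - s) * r ^ (1 - s)) * (4 * r ^ 2 * h' + K * G.W y)
        ≤ 1/2 * (4 * r ^ 2 * h' + 2 * K * w) := by
      have : r ^ (1 - s) * r ^ (1 - s) ≤ G.L ^ 2 := by rw [pow_two]; gcongr
      calc _ ≤ 4 * C1 * C * ε ^ (1 - s) * G.L ^ 2 * (4 * r ^ 2 * h' + K * (2 * w)) := by gcongr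
        _ = 4 * C1 * C * G.L ^ 2 * ε ^ (1 - s) * (4 * r ^ 2 * h' + 2 * K * w) := by ring
        _ ≤ _ := by gcongr
    have k3 : 4 * C1 * C * r ^ 2 * (ε ^ (1 - s) * r ^ (1 - s)) ≤ 4 * C1 * C * G.L ^ 3 * w := by
      have : r ^ 2 ≤ G.L * w := by rw [pow_two]; exact mul_le_mul (hrw.trans hwL) hrw hr0.le (by linarith)
      calc _ ≤ 4 * C1 * C * (G.L * w) * (1 * G.L) := by gcongr
        _ = 4 * C1 * C * G.L ^ 2 * w := by ring
        _ ≤ _ := by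
          have : G.L ^ 2 ≤ G.L ^ 3 := pow_le_pow_right₀ hL (by norm_num)
          gcongr
    have : B * w = 8 * C1 * K / ε ^ 2 * w + K * w + 4 * C1 * C * G.L ^ 3 * w := by rw [hB]; ring
    nlinarith
  have h1 := hmax' x0 (mem_closedBall_self hR00.le)
  rw [sub_self, norm_zero, sub_zero] at h1
  have h2 := h1.trans hNb
  rw [hR0] at h2
  rw [le_div_iff₀ hw0]
  have e : (w / (2 * G.L)) ^ 2 * ‖hess n u x0‖ = w * (‖hess n u x0‖ * w / (4 * G.L ^ 2)) := by field_simp; ring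
  rw [e] at h2
  have h3 : ‖hess n u x0‖ * w / (4 * G.L ^ 2) ≤ 2 * B := by
    refine le_of_mul_le_mul_left ?_ hw0
    linarith
  rw [div_le_iff₀ (by positivity)] at h3
  linarith

end

section

open MeasureTheory Real Set Metric Bornology Filter
open scoped RealInnerProductSpace ENNReal NNReal Pointwise

variable {n : ℕ}

lemma frac_abs (hn : 1 ≤ n) {s : ℝ} (hs : 0 < s) (hs1 : s < 1) {u : En n → ℝ} {x : En n} {m : En n → ℝ}
    (hm : Integrable m) (hm0 : ∀ z, 0 ≤ m z) (h : ∀ z, |sd u x z| / ‖z‖ ^ ((n:ℝ) + 2*s) ≤ m z) :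
    |fracLap n s u x| ≤ (cK n s / 2) * ∫ z, m z := by
  have h0 : ∀ z : En n, 0 ≤ ‖z‖ ^ ((n:ℝ) + 2*s) := fun z => by positivity
  have h1 := frac_lower hn hs hs1 (u := u) (x := x) hm hm0 (fun z => by
    have : -(|sd u x z| / ‖z‖ ^ ((n:ℝ) + 2*s)) ≤ sd u x z / ‖z‖ ^ ((n:ℝ) + 2*s) := by
      rw [← neg_div]
      exact div_le_div_of_nonneg_right (neg_abs_le _) (h0 z)
    linarith [h z])
  have h2 := frac_lower hn hs hs1 (u := fun y => -u y) (x := x) hm hm0 (fun z => by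
    have e : sd (fun y => -u y) x z = -sd u x z := by simp only [sd]; ring
    rw [e]
    have : -(|sd u x z| / ‖z‖ ^ ((n:ℝ) + 2*s)) ≤ -sd u x z / ‖z‖ ^ ((n:ℝ) + 2*s) := by
      rw [← neg_div]
      exact div_le_div_of_nonneg_right (neg_le_neg (le_abs_self _)) (h0 z)
    linarith [h z])
  rw [frac_neg] at h2
  rw [abs_le]
  constructor <;> linarith

lemma frac_two (hn : 1 ≤ n) {s τ a b B D : ℝ} (hs : 0 < s) (hs1 : s < 1) (hτ : 0 < τ) (hB : 0 ≤ B) (hD : 0 ≤ D)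
    (ha : 0 < a - 2*s) (hb : 0 < 2*s - b) {u : En n → ℝ} {x : En n}
    (h1 : ∀ z, ‖z‖ < τ → |sd u x z| ≤ B * ‖z‖ ^ a) (h2 : ∀ z, τ ≤ ‖z‖ → |sd u x z| ≤ D * ‖z‖ ^ b) :
    |fracLap n s u x| ≤ (cK n s / 2) * (B * (kn n / (a - 2*s) * τ ^ (a - 2*s))
      + D * (kn n / (2*s - b) * τ ^ (-(2*s - b)))) := by
  obtain ⟨i1, j1⟩ := rad_near hn ha hτ
  obtain ⟨i2, j2⟩ := rad_far hn hb hτ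
  rw [← j1, ← j2, ← integral_const_mul, ← integral_const_mul, ← integral_add (i1.const_mul _) (i2.const_mul _)]
  refine frac_abs hn hs hs1 ((i1.const_mul _).add (i2.const_mul _)) (fun z => ?_) (fun z => ?_)
  · exact add_nonneg (mul_nonneg hB (rad_nonneg z)) (mul_nonneg hD (rad_nonneg z))
  · have e : -(2*s - b) = b - 2*s := by ring
    rw [e]
    have := split_lower (s := s) (A := -|sd u x z|) hτ z (by rintro rfl; rw [sd_zero]; simp) hB hD
      (fun hz => neg_le_neg (h1 z hz)) (fun hz => neg_le_neg (h2 z hz))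
    rw [neg_div] at this
    linarith

lemma frac_three (hn : 1 ≤ n) {τ B D : ℝ} (hτ : 0 < τ) (hτ1 : τ ≤ 1) (hB : 0 ≤ B) (hD : 0 ≤ D)
    {u : En n → ℝ} {x : En n}
    (h1 : ∀ z, ‖z‖ < τ → |sd u x z| ≤ B * ‖z‖ ^ 2) (h2 : ∀ z, |sd u x z| ≤ D * ‖z‖) (h3 : ∀ z, |sd u x z| ≤ D) :
    |fracLap n (1/2) u x| ≤ (cK n (1/2) / 2) * (B * (kn n / 1 * τ ^ (1:ℝ))
      + D * (kn n * |log τ|) + D * (kn n / 1 * 1 ^ (-(1:ℝ)))) := by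
  obtain ⟨i1, j1⟩ := rad_near hn one_pos hτ
  obtain ⟨i2, j2⟩ := rad_log hn hτ hτ1
  obtain ⟨i3, j3⟩ := rad_far hn one_pos one_pos
  have i12 := (i1.const_mul B).add (i2.const_mul D)
  have ee : B * (kn n / 1 * τ ^ (1:ℝ)) + D * (kn n * |log τ|) + D * (kn n / 1 * 1 ^ (-(1:ℝ)))
    = ∫ z, (B * rad n (Ioo 0 τ) 1 z + D * rad n (Ico τ 1) 0 z + D * rad n (Ici 1) (-1) z) := by
    have := integral_add i12 (i3.const_mul D)
    simp only [Pi.add_apply] at this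
    rw [this, integral_add (i1.const_mul _) (i2.const_mul _), integral_const_mul, integral_const_mul,
      integral_const_mul, j1, j2, j3]
  rw [ee]
  refine frac_abs hn (by norm_num) (by norm_num) (i12.add (i3.const_mul _)) (fun z => ?_) (fun z => ?_)
  · have := mul_nonneg hB (rad_nonneg (n := n) (T := Ioo 0 τ) (q := 1) z)
    have := mul_nonneg hD (rad_nonneg (n := n) (T := Ico τ 1) (q := 0) z)
    have := mul_nonneg hD (rad_nonneg (n := n) (T := Ici 1) (q := -1) z)
    linarith
  · have p1 := mul_nonneg hB (rad_nonneg (n := n) (T := Ioo 0 τ) (q := 1) z)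
    have p2 := mul_nonneg hD (rad_nonneg (n := n) (T := Ico τ 1) (q := 0) z)
    have p3 := mul_nonneg hD (rad_nonneg (n := n) (T := Ici 1) (q := -1) z)
    by_cases hz : z = 0
    · subst hz
      rw [sd_zero]; simp only [abs_zero, zero_div]; linarith
    have hz0 : 0 < ‖z‖ := norm_pos_iff.2 hz
    have hp : 0 < ‖z‖ ^ ((n:ℝ) + 2*(1/2)) := rpow_pos_of_pos hz0 _
    rcases lt_or_ge ‖z‖ τ with h | h
    · have e := rad_of_mem (n := n) (T := Ioo 0 τ) (s := 1/2) (a := 2) ⟨hz0, h⟩ hz0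
      norm_num at e
      norm_num at hp ⊢
      rw [e] at p1 ⊢
      have : |sd u x z| / ‖z‖ ^ ((n:ℝ) + 1) ≤ B * (‖z‖ ^ 2 / ‖z‖ ^ ((n:ℝ) + 1)) := by
        rw [← mul_div_assoc]
        exact div_le_div_of_nonneg_right (h1 z h) hp.le
      linarith
    rcases lt_or_ge ‖z‖ 1 with h' | h'
    · have e := rad_of_mem (n := n) (T := Ico τ 1) (s := 1/2) (a := 1) ⟨h, h'⟩ hz0
      norm_num at e
      norm_num at hp ⊢
      rw [e] at p2 ⊢
      have : |sd u x z| / ‖z‖ ^ ((n:ℝ) + 1) ≤ D * (‖z‖ / ‖z‖ ^ ((n:ℝ) + 1)) := by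
        rw [← mul_div_assoc]
        exact div_le_div_of_nonneg_right (h2 z) hp.le
      linarith
    · have e := rad_of_mem (n := n) (T := Ici 1) (s := 1/2) (a := 0) h' hz0
      norm_num at e
      norm_num at hp ⊢
      have e' : rad n (Ici 1) (-1) z = (‖z‖ ^ ((n:ℝ) + 1))⁻¹ := e
      rw [e'] at p3 ⊢
      have : |sd u x z| / ‖z‖ ^ ((n:ℝ) + 1) ≤ D * (‖z‖ ^ ((n:ℝ) + 1))⁻¹ := by
        rw [← div_eq_mul_inv]
        exact div_le_div_of_nonneg_right (h3 z) hp.le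
      linarith

lemma sd_bds (hn : 1 ≤ n) {s A0 : ℝ} (hs : 0 < s) (hs1 : s < 1) (hA0 : 0 < A0) {Ω : Set (En n)}
    (G : Geo n Ω) : ∃ D > 0, ∀ a ∈ Icc 0 A0, ∀ g u, Sol n s a Ω g u → ∀ x ∈ Ω, ∀ z,
      (‖z‖ < G.W x / (2 * G.L) → |sd u x z| ≤ D / (G.W x / (2 * G.L)) * ‖z‖ ^ 2) ∧ |sd u x z| ≤ D * ‖z‖ ∧
      |sd u x z| ≤ D := by
  obtain ⟨K, hK, hbar⟩ := barrier hn hs hs1 hA0 G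
  obtain ⟨C, hC, hC1⟩ := int_hess hn hs hs1 hA0 G
  have hL := G.L1
  refine ⟨2 * C + 10 * K * G.L, by positivity, ?_⟩
  intro a ha g u S x hx z
  have hb := hbar a ha g u S
  set w := G.W x with hw
  have hw0 : 0 < w := (G.pos_iff x).1 hx
  set τ := w / (2 * G.L) with hτ
  have hτ0 : 0 < τ := by positivity
  have hwτ : w = 2 * G.L * τ := by rw [hτ]; field_simp
  have hKL : 0 < K * G.L := by positivity
  have near : ‖z‖ < τ → |sd u x z| ≤ (2 * C + 10 * K * G.L) / τ * ‖z‖ ^ 2 := by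
    intro hz
    have hsub : closedBall x τ ⊆ Ω := by
      intro y hy
      rw [mem_closedBall, dist_eq_norm] at hy
      exact (G.half hx hy).1
    have h1 := sd_le (x := x) (z := z) (Λ := 2 * C / w) G.isOpen S.cd (convex_closedBall x τ) hsub (by
      intro y hy
      rw [mem_closedBall, dist_eq_norm] at hy
      obtain ⟨q1, q2, q3⟩ := G.half hx hy
      refine (hC1 a ha g u S y q1).trans ?_
      have : 0 < G.W y := (G.pos_iff y).1 q1
      rw [div_le_div_iff₀ this hw0]
      nlinarith) (mem_closedBall_self hτ0.le) (by simpa using hz.le) (by simpa using hz.le)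
    refine h1.trans ?_
    refine mul_le_mul_of_nonneg_right ?_ (by positivity)
    calc 2 * (2 * C / w) = (2 * C / G.L) / τ := by rw [hwτ]; field_simp
      _ ≤ (2 * C + 10 * K * G.L) / τ := by
        gcongr
        have : 2 * C / G.L ≤ 2 * C := div_le_self (by positivity) hL
        nlinarith
  have hsd : |sd u x z| ≤ K * (2 * G.P x + G.P (x + z) + G.P (x - z)) := by
    have q1 := abs_le.1 (hb x)
    have q2 := abs_le.1 (hb (x + z))
    have q3 := abs_le.1 (hb (x - z))
    rw [abs_le]
    simp only [sd]
    constructor <;> linarith [q1.1, q2.1, q3.1, q1.2, q2.2, q3.2]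
  refine ⟨near, ?_, ?_⟩
  · rcases lt_or_ge ‖z‖ τ with h | h
    · refine (near h).trans ?_
      rw [pow_two, div_mul_eq_mul_div, div_le_iff₀ hτ0]
      have : 0 ≤ (2 * C + 10 * K * G.L) * ‖z‖ := by positivity
      nlinarith
    · have h1 := (abs_le.1 (G.P_lip x (x + z))).2
      have h2 := (abs_le.1 (G.P_lip x (x - z))).2
      have e2 : x - z - x = -z := by abel
      rw [add_sub_cancel_left] at h1
      rw [e2, norm_neg] at h2
      rw [G.P_eq hx] at *
      have h4 : w ≤ 2 * G.L * ‖z‖ := by rw [hwτ]; gcongr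
      have h5 : 2 * w + G.P (x + z) + G.P (x - z) ≤ 10 * G.L * ‖z‖ := by linarith
      have h6 := mul_le_mul_of_nonneg_left h5 hK.le
      have : 0 ≤ 2 * C * ‖z‖ := by positivity
      linarith
  · have h1 := G.P_le x
    have h2 := G.P_le (x + z)
    have h3 := G.P_le (x - z)
    nlinarith

/-- unified bound `|(-Δ)ˢ u| ≤ C W^{-s}` and bound by powers. -/
lemma frac_unif (hn : 1 ≤ n) {s A0 : ℝ} (hs : 0 < s) (hs1 : s < 1) (hA0 : 0 < A0) {Ω : Set (En n)}
    (G : Geo n Ω) : ∃ C > 0, ∀ a ∈ Icc 0 A0, ∀ g u, Sol n s a Ω g u → ∀ x ∈ Ω,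
      |lap n u x| ≤ C * G.W x ^ (-s) := by
  obtain ⟨D, hD, h⟩ := sd_bds hn hs hs1 hA0 G
  have hL := G.L1
  have hkn := kn_pos hn
  have hcK := cK_pos hn hs hs1
  have h22 : 0 < 2 - 2 * s := by linarith
  set C0 := (cK n s / 2) * (D * (kn n / (2 - 2*s)) + D * (kn n / (2*s - s))) * (2 * G.L) ^ s with hC0
  have h2s : 0 < 2 * s - s := by linarith
  refine ⟨A0 * C0 + G.L, by positivity, ?_⟩
  intro a ha g u S x hx
  set w := G.W x with hw
  have hw0 : 0 < w := (G.pos_iff x).1 hx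
  have hwL : w ≤ G.L := (le_abs_self _).trans (G.bd x)
  set τ := w / (2 * G.L) with hτ
  have hτ0 : 0 < τ := by positivity
  have hτ1 : τ ≤ 1 := by rw [hτ, div_le_one (by positivity)]; linarith
  have hb := h a ha g u S x hx
  have h1 := frac_two (n := n) (u := u) (x := x) (a := 2) (b := s) (B := D / τ) (D := D) hn hs hs1 hτ0 (by positivity) hD.le h22 h2s
    (fun z hz => by rw [rpow_two]; exact (hb z).1 hz) (fun z _ => by
      obtain ⟨_, h2, h3⟩ := hb z
      rcases le_total ‖z‖ 1 with h | h
      · have : ‖z‖ ≤ ‖z‖ ^ s := by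
          have := rpow_le_rpow_of_exponent_ge' (norm_nonneg z) h hs.le hs1.le
          simpa using this
        exact h2.trans (by gcongr)
      · exact h3.trans (le_mul_of_one_le_right hD.le (one_le_rpow h hs.le)))
  have e1 : D / τ * (kn n / (2 - 2*s) * τ ^ (2 - 2*s)) ≤ D * (kn n / (2 - 2*s)) * τ ^ (-s) := by
    have : τ ^ (2 - 2*s) = τ ^ (1 - 2*s) * τ := by rw [← rpow_add_one hτ0.ne']; congr 1; ring
    rw [this]
    calc _ = D * (kn n / (2 - 2*s)) * τ ^ (1 - 2*s) := by field_simp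
      _ ≤ _ := by
        have : τ ^ (1 - 2*s) ≤ τ ^ (-s) := rpow_le_rpow_of_exponent_ge hτ0 hτ1 (by linarith)
        gcongr
  have e2 : τ ^ (-(2*s - s)) = τ ^ (-s) := by congr 1; ring
  have e3 : τ ^ (-s) = (2 * G.L) ^ s * w ^ (-s) := by
    rw [hτ, div_rpow hw0.le (by positivity), rpow_neg (x := 2 * G.L) (by positivity)]
    field_simp
  have h2 : |fracLap n s u x| ≤ C0 * w ^ (-s) := by
    refine h1.trans ?_
    rw [e2]
    calc _ ≤ (cK n s / 2) * (D * (kn n / (2 - 2*s)) * τ ^ (-s) + D * (kn n / (2*s - s) * τ ^ (-s))) := by gcongr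
      _ = _ := by rw [e3, hC0]; ring
  have h3 : 1 ≤ G.L * w ^ (-s) := by
    have : w ^ s ≤ G.L := by
      calc w ^ s ≤ G.L ^ s := rpow_le_rpow hw0.le hwL hs.le
        _ ≤ G.L ^ (1:ℝ) := rpow_le_rpow_of_exponent_le hL hs1.le
        _ = G.L := rpow_one _
    rw [rpow_neg hw0.le, ← div_eq_mul_inv, le_div_iff₀ (by positivity)]; linarith
  rw [S.eq x hx]
  have h4 := S.gb x hx
  calc _ ≤ |a * fracLap n s u x| + |g x| := abs_sub _ _
    _ ≤ A0 * (C0 * w ^ (-s)) + G.L * w ^ (-s) := by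
      refine add_le_add ?_ (h4.trans h3)
      rw [abs_mul, abs_of_nonneg ha.1]
      exact mul_le_mul ha.2 h2 (abs_nonneg _) hA0.le
    _ = _ := by ring

end

section

open MeasureTheory Real Set Metric Bornology Filter
open scoped RealInnerProductSpace ENNReal NNReal Pointwise

variable {n : ℕ}

lemma frac_final (hn : 1 ≤ n) {s A0 : ℝ} (hs : 0 < s) (hs1 : s < 1) (hA0 : 0 < A0) {Ω : Set (En n)}
    (G : Geo n Ω) : ∃ C > 0, ∀ a ∈ Icc 0 A0, ∀ g u, Sol n s a Ω g u → ∀ x ∈ Ω,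
      |fracLap n s u x| ≤ C * (1 + (if s < 1/2 then 1 else 0)
          + (if s = 1/2 then |Real.log (infDist x (frontier Ω))| else 0)
          + (if 1/2 < s then infDist x (frontier Ω) ^ (1 - 2*s) else 0)) := by
  obtain ⟨D, hD, h⟩ := sd_bds hn hs hs1 hA0 G
  have hL := G.L1
  have hCd := G.Cd0
  have hkn := kn_pos hn
  have hcK := cK_pos hn hs hs1
  have tau : ∀ x ∈ Ω, 0 < G.W x / (2 * G.L) ∧ G.W x / (2 * G.L) ≤ 1 ∧ G.W x / (2 * G.L) ≤ infDist x (frontier Ω)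
      ∧ infDist x (frontier Ω) ≤ 2 * G.L * G.Cd * (G.W x / (2 * G.L)) := by
    intro x hx
    have hw0 : 0 < G.W x := (G.pos_iff x).1 hx
    have hwL : G.W x ≤ G.L := (le_abs_self _).trans (G.bd x)
    have h1 := G.W_le hx
    have h2 := G.dist_le hx
    have h3 : 0 ≤ infDist x (frontier Ω) := infDist_nonneg
    refine ⟨by positivity, ?_, ?_, ?_⟩
    · rw [div_le_one (by positivity)]; linarith
    · rw [div_le_iff₀ (by positivity)]; nlinarith
    · refine h2.trans (le_of_eq ?_); field_simp
  rcases lt_trichotomy s (1/2) with hc | hc | hc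
  · have p1 : 0 < 1 - 2*s := by linarith
    refine ⟨(cK n s / 2) * (D * (kn n / (1 - 2*s)) + D * (kn n / (2*s))), by positivity, ?_⟩
    intro a ha g u S x hx
    have hb := h a ha g u S x hx
    have h1 := frac_two (n := n) (u := u) (x := x) (a := 1) (b := 0) (B := D) (D := D) hn hs hs1 one_pos hD.le hD.le
      p1 (by linarith) (fun z _ => by rw [rpow_one]; exact (hb z).2.1)
      (fun z _ => by rw [rpow_zero, mul_one]; exact (hb z).2.2)
    rw [one_rpow, one_rpow, sub_zero, mul_one, mul_one] at h1
    refine h1.trans (le_mul_of_one_le_right (by positivity) ?_)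
    rw [if_pos hc, if_neg hc.ne, if_neg hc.le.not_gt]
    norm_num
  · subst hc
    refine ⟨(cK n (1/2) / 2) * (D * kn n) * (2 + |log (2 * G.L * G.Cd)|), by positivity, ?_⟩
    intro a ha g u S x hx
    have hb := h a ha g u S x hx
    obtain ⟨t0, t1, t2, t3⟩ := tau x hx
    set τ := G.W x / (2 * G.L) with hτ
    set d := infDist x (frontier Ω) with hd
    have hd0 : 0 < d := by linarith
    have h1 := frac_three (n := n) (u := u) (x := x) (B := D / τ) (D := D) hn t0 t1 (by positivity) hD.le
      (fun z hz => (hb z).1 hz) (fun z => (hb z).2.1) (fun z => (hb z).2.2)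
    rw [if_neg (lt_irrefl _), if_pos rfl, if_neg (lt_irrefl _), add_zero, add_zero]
    rw [rpow_one, one_rpow, div_one, mul_one] at h1
    have hlog : |log τ| ≤ |log d| + |log (2 * G.L * G.Cd)| := by
      have l1 := log_le_log t0 t2
      have l2 := log_le_log hd0 t3
      rw [log_mul (by positivity) t0.ne'] at l2
      have a1 := neg_abs_le (log d)
      have a2 := le_abs_self (log (2 * G.L * G.Cd))
      have a3 := le_abs_self (log d)
      have a4 := abs_nonneg (log (2 * G.L * G.Cd))
      rw [abs_le]
      constructor <;> linarith
    have e1 : D / τ * (kn n * τ) = D * kn n := by field_simp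
    rw [e1] at h1
    refine h1.trans ?_
    have hl0 := abs_nonneg (log d)
    have hm0 := abs_nonneg (log (2 * G.L * G.Cd))
    have e2 : D * kn n + D * (kn n * |log τ|) + D * kn n ≤ D * kn n * ((2 + |log (2 * G.L * G.Cd)|) * (1 + |log d|)) := by
      calc _ = D * kn n * (2 + |log τ|) := by ring
        _ ≤ _ := by
          refine mul_le_mul_of_nonneg_left ?_ (by positivity)
          nlinarith
    calc _ ≤ cK n (1/2) / 2 * (D * kn n * ((2 + |log (2 * G.L * G.Cd)|) * (1 + |log d|))) := by
          refine mul_le_mul_of_nonneg_left e2 (by positivity)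
      _ = _ := by ring
  · have p1 : 0 < 2*s - 1 := by linarith
    have p2 : 0 < 2 - 2*s := by linarith
    refine ⟨(cK n s / 2) * (D * (kn n / (2 - 2*s)) + D * (kn n / (2*s - 1))) * (2 * G.L * G.Cd) ^ (2*s - 1), by positivity, ?_⟩
    intro a ha g u S x hx
    have hb := h a ha g u S x hx
    obtain ⟨t0, t1, t2, t3⟩ := tau x hx
    set τ := G.W x / (2 * G.L) with hτ
    set d := infDist x (frontier Ω) with hd
    have hd0 : 0 < d := by linarith
    have h1 := frac_two (n := n) (u := u) (x := x) (a := 2) (b := 1) (B := D / τ) (D := D) hn hs hs1 t0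
      (by positivity) hD.le p2 p1 (fun z hz => by rw [rpow_two]; exact (hb z).1 hz)
      (fun z _ => by rw [rpow_one]; exact (hb z).2.1)
    rw [if_neg hc.le.not_gt, if_neg hc.ne', if_pos hc, add_zero, add_zero]
    have e1 : D / τ * (kn n / (2 - 2*s) * τ ^ (2 - 2*s)) = D * (kn n / (2 - 2*s)) * τ ^ (1 - 2*s) := by
      have : τ ^ (2 - 2*s) = τ ^ (1 - 2*s) * τ := by rw [← rpow_add_one t0.ne']; congr 1; ring
      rw [this]; field_simp
    have e2 : τ ^ (-(2*s - 1)) = τ ^ (1 - 2*s) := by congr 1; ring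
    have e3 : τ ^ (1 - 2*s) ≤ (2 * G.L * G.Cd) ^ (2*s - 1) * d ^ (1 - 2*s) := by
      have q : d / (2 * G.L * G.Cd) ≤ τ := by
        rw [div_le_iff₀ (by positivity)]; linarith
      have := rpow_le_rpow_of_nonpos (by positivity) q (by linarith : 1 - 2*s ≤ 0)
      refine this.trans (le_of_eq ?_)
      have e4 : (2 * G.L * G.Cd) ^ (2*s - 1) = ((2 * G.L * G.Cd) ^ (1 - 2*s))⁻¹ := by
        rw [← rpow_neg (by positivity)]; congr 1; ring
      rw [div_rpow hd0.le (by positivity), e4]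
      field_simp
    rw [e1, e2] at h1
    have hdp : 0 ≤ d ^ (1 - 2*s) := by positivity
    calc _ ≤ _ := h1
      _ = cK n s / 2 * (D * (kn n / (2 - 2*s)) + D * (kn n / (2*s - 1))) * τ ^ (1 - 2*s) := by ring
      _ ≤ cK n s / 2 * (D * (kn n / (2 - 2*s)) + D * (kn n / (2*s - 1))) * ((2 * G.L * G.Cd) ^ (2*s - 1) * d ^ (1 - 2*s)) := by gcongr
      _ ≤ cK n s / 2 * (D * (kn n / (2 - 2*s)) + D * (kn n / (2*s - 1))) * ((2 * G.L * G.Cd) ^ (2*s - 1) * (1 + d ^ (1 - 2*s))) := by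
        gcongr; linarith
      _ = _ := by ring

end

section

open MeasureTheory Real Set Metric Bornology Filter
open scoped RealInnerProductSpace ENNReal NNReal Pointwise

variable {n : ℕ}

lemma Geo.seg {Ω : Set (En n)} (G : Geo n Ω) (p x : En n) {t : ℝ} (h0 : 0 ≤ t) (h1 : t ≤ 1) :
    t * G.W x + (1 - t) * G.W p - G.L * ‖x - p‖ ^ 2 ≤ G.W (p + t • (x - p)) := by
  set y := p + t • (x - p) with hy
  have e1 : x - y = (1 - t) • (x - p) := by rw [hy, sub_smul, one_smul]; abel
  have e2 : p - y = -(t • (x - p)) := by rw [hy]; abel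
  have a1 := (abs_le.1 (G.tay y x)).2
  have a2 := (abs_le.1 (G.tay y p)).2
  rw [e1, map_smul, norm_smul, Real.norm_eq_abs, abs_of_nonneg (by linarith : 0 ≤ 1 - t), smul_eq_mul] at a1
  rw [e2, map_neg, map_smul, norm_neg, norm_smul, Real.norm_eq_abs, abs_of_nonneg h0, smul_eq_mul] at a2
  have b1 := mul_le_mul_of_nonneg_left a1 h0
  have b2 := mul_le_mul_of_nonneg_left a2 (by linarith : 0 ≤ 1 - t)
  have hL := G.L0
  have hq : 0 ≤ G.L * ‖x - p‖ ^ 2 := by positivity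
  have h3 : t * (1 - t) ^ 2 + (1 - t) * t ^ 2 ≤ 1 := by nlinarith
  have h4 := mul_le_mul_of_nonneg_right h3 hq
  nlinarith

lemma harnack_chain {Ω : Set (En n)} (G : Geo n Ω) (β : ℝ) (hβ : 0 ≤ β) {κ : ℝ} (hκ : 0 < κ) (hκ1 : κ ≤ 1) :
    ∃ c > 0, ∃ C > 0, ∀ r, 0 < r → G.L * r ≤ κ / 2 → ∀ z v F, ContDiffOn ℝ 2 v Ω → 0 ≤ F →
      (∀ y ∈ Ω, y ∈ ball z r → 0 ≤ v y) → (∀ y ∈ Ω, y ∈ ball z r → |lap n v y| ≤ F * G.W y ^ (-β)) →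
      ∀ p ∈ closedBall z (r/2), ∀ x ∈ closedBall z (r/2), κ * r ≤ G.W p → κ * r ≤ G.W x →
      c * v p - C * F * r ^ (2 - β) ≤ v x := by
  obtain ⟨c, hc, hc1, C, hC, hst⟩ := harnack_step n
  have hL := G.L1
  obtain ⟨N, hN⟩ := exists_nat_ge (8 * G.L / κ)
  have hN0 : 0 < (N:ℝ) := lt_of_lt_of_le (by positivity) hN
  set E := C * ((κ / (8 * G.L)) ^ 2 * (κ / 4) ^ (-β)) with hE
  have hE0 : 0 < E := by positivity
  refine ⟨c ^ N, by positivity, N * E, by positivity, ?_⟩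
  intro r hr hLr z v F hv hF hv0 hlap p hp x hx hWp hWx
  set ρ := κ * r / (8 * G.L) with hρ
  have hρ0 : 0 < ρ := by positivity
  have hρr : 2 * ρ ≤ r / 4 := by
    rw [hρ, ← mul_div_assoc, div_le_iff₀ (by positivity)]
    nlinarith
  have hxp : ‖x - p‖ ≤ r := by
    rw [mem_closedBall] at hp hx
    rw [← dist_eq_norm]
    linarith [dist_triangle_right x p z]
  have hseg : ∀ t : ℝ, 0 ≤ t → t ≤ 1 → κ * r / 2 ≤ G.W (p + t • (x - p)) ∧ p + t • (x - p) ∈ closedBall z (r/2) := by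
    intro t h0 h1
    constructor
    · have h2 := G.seg p x h0 h1
      have h3 : ‖x - p‖ ^ 2 ≤ r ^ 2 := by gcongr
      have h4 : G.L * ‖x - p‖ ^ 2 ≤ κ * r / 2 := by
        calc _ ≤ G.L * r ^ 2 := by gcongr
          _ = (G.L * r) * r := by ring
          _ ≤ κ / 2 * r := by gcongr
          _ = _ := by ring
      nlinarith
    · exact (convex_closedBall z (r/2)).add_smul_sub_mem hp hx ⟨h0, h1⟩
  have hstep : ∀ y y' : En n, y' ∈ closedBall z (r/2) → κ * r / 2 ≤ G.W y' → ‖y - y'‖ ≤ ρ →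
      c * v y - E * F * r ^ (2 - β) ≤ v y' := by
    intro y y' hy' hW hyy
    have key : ∀ q ∈ closedBall y' (2 * ρ), q ∈ Ω ∧ q ∈ ball z r ∧ κ * r / 4 ≤ G.W q := by
      intro q hq
      rw [mem_closedBall] at hq hy'
      have h1 := (abs_le.1 (G.lip y' q)).1
      rw [← dist_eq_norm] at h1
      have h2 : G.L * dist q y' ≤ κ * r / 4 := by
        calc _ ≤ G.L * (2 * ρ) := by gcongr
          _ = _ := by rw [hρ]; field_simp; norm_num
      have h3 : κ * r / 4 ≤ G.W q := by linarith
      refine ⟨(G.pos_iff q).2 (lt_of_lt_of_le (by positivity) h3), ?_, h3⟩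
      rw [mem_ball]
      linarith [dist_triangle q y' z]
    have h1 := hst Ω G.isOpen v hv y y' ρ (F * (κ * r / 4) ^ (-β)) hρ0 (fun q hq => (key q hq).1) hyy
      (fun q hq => hv0 q (key q hq).1 (key q hq).2.1) (fun q hq => by
        obtain ⟨k1, k2, k3⟩ := key q hq
        refine (hlap q k1 k2).trans ?_
        refine mul_le_mul_of_nonneg_left ?_ hF
        exact rpow_le_rpow_of_nonpos (by positivity) k3 (by linarith))
    have e : C * (ρ ^ 2 * (F * (κ * r / 4) ^ (-β))) = E * F * r ^ (2 - β) := by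
      have e1 : κ * r / 4 = (κ / 4) * r := by ring
      have e2 : r ^ (2 - β) = r ^ 2 * r ^ (-β) := by rw [sub_eq_add_neg, rpow_add hr, rpow_two]
      rw [e1, mul_rpow (by positivity) hr.le, e2, hE, hρ]
      ring
    linarith
  have hEF : 0 ≤ E * F * r ^ (2 - β) := by positivity
  have hind : ∀ j : ℕ, j ≤ N → c ^ j * v p - j * (E * F * r ^ (2 - β)) ≤ v (p + ((j:ℝ) / N) • (x - p)) := by
    intro j
    induction j with
    | zero => intro _; simp
    | succ j ih =>
      intro hj
      have hjN : ((j:ℝ) + 1) / N ≤ 1 := by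
        rw [div_le_one hN0]; exact_mod_cast hj
      obtain ⟨q1, q2⟩ := hseg (((j:ℝ) + 1) / N) (by positivity) hjN
      have h1 := hstep (p + ((j:ℝ) / N) • (x - p)) _ q2 q1 (by
        have : p + ((j:ℝ) / N) • (x - p) - (p + (((j:ℝ) + 1) / N) • (x - p)) = -((1 / (N:ℝ)) • (x - p)) := by
          rw [add_div, add_smul]; abel
        rw [this, norm_neg, norm_smul, Real.norm_eq_abs, abs_of_nonneg (by positivity)]
        calc 1 / (N:ℝ) * ‖x - p‖ ≤ 1 / (N:ℝ) * r := by gcongr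
          _ ≤ ρ := by
            rw [hρ, one_div_mul_eq_div, div_le_iff₀ hN0]
            rw [div_le_iff₀ hκ] at hN
            rw [div_mul_eq_mul_div, le_div_iff₀ (by positivity)]
            nlinarith)
      have h2 := ih (by omega)
      have h3 := mul_le_mul_of_nonneg_left h2 hc.le
      push_cast
      have h4 : c * (j * (E * F * r ^ (2 - β))) ≤ j * (E * F * r ^ (2 - β)) :=
        mul_le_of_le_one_left (by positivity) hc1
      rw [pow_succ]
      nlinarith
  have h1 := hind N le_rfl
  rw [div_self hN0.ne', one_smul, add_sub_cancel] at h1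
  linarith

end

section

open MeasureTheory Real Set Metric Bornology Filter
open scoped RealInnerProductSpace ENNReal NNReal Pointwise

variable {n : ℕ}

set_option maxHeartbeats 2000000 in
/-- comparison in the boundary layer -/
lemma layer {Ω : Set (En n)} (G : Geo n Ω) {β : ℝ} (hβ : 0 < β) (hβ1 : β < 1) {K κ r τ σ F : ℝ}
    (hK : K = (n + 1) / G.c ^ 2) (hκ : 0 < κ) (hκK : κ * (16 * (1 + K)) ≤ 1) (hr : 0 < r)
    (hr1 : r ≤ 1) (hrκ : r ≤ G.κ) (hr2 : r * (n * G.L * (1 + 2 * K)) ≤ 1)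
    (hr3 : r * (3 * n * G.L) ≤ (1 - β) * G.c ^ 2 / 2) (hτ : 0 < τ) (hF : 0 ≤ F)
    (hσ : σ = 2 * F / ((1 - β) * G.c ^ 2)) {v : En n → ℝ} (hvc : Continuous v) (hv : ContDiffOn ℝ 2 v Ω)
    (hfr : ∀ y ∈ frontier Ω, v y = 0) {x0 : En n} (hx0 : x0 ∈ Ω) (hx0W : G.W x0 ≤ κ * r)
    (h0 : ∀ y ∈ Ω, y ∈ closedBall x0 (r/4) → 0 ≤ v y)
    (hl : ∀ y ∈ Ω, y ∈ closedBall x0 (r/4) → |lap n v y| ≤ F * G.W y ^ (-β))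
    (htop : ∀ y ∈ Ω, y ∈ closedBall x0 (r/4) → G.W y = κ * r → τ * r ≤ v y) :
    (τ - σ * r ^ (1 - β)) * G.W x0 ≤ v x0 := by
  have hc := G.c0
  have hL := G.L1
  have h1β : 0 < 1 - β := by linarith
  have hK0 : 0 < K := by rw [hK]; positivity
  have hσ0 : 0 ≤ σ := by rw [hσ]; positivity
  have hκ1 : κ ≤ 1 := by nlinarith
  have hκr : κ * r ≤ r := mul_le_of_le_one_left hr.le hκ1
  set φ : ℝ → ℝ := fun t => τ * (t + K / r * t ^ 2) - σ * (r ^ (1 - β) * t - t ^ (2 - β)) with hφ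
  set φ1 : ℝ → ℝ := fun t => τ * (1 + K / r * (2 * t)) - σ * (r ^ (1 - β) - (2 - β) * t ^ (1 - β)) with hφ1
  have hS : ∀ t, 0 ≤ t → t ≤ r → 0 ≤ r ^ (1 - β) * t - t ^ (2 - β) := by
    intro t ht htr
    rcases ht.eq_or_lt with h | h
    · rw [← h, zero_rpow (by linarith)]; simp
    have e : t ^ (2 - β) = t ^ (1 - β) * t := by rw [← rpow_add_one h.ne']; congr 1; ring
    have : t ^ (1 - β) ≤ r ^ (1 - β) := rpow_le_rpow ht htr h1β.le
    rw [e]; nlinarith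
  have hφle : ∀ t, 0 ≤ t → t ≤ κ * r → φ t ≤ τ * (r / 16) := by
    intro t ht htr
    have h1 := mul_nonneg hσ0 (hS t ht (htr.trans hκr))
    have h2 : t + K / r * t ^ 2 ≤ r / 16 := by
      have : K / r * t ^ 2 ≤ K * (κ * r) := by
        rw [div_mul_eq_mul_div, div_le_iff₀ hr]
        have : t ^ 2 ≤ (κ * r) * r := by rw [pow_two]; exact mul_le_mul htr (htr.trans hκr) ht (by positivity)
        calc K * t ^ 2 ≤ K * ((κ * r) * r) := by gcongr
          _ = _ := by ring
      have : κ * r * (16 * (1 + K)) ≤ r := by nlinarith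
      nlinarith
    have h3 := mul_le_mul_of_nonneg_left h2 hτ.le
    simp only [hφ]
    linarith
  set f : En n → ℝ := fun y => φ (G.W y) - τ / r * ‖y - x0‖ ^ 2 - v y with hf
  have hfc : Continuous f := by
    have hW := G.smooth.continuous
    have h2 : Continuous fun y => G.W y ^ (2 - β) := hW.rpow_const fun _ => Or.inr (by linarith)
    simp only [hf, hφ]
    fun_prop
  set Q := closure Ω ∩ {y | G.W y ≤ κ * r} ∩ closedBall x0 (r/4) with hQ
  have hQc : IsCompact Q := by
    refine (isCompact_closedBall x0 (r/4)).inter_left ?_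
    exact isClosed_closure.inter (isClosed_le G.smooth.continuous continuous_const)
  have hx0Q : x0 ∈ Q := ⟨⟨subset_closure hx0, hx0W⟩, mem_closedBall_self (by positivity)⟩
  obtain ⟨x1, hx1, hmax⟩ := hQc.exists_isMaxOn ⟨x0, hx0Q⟩ hfc.continuousOn
  have hneg : f x1 ≤ 0 := by
    by_contra hcon
    push Not at hcon
    obtain ⟨⟨hx1c, hx1W⟩, hx1b⟩ := hx1
    change G.W x1 ≤ κ * r at hx1W
    have hq : 0 ≤ τ / r * ‖x1 - x0‖ ^ 2 := by positivity
    by_cases hx1Ω : x1 ∈ Ω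
    swap
    · have hx1f : x1 ∈ frontier Ω := by
        rw [G.isOpen.frontier_eq]; exact ⟨hx1c, hx1Ω⟩
      have e1 := G.front x1 hx1f
      have e2 := hfr x1 hx1f
      have e3 : φ 0 = 0 := by simp [hφ, zero_rpow (by linarith : 2 - β ≠ 0)]
      simp only [hf] at hcon
      rw [e1, e2, e3] at hcon
      linarith
    have ht0 : 0 < G.W x1 := (G.pos_iff x1).1 hx1Ω
    have hφ' := hφle _ ht0.le hx1W
    rcases hx1W.eq_or_lt with hW | hW
    · have := htop x1 hx1Ω hx1b hW
      simp only [hf] at hcon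
      nlinarith
    have hd1 : ‖x1 - x0‖ ≤ r / 4 := by rwa [mem_closedBall, dist_eq_norm] at hx1b
    rcases hd1.eq_or_lt with hd | hd
    · have := h0 x1 hx1Ω hx1b
      simp only [hf] at hcon
      rw [hd] at hcon
      have e : τ / r * (r / 4) ^ 2 = τ * (r / 16) := by field_simp; norm_num
      rw [e] at hcon
      linarith
    -- interior
    have hloc : IsLocalMax f x1 := by
      have n1 : ∀ᶠ y in nhds x1, y ∈ Ω := G.isOpen.mem_nhds hx1Ω
      have n2 : ∀ᶠ y in nhds x1, G.W y < κ * r :=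
        G.smooth.continuous.continuousAt.eventually_lt continuousAt_const hW
      have n3 : ∀ᶠ y in nhds x1, ‖y - x0‖ < r / 4 :=
        (by fun_prop : Continuous fun y : En n => ‖y - x0‖).continuousAt.eventually_lt continuousAt_const hd
      filter_upwards [n1, n2, n3] with y y1 y2 y3
      exact hmax ⟨⟨subset_closure y1, y2.le⟩, by rw [mem_closedBall, dist_eq_norm]; exact y3.le⟩
    have hWcd : ContDiffAt ℝ 2 G.W x1 := G.smooth.contDiffAt
    have hvcd : ContDiffAt ℝ 2 v x1 := hv.contDiffAt (G.isOpen.mem_nhds hx1Ω)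
    have hd1 : ∀ t : ℝ, 0 < t → HasDerivAt φ (φ1 t) t := by
      intro t ht
      have a1 : HasDerivAt (fun t : ℝ => t ^ (2 - β)) ((2 - β) * t ^ (2 - β - 1)) t :=
        hasDerivAt_rpow_const (Or.inl ht.ne')
      have a2 : HasDerivAt (fun t : ℝ => t ^ 2) (2 * t) t := by simpa using hasDerivAt_pow 2 t
      have e : 2 - β - 1 = 1 - β := by ring
      rw [e] at a1
      have a3 : HasDerivAt (fun t : ℝ => r ^ (1 - β) * t) (r ^ (1 - β)) t := by
        simpa using (hasDerivAt_id t).const_mul (r ^ (1 - β))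
      exact (((hasDerivAt_id t).add (a2.const_mul (K / r))).const_mul τ).sub ((a3.sub a1).const_mul σ)
    have hd2 : HasDerivAt φ1 (τ * (K / r * 2) + σ * ((2 - β) * ((1 - β) * G.W x1 ^ (-β)))) (G.W x1) := by
      set t := G.W x1
      have a1 : HasDerivAt (fun t : ℝ => t ^ (1 - β)) ((1 - β) * t ^ (1 - β - 1)) t :=
        hasDerivAt_rpow_const (Or.inl ht0.ne')
      have e : 1 - β - 1 = -β := by ring
      rw [e] at a1
      have a2 : HasDerivAt (fun t : ℝ => 2 * t) 2 t := by simpa using (hasDerivAt_id t).const_mul (2:ℝ)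
      have h := (((a2.const_mul (K / r)).const_add 1).const_mul τ).sub
        (((a1.const_mul (2 - β)).const_sub (r ^ (1 - β))).const_mul σ)
      have e' : τ * (K / r * 2) + σ * ((2 - β) * ((1 - β) * t ^ (-β)))
        = τ * (K / r * 2) - σ * (-((2 - β) * ((1 - β) * t ^ (-β)))) := by ring
      rw [e']
      exact h
    have hφcd : ContDiffAt ℝ 2 (fun y => φ (G.W y)) x1 := by
      have : ContDiffAt ℝ 2 (fun y => G.W y ^ (2 - β)) x1 := hWcd.rpow_const_of_ne ht0.ne'
      exact (contDiffAt_const.mul (hWcd.add (contDiffAt_const.mul (hWcd.pow 2)))).sub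
        (contDiffAt_const.mul ((contDiffAt_const.mul hWcd).sub this))
    have hlapφ := lap_comp (f := φ) (f1 := φ1) hWcd ((lt_mem_nhds ht0).mono hd1) hd2
    have hqcd : ContDiffAt ℝ 2 (fun y : En n => τ / r * ‖y - x0‖ ^ 2) x1 := contDiffAt_const.mul (normsq_cd x0 x1)
    have hlf := lap_max ((hφcd.sub hqcd).sub hvcd) hloc
    rw [lap_sub (hφcd.sub hqcd) hvcd, lap_sub hφcd hqcd, lap_const_mul (normsq_cd x0 x1) _, lap_normsq, hlapφ] at hlf
    set t := G.W x1 with htdef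
    obtain ⟨e, he, hce⟩ := G.nor x1 hx1c (by linarith)
    have hgrad := grad_sq_ge _ he G.c0.le hce
    have hlW := abs_le.1 (lap_abs_le hWcd (G.he x1))
    have hlv := (abs_le.1 (hl x1 hx1Ω hx1b)).2
    set gs := ∑ i, (fderiv ℝ G.W x1 (bv n i)) ^ 2 with hgs
    set T := t ^ (-β) with hT
    have hT0 : 0 < T := by positivity
    have htr : t ≤ r := hW.le.trans hκr
    have r1 : r ^ (1 - β) ≤ r * T := by
      have : r ^ (1 - β) = r * r ^ (-β) := by rw [sub_eq_add_neg, rpow_add hr, rpow_one]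
      rw [this]
      have : r ^ (-β) ≤ T := rpow_le_rpow_of_nonpos ht0 htr (by linarith)
      gcongr
    have r2 : t ^ (1 - β) ≤ r * T := by
      have : t ^ (1 - β) = t * T := by rw [sub_eq_add_neg, rpow_add ht0, rpow_one]
      rw [this]; gcongr
    have r10 : 0 ≤ r ^ (1 - β) := by positivity
    have r20 : 0 ≤ t ^ (1 - β) := by positivity
    have hφ1b : |φ1 t| ≤ τ * (1 + 2 * K) + σ * (3 * (r * T)) := by
      have q1 : K / r * (2 * t) ≤ 2 * K := by
        rw [div_mul_eq_mul_div, div_le_iff₀ hr]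
        have := mul_le_mul_of_nonneg_left htr hK0.le
        linarith
      have q0 : 0 ≤ K / r * (2 * t) := by positivity
      have q2 : |r ^ (1 - β) - (2 - β) * t ^ (1 - β)| ≤ 3 * (r * T) := by
        have w1 : (2 - β) * t ^ (1 - β) ≤ 2 * t ^ (1 - β) := mul_le_mul_of_nonneg_right (by linarith) r20
        have w2 : 0 ≤ (2 - β) * t ^ (1 - β) := mul_nonneg (by linarith) r20
        rw [abs_le]; constructor <;> linarith
      simp only [hφ1]
      refine (abs_sub _ _).trans ?_
      rw [abs_mul, abs_mul, abs_of_pos hτ, abs_of_nonneg hσ0, abs_of_nonneg (by linarith : 0 ≤ 1 + K / r * (2 * t))]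
      gcongr
    have hprod : -((τ * (1 + 2 * K) + σ * (3 * (r * T))) * (n * G.L)) ≤ φ1 t * lap n G.W x1 := by
      have : |φ1 t * lap n G.W x1| ≤ (τ * (1 + 2 * K) + σ * (3 * (r * T))) * (n * G.L) := by
        rw [abs_mul]
        exact mul_le_mul hφ1b (abs_le.2 hlW) (abs_nonneg _) (by positivity)
      exact (abs_le.1 this).1
    have hmain : (τ * (K / r * 2) + σ * ((2 - β) * ((1 - β) * T))) * G.c ^ 2
        ≤ (τ * (K / r * 2) + σ * ((2 - β) * ((1 - β) * T))) * gs := by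
      have h2β : 0 ≤ 2 - β := by linarith
      refine mul_le_mul_of_nonneg_left hgrad (by positivity)
    have p1 : τ * (K / r * 2) * G.c ^ 2 = τ / r * (2 * n + 2) := by
      rw [hK]; field_simp
    have p2 : τ * (1 + 2 * K) * (n * G.L) ≤ τ / r := by
      rw [le_div_iff₀ hr]
      have := mul_le_mul_of_nonneg_left hr2 hτ.le
      linarith
    have p3 : σ * (3 * (r * T)) * (n * G.L) ≤ σ * T * ((1 - β) * G.c ^ 2 / 2) := by
      have := mul_le_mul_of_nonneg_left hr3 (by positivity : 0 ≤ σ * T)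
      linarith
    have p4 : σ * T * ((1 - β) * G.c ^ 2) = 2 * F * T := by
      rw [hσ]; field_simp
    have p5 : σ * ((2 - β) * ((1 - β) * T)) * G.c ^ 2 ≥ σ * T * ((1 - β) * G.c ^ 2) := by
      have : 0 ≤ σ * T * ((1 - β) * G.c ^ 2) := by positivity
      have := mul_nonneg this h1β.le
      linarith
    have p6 : 0 < τ / r := by positivity
    linarith
  have h2 : f x0 ≤ 0 := (hmax hx0Q).trans hneg
  simp only [hf, hφ] at h2
  rw [sub_self, norm_zero] at h2
  have ht0 : 0 < G.W x0 := (G.pos_iff x0).1 hx0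
  have : 0 ≤ τ * (K / r * G.W x0 ^ 2) := by positivity
  have : 0 ≤ σ * G.W x0 ^ (2 - β) := by positivity
  nlinarith

end

section

open MeasureTheory Real Set Metric Bornology Filter
open scoped RealInnerProductSpace ENNReal NNReal Pointwise

variable {n : ℕ}

lemma small_ex {X δ : ℝ} (hX : 0 ≤ X) (hδ : 0 < δ) : ∃ r0 > 0, ∀ r, 0 < r → r ≤ r0 → r * X ≤ δ := by
  refine ⟨δ / (X + 1), by positivity, fun r hr h => ?_⟩
  rw [le_div_iff₀ (by positivity)] at h
  linarith

/-- growth lemma -/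
lemma growth {Ω : Set (En n)} (G : Geo n Ω) {β : ℝ} (hβ : 0 < β) (hβ1 : β < 1) :
    ∃ r0 > 0, r0 ≤ 1 ∧ ∃ κ > 0, ∃ c2 > 0, ∃ C2 > 0, ∀ z ∈ frontier Ω, ∀ r, 0 < r → r ≤ r0 →
      ∃ p ∈ Ω, p ∈ ball z r ∧ κ * r ≤ G.W p ∧ ∀ (v : En n → ℝ) (F : ℝ), Continuous v →
      ContDiffOn ℝ 2 v Ω → 0 ≤ F → (∀ y ∈ Ω, y ∈ ball z r → 0 ≤ v y) →
      (∀ y ∈ frontier Ω, v y = 0) → (∀ y ∈ Ω, y ∈ ball z r → |lap n v y| ≤ F * G.W y ^ (-β)) →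
      ∀ x ∈ Ω, x ∈ ball z (r / 8) → (c2 * (v p / r) - C2 * F * r ^ (1 - β)) * G.W x ≤ v x := by
  have hc := G.c0
  have hL := G.L1
  have hL0 : 0 < G.L := by linarith
  have h1β : 0 < 1 - β := by linarith
  obtain ⟨K, hK⟩ : ∃ K : ℝ, K = (n + 1) / G.c ^ 2 := ⟨_, rfl⟩
  have hK0 : 0 < K := by rw [hK]; positivity
  obtain ⟨κ, hκ, hκ1, hκ2⟩ : ∃ κ : ℝ, 0 < κ ∧ κ * (16 * (1 + K)) ≤ 1 ∧ κ ≤ G.c / 8 := by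
    refine ⟨min (1 / (16 * (1 + K))) (G.c / 8), by positivity, ?_, min_le_right _ _⟩
    rw [← le_div_iff₀ (by positivity)]; exact min_le_left _ _
  have hκ3 : κ ≤ 1 := by nlinarith
  obtain ⟨c', hc', C', hC', hch⟩ := harnack_chain G β hβ.le hκ hκ3
  obtain ⟨r1, hr1, H1⟩ := small_ex (X := n * G.L * (1 + 2 * K)) (δ := 1) (by positivity) one_pos
  obtain ⟨r2, hr2, H2⟩ := small_ex (X := 3 * n * G.L) (δ := (1 - β) * G.c ^ 2 / 2) (by positivity) (by positivity)
  obtain ⟨r3, hr3, H3⟩ := small_ex (X := G.L) (δ := κ / 2) (by positivity) (by positivity)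
  obtain ⟨r4, hr4, H4⟩ := small_ex (X := G.L) (δ := 2 * G.c) (by positivity) (by positivity)
  have hκG := G.κ0
  refine ⟨min (min (min r1 r2) (min r3 r4)) (min G.κ 1), by positivity,
    (min_le_right _ _).trans (min_le_right _ _), κ, hκ, c' / G.L, by positivity,
    C' / G.L + 2 / ((1 - β) * G.c ^ 2) + C', by positivity, ?_⟩
  intro z hz r hr hr0
  simp only [le_min_iff] at hr0
  obtain ⟨⟨⟨q1, q2⟩, q3, q4⟩, q5, q6⟩ := hr0
  have H1 := H1 r hr q1
  have H2 := H2 r hr q2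
  have H3 := H3 r hr q3
  have H4 := H4 r hr q4
  have hWz := G.front z hz
  obtain ⟨e, he, hce⟩ := G.nor z (frontier_subset_closure hz) (by rw [hWz]; exact hκG)
  set p := z + (r / 4) • e with hp
  have hpz : p - z = (r / 4) • e := by simp [hp]
  have hpn : ‖p - z‖ = r / 4 := by rw [hpz, norm_smul, he, norm_of_nonneg (by positivity), mul_one]
  have hWp : κ * r ≤ G.W p := by
    have h1 := (abs_le.1 (G.tay z p)).1
    rw [hpn, hpz, hWz, map_smul, smul_eq_mul] at h1
    have h2 : r / 4 * G.c ≤ r / 4 * fderiv ℝ G.W z e := by gcongr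
    have h3 : κ * r ≤ G.c / 8 * r := by gcongr
    have h4 := mul_le_mul_of_nonneg_left H4 hr.le
    nlinarith
  have hpΩ : p ∈ Ω := (G.pos_iff p).2 (lt_of_lt_of_le (by positivity) hWp)
  refine ⟨p, hpΩ, by rw [mem_ball, dist_eq_norm, hpn]; linarith, hWp, ?_⟩
  intro v F hvc hv hF h0 hfr hl x hx hxb
  have hxz : ‖x - z‖ < r / 8 := by rwa [mem_ball, dist_eq_norm] at hxb
  have hWx : 0 < G.W x := (G.pos_iff x).1 hx
  have hsub : ∀ y ∈ closedBall x (r/4), ‖y - z‖ ≤ r / 2 := by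
    intro y hy
    rw [mem_closedBall, dist_eq_norm] at hy
    have := norm_add_le (y - x) (x - z)
    rw [sub_add_sub_cancel] at this
    linarith
  have hsub' : ∀ y ∈ closedBall x (r/4), y ∈ ball z r := by
    intro y hy
    rw [mem_ball, dist_eq_norm]; linarith [hsub y hy]
  have hxx : x ∈ ball z r := by rw [mem_ball, dist_eq_norm]; linarith
  have hvx := h0 x hx hxx
  have hch' : ∀ y, ‖y - z‖ ≤ r / 2 → κ * r ≤ G.W y → c' * v p - C' * F * r ^ (2 - β) ≤ v y := by
    intro y hy hyW
    exact hch r hr (by linarith) z v F hv hF h0 hl p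
      (by rw [mem_closedBall, dist_eq_norm]; linarith) y (by rwa [mem_closedBall, dist_eq_norm]) hWp hyW
  set ρ := r ^ (1 - β) with hρ
  have hρ0 : 0 < ρ := by positivity
  have e2 : r ^ (2 - β) = r * ρ := by
    rw [hρ, show 2 - β = 1 + (1 - β) by ring, rpow_add hr, rpow_one]
  rw [e2] at hch'
  set σ := 2 * F / ((1 - β) * G.c ^ 2) with hσ
  have hσ0 : 0 ≤ σ := by positivity
  set τ := c' * (v p / r) - C' * F * ρ with hτ
  have hτr : τ * r = c' * v p - C' * F * (r * ρ) := by rw [hτ]; field_simp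
  rw [← hτr] at hch'
  have key : τ ≤ 0 ∨ (τ / G.L - σ * ρ) * G.W x ≤ v x := by
    by_cases h : τ ≤ 0
    · exact Or.inl h
    right
    push Not at h
    have hs0 : 0 ≤ σ * ρ := by positivity
    by_cases hW : κ * r ≤ G.W x
    · have h1 := hch' x (by linarith) hW
      have h2 : G.W x ≤ G.L * r := by
        have := (abs_le.1 (G.lip z x)).2
        rw [hWz] at this
        have : G.L * ‖x - z‖ ≤ G.L * r := by gcongr; linarith
        linarith
      have h3 : τ / G.L * G.W x ≤ τ / G.L * (G.L * r) := by gcongr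
      have h4 : τ / G.L * (G.L * r) = τ * r := by field_simp
      nlinarith
    · push Not at hW
      have := layer G hβ hβ1 hK hκ hκ1 hr q6 q5 H1 H2 h hF hσ hvc hv hfr hx hW.le
        (fun y hy hyb => h0 y hy (hsub' y hyb)) (fun y hy hyb => hl y hy (hsub' y hyb))
        (fun y hy hyb hyW => hch' y (hsub y hyb) hyW.ge)
      refine le_trans ?_ this
      have : τ / G.L ≤ τ := div_le_self h.le hL
      gcongr
  have hFρ : 0 ≤ F * ρ := by positivity
  have hle : c' / G.L * (v p / r) - (C' / G.L + 2 / ((1 - β) * G.c ^ 2) + C') * F * ρ ≤ τ / G.L - σ * ρ := by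
    have e1 : τ / G.L - σ * ρ = c' / G.L * (v p / r) - (C' / G.L + 2 / ((1 - β) * G.c ^ 2)) * F * ρ := by
      rw [hτ, hσ]; field_simp; ring
    rw [e1]
    have : 0 ≤ C' * (F * ρ) := by positivity
    linarith
  rcases key with h | h
  · have h5 : τ / G.L ≤ 0 := div_nonpos_of_nonpos_of_nonneg h hL0.le
    have : c' / G.L * (v p / r) - (C' / G.L + 2 / ((1 - β) * G.c ^ 2) + C') * F * ρ ≤ 0 := by
      have : 0 ≤ σ * ρ := by positivity
      linarith
    exact (mul_nonpos_of_nonpos_of_nonneg this hWx.le).trans hvx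
  · exact (mul_le_mul_of_nonneg_right hle hWx.le).trans h

end

section

open MeasureTheory Real Set Metric Bornology Filter
open scoped RealInnerProductSpace ENNReal NNReal Pointwise

variable {n : ℕ}

set_option maxHeartbeats 1000000 in
/-- boundary regularity of the quotient `u / W` -/
lemma krylov (hn : 1 ≤ n) {s A0 : ℝ} (hs : 0 < s) (hs1 : s < 1) (hA0 : 0 < A0) {Ω : Set (En n)}
    (G : Geo n Ω) : ∃ r0 > 0, r0 ≤ 1 ∧ ∃ α > 0, α ≤ 1 - s ∧ ∃ K > 0, ∃ E > 0, ∀ a ∈ Icc 0 A0,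
      ∀ g u : En n → ℝ, Sol n s a Ω g u → ∀ z ∈ frontier Ω, ∀ k : ℕ, ∃ m : ℝ, |m| ≤ K ∧
      ∀ y ∈ Ω, y ∈ ball z (r0 * (1 / 8 : ℝ) ^ k) →
        |u y - m * G.W y| ≤ E * ((1 / 8 : ℝ) ^ k) ^ α * G.W y := by
  obtain ⟨K, hK, hKb⟩ := barrier hn hs hs1 hA0 G
  obtain ⟨F, hF, hFb⟩ := frac_unif hn hs hs1 hA0 G
  obtain ⟨r0, hr0, hr01, κ, hκ, c2, hc2, C2, hC2, hgr⟩ := growth G hs hs1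
  have hL := G.L1
  have hL0 : 0 < G.L := by linarith
  have h1s : 0 < 1 - s := by linarith
  set c3 := min (c2 * κ / 2) (1 / 2) with hc3
  have hc30 : 0 < c3 := by positivity
  have hc31 : c3 ≤ c2 * κ / 2 := min_le_left _ _
  set F' := F + K * (n * G.L) * G.L with hF'
  have hF'0 : 0 < F' := by positivity
  set α := min (1 - s) (c3 / 14) with hα
  have hα0 : 0 < α := by positivity
  have hαs : α ≤ 1 - s := min_le_left _ _
  have hα2 : α ≤ c3 / 14 := min_le_right _ _
  have hθ : 1 - c3 / 2 ≤ (1 / 8 : ℝ) ^ α := by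
    rw [rpow_def_of_pos (by norm_num)]
    have h1 := add_one_le_exp (log (1 / 8) * α)
    have h2 : log (1 / 8 : ℝ) = - log 8 := by rw [one_div, log_inv]
    have h3 := log_le_sub_one_of_pos (by norm_num : (0:ℝ) < 8)
    rw [h2] at h1 ⊢
    have : log 8 * α ≤ 7 * (c3 / 14) := mul_le_mul (by linarith) hα2 hα0.le (by norm_num)
    linarith
  set E := 2 * K + 2 * C2 * F' / c3 with hE
  have hE0 : 0 < E := by positivity
  have hE1 : 2 * K ≤ E := by rw [hE]; have : 0 ≤ 2 * C2 * F' / c3 := by positivity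
                             linarith
  have hE2 : C2 * F' ≤ c3 / 2 * E := by
    have : c3 / 2 * (2 * C2 * F' / c3) = C2 * F' := by field_simp
    have : 0 ≤ c3 / 2 * (2 * K) := by positivity
    rw [hE]; linarith
  refine ⟨r0, hr0, hr01, α, hα0, hαs, K, hK, E, hE0, ?_⟩
  intro a ha g u S z hz
  have hpos : ∀ y ∈ Ω, 0 < G.W y := fun y hy => (G.pos_iff y).1 hy
  have hub : ∀ y ∈ Ω, |u y| ≤ K * G.W y := by
    intro y hy
    have := hKb a ha g u S y
    rwa [G.P_eq hy] at this
  have hfu : ∀ y ∈ frontier Ω, u y = 0 := by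
    intro y hy
    rw [G.isOpen.frontier_eq] at hy
    exact S.out y hy.2
  have hone : ∀ y ∈ Ω, 1 ≤ G.L * G.W y ^ (-s) := by
    intro y hy
    have h1 : G.W y ≤ G.L := (le_abs_self _).trans (G.bd y)
    have h2 : G.L ^ (-s) ≤ G.W y ^ (-s) := rpow_le_rpow_of_nonpos (hpos y hy) h1 (by linarith)
    have h3 : 1 ≤ G.L ^ (1 - s) := one_le_rpow hL h1s.le
    have h4 : G.L ^ (1 - s) = G.L * G.L ^ (-s) := by rw [sub_eq_add_neg, rpow_add hL0, rpow_one]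
    rw [h4] at h3
    exact h3.trans (by gcongr)
  have hlap : ∀ m : ℝ, |m| ≤ K → ∀ y ∈ Ω, |lap n u y| + |m * lap n G.W y| ≤ F' * G.W y ^ (-s) := by
    intro m hm y hy
    have h1 := hFb a ha g u S y hy
    have h2 := lap_abs_le G.smooth.contDiffAt (G.he y)
    rw [abs_mul]
    have h3 : |m| * |lap n G.W y| ≤ K * (n * G.L) := by gcongr
    have h4 : K * (n * G.L) * 1 ≤ K * (n * G.L) * (G.L * G.W y ^ (-s)) := by
      have := hone y hy
      gcongr
    rw [hF']
    linarith
  have ind : ∀ k : ℕ, ∃ m M : ℝ, -K ≤ m ∧ M ≤ K ∧ M - m ≤ E * ((1 / 8 : ℝ) ^ k) ^ α ∧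
      ∀ y ∈ Ω, y ∈ ball z (r0 * (1 / 8 : ℝ) ^ k) → m * G.W y ≤ u y ∧ u y ≤ M * G.W y := by
    intro k
    induction k with
    | zero =>
      refine ⟨-K, K, le_rfl, le_rfl, by simp; linarith, fun y hy _ => ?_⟩
      have := abs_le.1 (hub y hy)
      constructor <;> linarith
    | succ k ih =>
      obtain ⟨m, M, hmK, hMK, hd, hb⟩ := ih
      set q : ℝ := (1 / 8 : ℝ) ^ k with hq
      have hq0 : 0 < q := by positivity
      have hq1 : q ≤ 1 := pow_le_one₀ (by norm_num) (by norm_num)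
      have hrq : r0 * q ≤ q := mul_le_of_le_one_left hq0.le hr01
      obtain ⟨p, hp, hpb, hWp, hg⟩ := hgr z hz (r0 * q) (by positivity) (mul_le_of_le_one_right hr0.le hq1)
      set r := r0 * q with hr
      have hr0' : 0 < r := by positivity
      have hpp := hb p hp hpb
      have hWp0 := hpos p hp
      have hmM : m ≤ M := by
        have := hpp.1.trans hpp.2
        exact le_of_mul_le_mul_right this hWp0
      set b := c3 * (M - m) - C2 * F' * r ^ (1 - s) with hbdef
      have hq' : ((1 / 8 : ℝ) ^ (k + 1)) ^ α = (1 / 8 : ℝ) ^ α * q ^ α := by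
        rw [pow_succ, mul_comm, mul_rpow (by norm_num) hq0.le]
      have hballeq : r0 * (1 / 8 : ℝ) ^ (k + 1) = r / 8 := by rw [pow_succ, hr]; ring
      have hrs : r ^ (1 - s) ≤ q ^ α :=
        (rpow_le_rpow hr0'.le hrq h1s.le).trans (rpow_le_rpow_of_exponent_ge hq0 hq1 hαs)
      have hqα : 0 < q ^ α := by positivity
      have hdec : (M - m) - b ≤ E * ((1 / 8 : ℝ) ^ α * q ^ α) := by
        have t1 : (1 - c3) * (M - m) ≤ (1 - c3) * (E * q ^ α) := by
          have : c3 ≤ 1 / 2 := min_le_right _ _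
          exact mul_le_mul_of_nonneg_left hd (by linarith)
        have t2 : C2 * F' * r ^ (1 - s) ≤ c3 / 2 * E * q ^ α :=
          mul_le_mul hE2 hrs (by positivity) (by positivity)
        have t3 : (1 - c3 / 2) * (E * q ^ α) ≤ (1 / 8 : ℝ) ^ α * (E * q ^ α) := by gcongr
        rw [hbdef]; linarith
      have hdec0 : ∀ v : En n → ℝ, (M - m) / 2 * G.W p ≤ v p → b ≤ c2 * (v p / r) - C2 * F' * r ^ (1 - s) := by
        intro v hv
        have hmM' : 0 ≤ M - m := by linarith
        have t1 : (M - m) / 2 * (κ * r) ≤ v p := le_trans (by gcongr) hv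
        have t2 : (M - m) / 2 * κ ≤ v p / r := by rw [le_div_iff₀ hr0']; linarith
        have t3 : c2 * ((M - m) / 2 * κ) ≤ c2 * (v p / r) := by gcongr
        have t4 : c3 * (M - m) ≤ c2 * κ / 2 * (M - m) := by gcongr
        rw [hbdef]; linarith
      have habs : ∀ m : ℝ, -K ≤ m → m ≤ K → |m| ≤ K := fun m h1 h2 => abs_le.2 ⟨h1, h2⟩
      have hsm : ∀ y ∈ Ω, r / 8 ≤ r := fun _ _ => by linarith
      rw [hq', hballeq]
      have hWcd : ∀ y, ContDiffAt ℝ 2 G.W y := fun y => G.smooth.contDiffAt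
      have hucd : ∀ y ∈ Ω, ContDiffAt ℝ 2 u y := fun y hy => S.cd.contDiffAt (G.isOpen.mem_nhds hy)
      have hlm : ∀ m : ℝ, ∀ y, lap n (fun y => m * G.W y) y = m * lap n G.W y :=
        fun m y => lap_const_mul (hWcd y) m
      have hbb : ∀ y ∈ ball z (r / 8), y ∈ ball z r := fun y hy => ball_subset_ball (by linarith) hy
      rcases le_total ((M - m) / 2 * G.W p) (u p - m * G.W p) with hcase | hcase
      · have hh := hg (fun y => u y - m * G.W y) F' (S.ct.sub (continuous_const.mul G.smooth.continuous))
          (S.cd.sub (contDiffOn_const.mul G.smooth.contDiffOn)) hF'0.le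
          (fun y hy hyb => by linarith [(hb y hy hyb).1])
          (fun y hy => by simp [hfu y hy, G.front y hy])
          (fun y hy hyb => by
            rw [lap_sub (hucd y hy) (contDiffAt_const.mul (hWcd y)), hlm]
            exact (abs_sub _ _).trans (hlap m (habs m hmK (by linarith)) y hy))
        have hb0 := hdec0 (fun y => u y - m * G.W y) hcase
        refine ⟨max m (m + b), M, hmK.trans (le_max_left _ _), hMK, ?_, ?_⟩
        · have := le_max_right m (m + b)
          linarith
        · intro y hy hyb
          have h1 := hh y hy hyb
          have h2 := mul_le_mul_of_nonneg_right hb0 (hpos y hy).le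
          have h3 := hb y hy (hbb y hyb)
          refine ⟨?_, h3.2⟩
          rcases max_choice m (m + b) with h | h <;> rw [h]
          · exact h3.1
          · linarith
      · have hh := hg (fun y => M * G.W y - u y) F' ((continuous_const.mul G.smooth.continuous).sub S.ct)
          ((contDiffOn_const.mul G.smooth.contDiffOn).sub S.cd) hF'0.le
          (fun y hy hyb => by linarith [(hb y hy hyb).2])
          (fun y hy => by simp [hfu y hy, G.front y hy])
          (fun y hy hyb => by
            rw [lap_sub (contDiffAt_const.mul (hWcd y)) (hucd y hy), hlm]
            refine (abs_sub _ _).trans ?_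
            rw [add_comm]
            exact hlap M (habs M (by linarith) hMK) y hy)
        have hb0 := hdec0 (fun y => M * G.W y - u y) (by linarith)
        refine ⟨m, min M (M - b), hmK, (min_le_left _ _).trans hMK, ?_, ?_⟩
        · have := min_le_right M (M - b)
          linarith
        · intro y hy hyb
          have h1 := hh y hy hyb
          have h2 := mul_le_mul_of_nonneg_right hb0 (hpos y hy).le
          have h3 := hb y hy (hbb y hyb)
          refine ⟨h3.1, ?_⟩
          rcases min_choice M (M - b) with h | h <;> rw [h]
          · exact h3.2
          · linarith
  intro k
  obtain ⟨m, M, hmK, hMK, hd, hb⟩ := ind k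
  have hq0 : (0:ℝ) < (1 / 8 : ℝ) ^ k := by positivity
  have hq1 : (1 / 8 : ℝ) ^ k ≤ 1 := pow_le_one₀ (by norm_num) (by norm_num)
  obtain ⟨p, hp, hpb, hWp, _⟩ := hgr z hz (r0 * (1 / 8 : ℝ) ^ k) (by positivity) (mul_le_of_le_one_right hr0.le hq1)
  have hpp := hb p hp hpb
  have hmM : m ≤ M := le_of_mul_le_mul_right (hpp.1.trans hpp.2) (hpos p hp)
  refine ⟨m, abs_le.2 ⟨hmK, hmM.trans hMK⟩, fun y hy hyb => ?_⟩
  have h3 := hb y hy hyb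
  have h4 := mul_le_mul_of_nonneg_right hd (hpos y hy).le
  rw [abs_le]
  constructor <;> linarith

end

section

open MeasureTheory Real Set Metric Bornology Filter
open scoped RealInnerProductSpace ENNReal NNReal Pointwise

variable {n : ℕ}

set_option maxHeartbeats 1000000 in
lemma hess_W (hn : 1 ≤ n) {s A0 : ℝ} (hs : 0 < s) (hs1 : s < 1) (hA0 : 0 < A0) {Ω : Set (En n)}
    (G : Geo n Ω) : ∃ α > (0:ℝ), α < 1 ∧ ∃ C > 0, ∀ a ∈ Icc 0 A0, ∀ g u : En n → ℝ, Sol n s a Ω g u →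
      ∀ x ∈ Ω, ‖hess n u x‖ ≤ C * G.W x ^ (α - 1) := by
  obtain ⟨K0, hK0, hKb⟩ := barrier hn hs hs1 hA0 G
  obtain ⟨C1, hC1, hI⟩ := int_hess hn hs hs1 hA0 G
  obtain ⟨C2, hC2, hH⟩ := lap_hold hn hs hs1 hA0 G
  have h1s : 0 < 1 - s := by linarith
  obtain ⟨C3, hC3, hSch⟩ := schauder_loc n h1s
  obtain ⟨r0, hr0, hr01, α, hα0, hαs, K, hK, E, hE, hkr⟩ := krylov hn hs hs1 hA0 G
  have hL := G.L1
  have hL0 : 0 < G.L := by linarith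
  have hCd := G.Cd0
  set δ := r0 / (2 * (G.Cd + 1)) with hδ
  have hδ0 : 0 < δ := by positivity
  have hδ1 : δ ≤ 1 := by rw [hδ, div_le_one (by positivity)]; linarith
  set B := 16 * (G.Cd + 1) / r0 with hB
  have hB0 : 0 < B := by positivity
  set Q := 2 * C1 + K0 * (4 * G.L ^ 2) with hQ
  have hQ0 : 0 < Q := by positivity
  set C4 := C3 * (64 * G.L ^ 2 * (2 * E * B ^ α + K * G.L) + C2 * (Q + 1)) with hC4
  have hC40 : 0 < C4 := by positivity
  refine ⟨α, hα0, by linarith, C4 + C1 * δ ^ (-α), by positivity, ?_⟩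
  intro a ha g u S x hx
  set w := G.W x with hw
  have hw0 : 0 < w := (G.pos_iff x).1 hx
  have hwa : 0 < w ^ (α - 1) := by positivity
  have hδa : 0 < C1 * δ ^ (-α) := by positivity
  by_cases hwδ : w ≤ δ
  swap
  · push Not at hwδ
    have h1 := hI a ha g u S x hx
    have h2 : w ^ (-α) ≤ δ ^ (-α) := rpow_le_rpow_of_nonpos hδ0 hwδ.le (by linarith)
    have h3 : C1 / w = C1 * w ^ (-α) * w ^ (α - 1) := by
      rw [mul_assoc, ← rpow_add hw0, show -α + (α - 1) = -1 by ring, rpow_neg_one]; rfl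
    have h4 : C1 * w ^ (-α) * w ^ (α - 1) ≤ C1 * δ ^ (-α) * w ^ (α - 1) := by gcongr
    have h5 : 0 ≤ C4 * w ^ (α - 1) := by positivity
    rw [← hw, h3] at h1
    linarith
  have hw1 : w ≤ 1 := hwδ.trans hδ1
  obtain ⟨z, hz, hxz⟩ := G.near x hx
  obtain ⟨k, hk1, hk2⟩ := exists_nat_pow_near_of_lt_one (x := 2 * (G.Cd + 1) * w / r0) (y := (1 / 8 : ℝ))
    (by positivity) (by
      rw [div_le_one hr0]
      rw [hδ, le_div_iff₀ (by positivity)] at hwδ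
      linarith) (by norm_num) (by norm_num)
  obtain ⟨m, hm, hmb⟩ := hkr a ha g u S z hz k
  set q : ℝ := (1 / 8 : ℝ) ^ k with hq
  have hq0 : 0 < q := by positivity
  have hqB : q ≤ B * w := by
    rw [pow_succ] at hk1
    have : B * w = 8 * (2 * (G.Cd + 1) * w / r0) := by rw [hB]; ring
    rw [this]; linarith
  have hqr : 2 * (G.Cd + 1) * w ≤ r0 * q := by
    rw [div_le_iff₀ hr0] at hk2; linarith
  have hqα : q ^ α ≤ B ^ α * w ^ α := by
    rw [← mul_rpow hB0.le hw0.le]; exact rpow_le_rpow hq0.le hqB hα0.le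
  set r := w / (2 * G.L) with hr
  have hrp : 0 < r := by positivity
  have hrw : r ≤ w := div_le_self hw0.le (by linarith)
  have hhalf : ∀ y ∈ closedBall x r, y ∈ Ω ∧ w / 2 ≤ G.W y ∧ G.W y ≤ 2 * w := by
    intro y hy
    rw [mem_closedBall, dist_eq_norm] at hy
    exact G.half hx hy
  have hsub : ∀ y ∈ closedBall x (r / 4), y ∈ closedBall x r :=
    fun y hy => closedBall_subset_closedBall (by linarith) hy
  have hΛ : ∀ y ∈ closedBall x r, ‖hess n u y‖ ≤ 2 * C1 / w := by
    intro y hy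
    obtain ⟨h1, h2, h3⟩ := hhalf y hy
    refine (hI a ha g u S y h1).trans ?_
    rw [show 2 * C1 / w = C1 / (w / 2) by field_simp]
    gcongr
  have hHo := hH a ha g u S K0 hK0.le (hKb a ha g u S) x hx r (2 * C1 / w) hrp le_rfl hΛ
  set H := C2 * ((2 * C1 / w + K0 * G.W x / r ^ 2) * r ^ (1 - s) + 1) with hHdef
  rw [← hw] at hHdef
  have hHQ : H = C2 * (Q / w * r ^ (1 - s) + 1) := by
    have : K0 * w / r ^ 2 = K0 * (4 * G.L ^ 2) / w := by
      rw [hr]; field_simp; norm_num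
    rw [hHdef, this, ← add_div]
  have hH0 : 0 ≤ H := by rw [hHQ]; positivity
  have hfin := hSch Ω G.isOpen u S.cd x (r / 4) (2 * E * B ^ α * w ^ (α + 1) + K * G.L * w ^ 2) H (by positivity)
    (fun y hy => (hhalf y (hsub y hy)).1) hH0 (m * (w - fderiv ℝ G.W x x)) (m • fderiv ℝ G.W x)
    (by
      intro y hy
      obtain ⟨h1, h2, h3⟩ := hhalf y (hsub y hy)
      have hyx : ‖y - x‖ ≤ r / 4 := by rwa [mem_closedBall, dist_eq_norm] at hy
      have hyw : ‖y - x‖ ≤ w := by linarith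
      have e : u y - (m * (w - fderiv ℝ G.W x x) + (m • fderiv ℝ G.W x) y)
          = (u y - m * G.W y) + m * (G.W y - G.W x - fderiv ℝ G.W x (y - x)) := by
        rw [map_sub, ← hw]; simp only [_root_.smul_apply, smul_eq_mul]; ring
      rw [e]
      refine (abs_add_le _ _).trans ?_
      have b1 := hmb y h1 (by
        rw [mem_ball, dist_eq_norm]
        have := norm_add_le (y - x) (x - z)
        rw [sub_add_sub_cancel] at this
        have : G.Cd * w + w < 2 * (G.Cd + 1) * w := by nlinarith
        linarith)
      have b2 : E * q ^ α * G.W y ≤ E * (B ^ α * w ^ α) * (2 * w) := by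
        have : 0 ≤ G.W y := by linarith
        gcongr
      have b3 : w ^ (α + 1) = w ^ α * w := rpow_add_one hw0.ne' α
      have b4 : |m * (G.W y - G.W x - fderiv ℝ G.W x (y - x))| ≤ K * (G.L * w ^ 2) := by
        rw [abs_mul]
        have := G.tay x y
        have : G.L * ‖y - x‖ ^ 2 ≤ G.L * w ^ 2 := by gcongr
        exact mul_le_mul hm (by linarith) (abs_nonneg _) hK.le
      rw [b3]
      linarith)
    (fun y hy => hHo y (by rwa [mem_closedBall, dist_eq_norm] at hy))
  have hone : 1 ≤ w ^ (α - 1) := one_le_rpow_of_pos_of_le_one_of_nonpos hw0 hw1 (by linarith)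
  have f1 : (r / 4)⁻¹ ^ 2 * (2 * E * B ^ α * w ^ (α + 1) + K * G.L * w ^ 2)
      ≤ 64 * G.L ^ 2 * (2 * E * B ^ α + K * G.L) * w ^ (α - 1) := by
    have e1 : (r / 4)⁻¹ ^ 2 = 64 * G.L ^ 2 / w ^ 2 := by rw [hr]; field_simp; norm_num
    have e2 : w ^ (α + 1) = w ^ (α - 1) * w ^ 2 := by
      rw [← rpow_natCast w 2, ← rpow_add hw0]; congr 1; push_cast; ring
    rw [e1, e2]
    have e3 : 64 * G.L ^ 2 / w ^ 2 * (2 * E * B ^ α * (w ^ (α - 1) * w ^ 2) + K * G.L * w ^ 2)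
        = 64 * G.L ^ 2 * (2 * E * B ^ α * w ^ (α - 1) + K * G.L * 1) := by field_simp
    rw [e3, show 64 * G.L ^ 2 * (2 * E * B ^ α + K * G.L) * w ^ (α - 1)
      = 64 * G.L ^ 2 * (2 * E * B ^ α * w ^ (α - 1) + K * G.L * w ^ (α - 1)) by ring]
    gcongr
  have f2 : H * (r / 4) ^ (1 - s) ≤ C2 * (Q + 1) * w ^ (α - 1) := by
    have g1 : r ^ (1 - s) ≤ w ^ (1 - s) := rpow_le_rpow hrp.le hrw h1s.le
    have g2 : (r / 4) ^ (1 - s) ≤ w ^ (1 - s) := rpow_le_rpow (by positivity) (by linarith) h1s.le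
    have g3 : w ^ (1 - s) ≤ 1 := rpow_le_one hw0.le hw1 h1s.le
    have g4 : w⁻¹ * w ^ (1 - s) * w ^ (1 - s) ≤ w ^ (α - 1) := by
      rw [← rpow_neg_one, ← rpow_add hw0, ← rpow_add hw0]
      exact rpow_le_rpow_of_exponent_ge hw0 hw1 (by linarith)
    rw [hHQ]
    calc C2 * (Q / w * r ^ (1 - s) + 1) * (r / 4) ^ (1 - s)
        ≤ C2 * (Q / w * w ^ (1 - s) + 1) * w ^ (1 - s) := by gcongr
      _ = C2 * (Q * (w⁻¹ * w ^ (1 - s) * w ^ (1 - s)) + w ^ (1 - s)) := by rw [div_eq_mul_inv]; ring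
      _ ≤ C2 * (Q * w ^ (α - 1) + w ^ (α - 1)) := by
        have g5 := g3.trans hone
        have g6 := mul_le_mul_of_nonneg_left g4 hQ0.le
        exact mul_le_mul_of_nonneg_left (add_le_add g6 g5) hC2.le
      _ = _ := by ring
  calc ‖hess n u x‖ ≤ _ := hfin
    _ ≤ C3 * (64 * G.L ^ 2 * (2 * E * B ^ α + K * G.L) * w ^ (α - 1) + C2 * (Q + 1) * w ^ (α - 1)) := by gcongr
    _ = C4 * w ^ (α - 1) := by rw [hC4]; ring
    _ ≤ _ := by gcongr; linarith

lemma hess_final (hn : 1 ≤ n) {s A0 : ℝ} (hs : 0 < s) (hs1 : s < 1) (hA0 : 0 < A0) {Ω : Set (En n)}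
    (G : Geo n Ω) : ∃ α > (0:ℝ), α < 1 ∧ ∃ C > 0, ∀ a ∈ Icc 0 A0, ∀ g u : En n → ℝ, Sol n s a Ω g u →
      ∀ x ∈ Ω, ‖hess n u x‖ ≤ C * infDist x (frontier Ω) ^ (α - 1) := by
  obtain ⟨α, h0, h1, C, hC, h⟩ := hess_W hn hs hs1 hA0 G
  have hCd := G.Cd0
  refine ⟨α, h0, h1, C * G.Cd⁻¹ ^ (α - 1), by positivity, fun a ha g u S x hx => (h a ha g u S x hx).trans ?_⟩
  have hw0 : 0 < G.W x := (G.pos_iff x).1 hx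
  have d1 := G.W_le hx
  have d2 := G.dist_le hx
  have hL := G.L0
  have d0 : 0 < infDist x (frontier Ω) := by
    by_contra hc
    push Not at hc
    nlinarith
  rw [mul_assoc, ← mul_rpow (by positivity) d0.le]
  have : G.Cd⁻¹ * infDist x (frontier Ω) ≤ G.W x := by
    rw [inv_mul_le_iff₀ hCd]; exact d2
  have := rpow_le_rpow_of_nonpos (by positivity) this (by linarith : α - 1 ≤ 0)
  gcongr

theorem final_thm (n : ℕ) (hn : 1 ≤ n) (s : ℝ)
    (hs : s ∈ Set.Ioo (0:ℝ) 1) (A₀ : ℝ) (hA₀ : 0 < A₀) (D : C2Domain n) :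
    ∃ α ∈ Set.Ioo (0:ℝ) 1, ∃ C > (0:ℝ), ∀ a ∈ Set.Icc (0:ℝ) A₀, ∀ g u : En n → ℝ,
      (∃ M : ℝ, ∃ L : ℝ≥0, M + (L : ℝ) ≤ 1 ∧ (∀ x ∈ D.carrier, |g x| ≤ M) ∧
        LipschitzOnWith L g D.carrier) →
      ContDiffOn ℝ 2 u D.carrier → Continuous u →
      (∀ x ∈ D.carrier, -lap n u x + a * fracLap n s u x = g x) →
      (∀ x ∉ D.carrier, u x = 0) →
      ∀ x ∈ D.carrier,
        ‖hess n u x‖ ≤ C * infDist x (frontier D.carrier) ^ (α - 1) ∧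
        |fracLap n s u x| ≤ C * (1 + (if s < 1/2 then 1 else 0)
          + (if s = 1/2 then |Real.log (infDist x (frontier D.carrier))| else 0)
          + (if 1/2 < s then infDist x (frontier D.carrier) ^ (1 - 2*s) else 0)) := by
  obtain ⟨G⟩ := geo_exists hn D
  obtain ⟨α, h0, h1, C, hC, h⟩ := hess_final hn hs.1 hs.2 hA₀ G
  obtain ⟨C', hC', h'⟩ := frac_final hn hs.1 hs.2 hA₀ G
  refine ⟨α, ⟨h0, h1⟩, C + C', by positivity, ?_⟩
  rintro a ha g u ⟨M, L, hML, hgM, hgL⟩ hcd hct heq hout x hx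
  have hM0 : 0 ≤ M := (abs_nonneg _).trans (hgM x hx)
  have hL0 : (0:ℝ) ≤ L := L.2
  have S : Sol n s a D.carrier g u :=
    { gb := fun y hy => (hgM y hy).trans (by linarith)
      gl := fun y hy y' hy' => by
        have := hgL.dist_le_mul y hy y' hy'
        rw [Real.dist_eq, dist_eq_norm] at this
        exact this.trans (mul_le_of_le_one_left (norm_nonneg _) (by linarith))
      cd := hcd
      ct := hct
      eq := fun y hy => by linarith [heq y hy]
      out := hout }
  have hd : 0 ≤ infDist x (frontier D.carrier) := infDist_nonneg
  constructor
  · refine (h a ha g u S x hx).trans ?_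
    gcongr; linarith
  · refine (h' a ha g u S x hx).trans ?_
    have : 0 ≤ (1 + (if s < 1/2 then 1 else 0)
          + (if s = 1/2 then |Real.log (infDist x (frontier D.carrier))| else 0)
          + (if 1/2 < s then infDist x (frontier D.carrier) ^ (1 - 2*s) else 0) : ℝ) := by
      split_ifs <;> positivity
    exact mul_le_mul_of_nonneg_right (by linarith) this

end

/-- Theorem 2.2, interior estimates: there exist `α ∈ (0,1)` and `C > 0`
such that for every `a ∈ [0, A₀]`, every `g` with `‖g‖_{C^{0,1}(Ω)} ≤ 1`, and every
solution `u ∈ C²(Ω) ∩ C(ℝⁿ)` of `-Δu + a(-Δ)ˢu = g` in `Ω`, `u = 0` in `Ωᶜ`, one has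
`|D²u(x)| ≤ C dist(x,∂Ω)^{α-1}` and the stated bound on `|(-Δ)ˢu(x)|` in `Ω`. -/
theorem interior_second_derivative_estimates (n : ℕ) (hn : 1 ≤ n) (s : ℝ)
    (hs : s ∈ Set.Ioo (0:ℝ) 1) (A₀ : ℝ) (hA₀ : 0 < A₀) (D : C2Domain n) :
    ∃ α ∈ Set.Ioo (0:ℝ) 1, ∃ C > (0:ℝ), ∀ a ∈ Set.Icc (0:ℝ) A₀, ∀ g u : En n → ℝ,
      (∃ M : ℝ, ∃ L : ℝ≥0, M + (L : ℝ) ≤ 1 ∧ (∀ x ∈ D.carrier, |g x| ≤ M) ∧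
        LipschitzOnWith L g D.carrier) →
      ContDiffOn ℝ 2 u D.carrier → Continuous u →
      (∀ x ∈ D.carrier, -lap n u x + a * fracLap n s u x = g x) →
      (∀ x ∉ D.carrier, u x = 0) →
      ∀ x ∈ D.carrier,
        ‖hess n u x‖ ≤ C * infDist x (frontier D.carrier) ^ (α - 1) ∧
        |fracLap n s u x| ≤ C * (1 + (if s < 1/2 then 1 else 0)
          + (if s = 1/2 then |Real.log (infDist x (frontier D.carrier))| else 0)
          + (if 1/2 < s then infDist x (frontier D.carrier) ^ (1 - 2*s) else 0)) := by
  exact final_thm n hn s hs A₀ hA₀ D
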